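/- arXiv:1303.3857 — 4 statements merged into one kernel-verified Lean document; each statement's English description precedes it below -/
import Mathlib

section
/- Let A_{m,k} denote the set of start-small permutations of [m] avoiding 1243 and 2134 with exactly k key mid-123 entries. Then for all n ≥ 1 and k ≥ 1, |A_{n,k}| = Σ_{j=k+1}^{n−1} |A_{j,k−1}| · |A_{n+1−j,0}|. -/
/-- `π` contains the pattern 1243: indices `i < j < k < l` with `π i < π j < π l < π k`. -/
def Contains1243 {n : ℕ} (π : Equiv.Perm (Fin n)) : Prop :=
  ∃ i j k l : Fin n, i < j ∧ j < k ∧ k < l ∧ π i < π j ∧ π j < π l ∧ π l < π k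

/-- `π` contains the pattern 2134: indices `i < j < k < l` with `π j < π i < π k < π l`. -/
def Contains2134 {n : ℕ} (π : Equiv.Perm (Fin n)) : Prop :=
  ∃ i j k l : Fin n, i < j ∧ j < k ∧ k < l ∧ π j < π i ∧ π i < π k ∧ π k < π l

/-- `π` avoids both patterns 1243 and 2134. -/
def AvoidsBoth {n : ℕ} (π : Equiv.Perm (Fin n)) : Prop :=
  ¬ Contains1243 π ∧ ¬ Contains2134 π
/-- `π j` is a mid-123 entry: it serves as the "2" of a 123 pattern. -/
def IsMid123 {n : ℕ} (π : Equiv.Perm (Fin n)) (j : Fin n) : Prop :=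
  ∃ i k : Fin n, i < j ∧ j < k ∧ π i < π j ∧ π j < π k

/-- `π m` is a right-to-left maximum: it exceeds every entry to its right. -/
def IsRLMax {n : ℕ} (π : Equiv.Perm (Fin n)) (m : Fin n) : Prop :=
  ∀ m' : Fin n, m < m' → π m' < π m

/-- `π j` is a key mid-123 entry: a mid-123 entry whose immediate predecessor either is
smaller than `π j` or is a right-to-left maximum. -/
def IsKeyMid123 {n : ℕ} (π : Equiv.Perm (Fin n)) (j : Fin n) : Prop :=
  IsMid123 π j ∧ ∃ j' : Fin n, (j' : ℕ) + 1 = (j : ℕ) ∧ (π j' < π j ∨ IsRLMax π j')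

/-- `π` is start-small: it does not start with its largest entry `n`. -/
def StartSmall {n : ℕ} (π : Equiv.Perm (Fin n)) : Prop :=
  ∀ h : 0 < n, ((π ⟨0, h⟩ : ℕ)) + 1 ≠ n

/-- The number of key mid-123 entries of `π`. -/
noncomputable def keyCount {n : ℕ} (π : Equiv.Perm (Fin n)) : ℕ :=
  Nat.card {j : Fin n // IsKeyMid123 π j}

/-- `A n k` : start-small permutations of `[n]` avoiding 1243 and 2134 with exactly `k`
key mid-123 entries. -/
def A (n k : ℕ) : Set (Equiv.Perm (Fin n)) :=
  {π | StartSmall π ∧ AvoidsBoth π ∧ keyCount π = k}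

/-- `Apos n k j` : members of `A n k` whose last mid-123 entry is in (1-based) position `j`. -/
def Apos (n k j : ℕ) : Set (Equiv.Perm (Fin n)) :=
  {π | π ∈ A n k ∧ ∃ jf : Fin n, (jf : ℕ) + 1 = j ∧ IsMid123 π jf ∧
    ∀ j' : Fin n, jf < j' → ¬ IsMid123 π j'}



structure IsP (n : ℕ) (f : ℕ → ℕ) : Prop where
  lt : ∀ i, i < n → f i < n
  inj : ∀ i j, i < n → j < n → f i = f j → i = j
  out : ∀ i, n ≤ i → f i = 0

def C1 (n : ℕ) (f : ℕ → ℕ) : Prop :=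
  ∃ i j k l, i < j ∧ j < k ∧ k < l ∧ l < n ∧ f i < f j ∧ f j < f l ∧ f l < f k
def C2 (n : ℕ) (f : ℕ → ℕ) : Prop :=
  ∃ i j k l, i < j ∧ j < k ∧ k < l ∧ l < n ∧ f j < f i ∧ f i < f k ∧ f k < f l
def Mid (n : ℕ) (f : ℕ → ℕ) (j : ℕ) : Prop :=
  ∃ i k, i < j ∧ j < k ∧ k < n ∧ f i < f j ∧ f j < f k
def RL (n : ℕ) (f : ℕ → ℕ) (m : ℕ) : Prop := ∀ m', m < m' → m' < n → f m' < f m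
def Key (n : ℕ) (f : ℕ → ℕ) (j : ℕ) : Prop :=
  Mid n f j ∧ (f (j-1) < f j ∨ RL n f (j-1))
noncomputable def kc (n : ℕ) (f : ℕ → ℕ) : ℕ := Set.ncard {j | Key n f j}

structure AN (n k : ℕ) (f : ℕ → ℕ) : Prop where
  p : IsP n f
  ss : f 0 + 1 ≠ n
  c1 : ¬ C1 n f
  c2 : ¬ C2 n f
  kc : kc n f = k

structure PN (n k q : ℕ) (f : ℕ → ℕ) : Prop where
  a : AN n k f
  mid : Mid n f q
  last : ∀ i, q < i → ¬ Mid n f i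

/-! insertion and deletion -/
def up (v u : ℕ) : ℕ := if v ≤ u then u + 1 else u
def ins (n p v : ℕ) (g : ℕ → ℕ) (i : ℕ) : ℕ :=
  if n < i then 0 else if i < p then up v (g i) else if i = p then v else up v (g (i-1))
def sk (p i : ℕ) : ℕ := if i < p then i else i + 1
def del (n p v : ℕ) (f : ℕ → ℕ) (i : ℕ) : ℕ :=
  if n ≤ i then 0 else if v < f (sk p i) then f (sk p i) - 1 else f (sk p i)

theorem up_lt (v a b : ℕ) : up v a < up v b ↔ a < b := by unfold up; split_ifs <;> omega
theorem up_inj (v a b : ℕ) : up v a = up v b ↔ a = b := by unfold up; split_ifs <;> omega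
theorem up_ne (v a : ℕ) : up v a ≠ v := by unfold up; split_ifs <;> omega
theorem up_lt' (v a : ℕ) : up v a < v ↔ a < v := by unfold up; split_ifs <;> omega
theorem lt_up (v a : ℕ) : v < up v a ↔ v ≤ a := by unfold up; split_ifs <;> omega
theorem up_le (v a : ℕ) : up v a ≤ a + 1 := by unfold up; split_ifs <;> omega

theorem ins_isP {n p v : ℕ} {g : ℕ → ℕ} (hg : IsP n g) (hp : p ≤ n) (hv : v ≤ n) :
    IsP (n+1) (ins n p v g) := by
  have h1 := hg.lt
  have h2 := hg.inj
  refine ⟨?_, ?_, ?_⟩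
  · intro i hi
    have a1 := h1 i
    have a2 := h1 (i-1)
    have := up_le v (g i)
    have := up_le v (g (i-1))
    unfold ins; split_ifs <;> omega
  · intro i j hi hj
    have a1 := h2 i j
    have a2 := h2 (i-1) j
    have a3 := h2 i (j-1)
    have a4 := h2 (i-1) (j-1)
    have b1 := up_ne v (g i)
    have b2 := up_ne v (g (i-1))
    have b3 := up_ne v (g j)
    have b4 := up_ne v (g (j-1))
    unfold ins
    split_ifs <;> (try simp only [up_inj]) <;> omega
  · intro i hi
    unfold ins; split_ifs <;> omega

theorem del_isP {n p v : ℕ} {f : ℕ → ℕ} (hf : IsP (n+1) f) (hp : p ≤ n) (hv : f p = v) :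
    IsP n (del n p v f) := by
  have h1 := hf.lt
  have h2 := hf.inj
  have hvn := h1 p (by omega)
  have h3 : ∀ i, i < n → f (sk p i) ≠ v := by
    intro i hi h
    have := h2 (sk p i) p (by unfold sk; split_ifs <;> omega) (by omega) (by omega)
    unfold sk at this; split_ifs at this <;> omega
  have h4 : ∀ i j, i < n → j < n → f (sk p i) = f (sk p j) → i = j := by
    intro i j hi hj h
    have := h2 (sk p i) (sk p j) (by unfold sk; split_ifs <;> omega) (by unfold sk; split_ifs <;> omega) h
    unfold sk at this; split_ifs at this <;> omega
  refine ⟨?_, ?_, ?_⟩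
  · intro i hi
    have := h3 i hi
    have := h1 (sk p i) (by unfold sk; split_ifs <;> omega)
    unfold del; split_ifs <;> omega
  · intro i j hi hj
    have := h3 i hi
    have := h3 j hj
    have := h4 i j hi hj
    unfold del; split_ifs <;> omega
  · intro i hi
    unfold del; split_ifs <;> omega

theorem ins_del {n p v : ℕ} {f : ℕ → ℕ} (hf : IsP (n+1) f) (hp : p ≤ n) (hv : f p = v) :
    ins n p v (del n p v f) = f := by
  have h2 := hf.inj
  funext i
  by_cases hi : n < i
  · rw [hf.out i (by omega)]; simp [ins, hi]
  have h3 : i ≠ p → f i ≠ v := fun h h' => h (h2 i p (by omega) (by omega) (by omega))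
  rcases lt_trichotomy i p with h | h | h
  · have : sk p i = i := by simp [sk, h]
    simp only [ins, del, up, this]
    split_ifs <;> omega
  · subst h; simp [ins, hv, hi]
  · have : sk p (i-1) = i := by unfold sk; split_ifs <;> omega
    simp only [ins, del, up, this]
    split_ifs <;> omega

theorem ins_sk {n p v : ℕ} {g : ℕ → ℕ} {i : ℕ} (hi : i < n) (hp : p ≤ n) :
    ins n p v g (sk p i) = up v (g i) := by
  unfold sk ins
  by_cases h : i < p
  · rw [if_pos h, if_neg (by omega), if_pos h]
  · rw [if_neg h, if_neg (by omega), if_neg (by omega), if_neg (by omega), Nat.add_sub_cancel]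

theorem ins_p {n p v : ℕ} {g : ℕ → ℕ} (hp : p ≤ n) : ins n p v g p = v := by
  unfold ins; rw [if_neg (by omega), if_neg (by omega), if_pos rfl]

theorem del_ins {n p v : ℕ} {g : ℕ → ℕ} (hg : IsP n g) (hp : p ≤ n) :
    del n p v (ins n p v g) = g := by
  funext i
  by_cases hi : n ≤ i
  · rw [hg.out i (by omega)]; simp [del, hi]
  · unfold del; rw [ins_sk (by omega) hp]; unfold up; split_ifs <;> omega

theorem sk_lt {p i j : ℕ} : sk p i < sk p j ↔ i < j := by unfold sk; split_ifs <;> omega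
theorem sk_le {n p i : ℕ} (h : i < n) : sk p i < n + 1 := by unfold sk; split_ifs <;> omega
theorem sk_ne {p i : ℕ} : sk p i ≠ p := by unfold sk; split_ifs <;> omega
theorem exists_sk {n p i : ℕ} (hp : p ≤ n) (h : i ≠ p) (hi : i < n + 1) : ∃ i', i' < n ∧ i = sk p i' := by
  by_cases h' : i < p
  · exact ⟨i, by omega, by simp [sk, h']⟩
  · exact ⟨i-1, by omega, by unfold sk; split_ifs <;> omega⟩

/-- relation between `f` and `g` when `f` is obtained from `g` by an insertion at `p`. -/
structure InsRel (n p : ℕ) (f g : ℕ → ℕ) : Prop where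
  hp : p ≤ n
  lt : ∀ i j, i < n → j < n → (f (sk p i) < f (sk p j) ↔ g i < g j)

theorem ins_rel {n p v : ℕ} {g : ℕ → ℕ} (hp : p ≤ n) : InsRel n p (ins n p v g) g :=
  ⟨hp, fun i j hi hj => by rw [ins_sk hi hp, ins_sk hj hp, up_lt]⟩

theorem InsRel.c1 {n p : ℕ} {f g : ℕ → ℕ} (h : InsRel n p f g) (hc : C1 n g) : C1 (n+1) f := by
  obtain ⟨i, j, k, l, h1, h2, h3, h4, h5, h6, h7⟩ := hc
  exact ⟨sk p i, sk p j, sk p k, sk p l, sk_lt.2 h1, sk_lt.2 h2, sk_lt.2 h3, sk_le h4,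
    (h.lt _ _ (by omega) (by omega)).2 h5, (h.lt _ _ (by omega) (by omega)).2 h6,
    (h.lt _ _ (by omega) (by omega)).2 h7⟩
theorem InsRel.c2 {n p : ℕ} {f g : ℕ → ℕ} (h : InsRel n p f g) (hc : C2 n g) : C2 (n+1) f := by
  obtain ⟨i, j, k, l, h1, h2, h3, h4, h5, h6, h7⟩ := hc
  exact ⟨sk p i, sk p j, sk p k, sk p l, sk_lt.2 h1, sk_lt.2 h2, sk_lt.2 h3, sk_le h4,
    (h.lt _ _ (by omega) (by omega)).2 h5, (h.lt _ _ (by omega) (by omega)).2 h6,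
    (h.lt _ _ (by omega) (by omega)).2 h7⟩
theorem InsRel.mid {n p : ℕ} {f g : ℕ → ℕ} (h : InsRel n p f g) {j : ℕ} (hc : Mid n g j) :
    Mid (n+1) f (sk p j) := by
  obtain ⟨i, k, h1, h2, h3, h4, h5⟩ := hc
  exact ⟨sk p i, sk p k, sk_lt.2 h1, sk_lt.2 h2, sk_le h3,
    (h.lt _ _ (by omega) (by omega)).2 h4, (h.lt _ _ (by omega) (by omega)).2 h5⟩
/-- a pattern of `f` not using `p` is a pattern of `g`. -/
theorem InsRel.c1' {n p : ℕ} {f g : ℕ → ℕ} (h : InsRel n p f g) (hg : ¬ C1 n g) {i j k l : ℕ}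
    (h1 : i < j) (h2 : j < k) (h3 : k < l) (h4 : l < n + 1)
    (h5 : f i < f j) (h6 : f j < f l) (h7 : f l < f k) : i = p ∨ j = p ∨ k = p ∨ l = p := by
  by_contra! hh
  obtain ⟨a, b, c, d⟩ := hh
  obtain ⟨i, hi, rfl⟩ := exists_sk h.hp a (by omega)
  obtain ⟨j, hj, rfl⟩ := exists_sk h.hp b (by omega)
  obtain ⟨k, hk, rfl⟩ := exists_sk h.hp c (by omega)
  obtain ⟨l, hl, rfl⟩ := exists_sk h.hp d (by omega)
  exact hg ⟨i, j, k, l, sk_lt.1 h1, sk_lt.1 h2, sk_lt.1 h3, hl, (h.lt _ _ hi hj).1 h5,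
    (h.lt _ _ hj hl).1 h6, (h.lt _ _ hl hk).1 h7⟩
theorem InsRel.c2' {n p : ℕ} {f g : ℕ → ℕ} (h : InsRel n p f g) (hg : ¬ C2 n g) {i j k l : ℕ}
    (h1 : i < j) (h2 : j < k) (h3 : k < l) (h4 : l < n + 1)
    (h5 : f j < f i) (h6 : f i < f k) (h7 : f k < f l) : i = p ∨ j = p ∨ k = p ∨ l = p := by
  by_contra! hh
  obtain ⟨a, b, c, d⟩ := hh
  obtain ⟨i, hi, rfl⟩ := exists_sk h.hp a (by omega)
  obtain ⟨j, hj, rfl⟩ := exists_sk h.hp b (by omega)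
  obtain ⟨k, hk, rfl⟩ := exists_sk h.hp c (by omega)
  obtain ⟨l, hl, rfl⟩ := exists_sk h.hp d (by omega)
  exact hg ⟨i, j, k, l, sk_lt.1 h1, sk_lt.1 h2, sk_lt.1 h3, hl, (h.lt _ _ hj hi).1 h5,
    (h.lt _ _ hi hk).1 h6, (h.lt _ _ hk hl).1 h7⟩
theorem InsRel.mid' {n p : ℕ} {f g : ℕ → ℕ} (h : InsRel n p f g) {i j k : ℕ} (hi' : i ≠ p) (hk' : k ≠ p)
    (h1 : i < sk p j) (h2 : sk p j < k) (h4 : k < n + 1)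
    (h5 : f i < f (sk p j)) (h6 : f (sk p j) < f k) : Mid n g j := by
  obtain ⟨i, hi, rfl⟩ := exists_sk h.hp hi' (by omega)
  obtain ⟨k, hk, rfl⟩ := exists_sk h.hp hk' (by omega)
  have := sk_lt.1 h1
  have := sk_lt.1 h2
  exact ⟨i, k, sk_lt.1 h1, sk_lt.1 h2, hk, (h.lt _ _ hi (by omega)).1 h5,
    (h.lt _ _ (by omega) hk).1 h6⟩
/-- keys at positions `< p`, provided all mids in f can avoid `p`. -/
theorem InsRel.key {n p : ℕ} {f g : ℕ → ℕ} (h : InsRel n p f g) (hf : IsP (n+1) f) {j : ℕ} (hj : j < p)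
    (hm : Mid (n+1) f j → Mid n g j) (hr : ∀ i, i < p → f i < f p → ∃ t, p < t ∧ t < n + 1 ∧ f i < f t) :
    Key (n+1) f j ↔ Key n g j := by
  have hp := h.hp
  have hs : ∀ i, i < p → sk p i = i := fun i hi => by simp [sk, hi]
  have hm2 : Mid (n+1) f j ↔ Mid n g j := ⟨hm, fun h' => by simpa [hs j hj] using h.mid h'⟩
  unfold Key
  rw [hm2]
  refine and_congr_right (fun hmm => or_congr ?_ ?_)
  · rw [← h.lt (j-1) j (by omega) (by omega), hs j hj, hs (j-1) (by omega)]
  · constructor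
    · intro hR m hm1 hm2
      rw [← h.lt _ _ (by omega) (by omega)]
      rw [hs (j-1) (by omega)]
      apply hR _ _ (sk_le hm2)
      rw [← hs (j-1) (by omega)]; exact sk_lt.2 hm1
    · intro hR m hm1 hm2
      have key : ∀ m, j - 1 < m → m < n + 1 → m ≠ p → f m < f (j-1) := by
        intro m hm1 hm2 hmp
        obtain ⟨m, hm, rfl⟩ := exists_sk hp hmp hm2
        have := (h.lt m (j-1) hm (by omega)).2 (hR m (by
          rw [← hs (j-1) (by omega)] at hm1; exact sk_lt.1 hm1) hm)
        rwa [hs (j-1) (by omega)] at this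
      by_cases hmp : m = p
      · subst hmp
        by_contra hcon
        have hne : f (j-1) ≠ f m := by
          intro hh
          have := hf.inj (j-1) m (by omega) (by omega) hh
          omega
        obtain ⟨t, ht1, ht2, ht3⟩ := hr (j-1) (by omega) (by omega)
        have := key t (by omega) ht2 (by omega)
        omega
      · exact key m hm1 hm2 hmp

theorem card_eq (S T : Set (ℕ → ℕ)) (F G : (ℕ → ℕ) → (ℕ → ℕ)) (h1 : ∀ x ∈ S, F x ∈ T)
    (h2 : ∀ x ∈ T, G x ∈ S) (h3 : ∀ x ∈ S, G (F x) = x) (h4 : ∀ x ∈ T, F (G x) = x) :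
    Nat.card S = Nat.card T :=
  Nat.card_congr ⟨fun x => ⟨F x, h1 x x.2⟩, fun x => ⟨G x, h2 x x.2⟩,
    fun x => Subtype.ext (h3 x x.2), fun x => Subtype.ext (h4 x x.2)⟩


theorem card_rel {α β : Type*} (S : Set α) (T : Set β) (R : α → β → Prop)
    (h1 : ∀ x ∈ S, ∃ y ∈ T, R x y) (h2 : ∀ y ∈ T, ∃ x ∈ S, R x y)
    (h3 : ∀ x ∈ S, ∀ y ∈ T, ∀ y' ∈ T, R x y → R x y' → y = y')
    (h4 : ∀ x ∈ S, ∀ x' ∈ S, ∀ y ∈ T, R x y → R x' y → x = x') : Nat.card S = Nat.card T := by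
  choose F hF hF' using h1
  refine Nat.card_congr (Equiv.ofBijective (fun x : S => (⟨F x x.2, hF x x.2⟩ : T)) ⟨?_, ?_⟩)
  · intro x x' h
    have h' : F x x.2 = F x' x'.2 := congrArg Subtype.val h
    have := hF' x' x'.2
    rw [← h'] at this
    exact Subtype.ext (h4 x x.2 x' x'.2 _ (hF x x.2) (hF' x x.2) this)
  · rintro ⟨y, hy⟩
    obtain ⟨x, hx, hxy⟩ := h2 y hy
    exact ⟨⟨x, hx⟩, Subtype.ext (h3 x hx _ (hF x hx) y hy (hF' x hx) hxy)⟩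

theorem IsP.surj {n : ℕ} {f : ℕ → ℕ} (h : IsP n f) {v : ℕ} (hv : v < n) : ∃ i, i < n ∧ f i = v := by
  have h1 : Finset.image f (Finset.range n) = Finset.range n := by
    apply Finset.eq_of_subset_of_card_le
    · intro x hx
      simp only [Finset.mem_image, Finset.mem_range] at hx ⊢
      obtain ⟨a, ha, rfl⟩ := hx
      exact h.lt a ha
    · rw [Finset.card_image_of_injOn]
      intro a ha b hb hab
      simp only [Finset.coe_range, Set.mem_Iio] at ha hb
      exact h.inj a b ha hb hab
  have : v ∈ Finset.image f (Finset.range n) := by rw [h1]; simpa using hv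
  simpa using this

theorem IsP.low {n : ℕ} {f : ℕ → ℕ} (h : IsP n f) (D : Finset ℕ) (hD : ∀ i ∈ D, i < n)
    (hlt : ∀ i ∈ D, ∀ j, j < n → j ∉ D → f i < f j) (i : ℕ) (hi : i < n) :
    f i < D.card ↔ i ∈ D := by
  have hc : (D.image f).card = D.card := by
    apply Finset.card_image_of_injOn
    intro a ha b hb hab
    exact h.inj a b (hD a ha) (hD b hb) hab
  constructor
  · intro hlt'
    by_contra hiD
    have : D.image f ⊆ Finset.range (f i) := by
      intro x hx
      obtain ⟨a, ha, rfl⟩ := Finset.mem_image.1 hx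
      exact Finset.mem_range.2 (hlt a ha i hi hiD)
    have := Finset.card_le_card this
    rw [hc, Finset.card_range] at this
    omega
  · intro hiD
    have : Finset.range (f i + 1) ⊆ D.image f := by
      intro x hx
      have hx' := Finset.mem_range.1 hx
      have := h.lt i hi
      obtain ⟨a, ha, rfl⟩ := h.surj (v := x) (by omega)
      by_cases haD : a ∈ D
      · exact Finset.mem_image_of_mem f haD
      · have := hlt i hiD a ha haD
        omega
    have := Finset.card_le_card this
    rw [hc, Finset.card_range] at this
    omega

theorem endmin_iff {n k : ℕ} {g : ℕ → ℕ} (hn : 1 ≤ n) (hg : IsP n g) :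
    AN (n+1) k (ins n n 0 g) ↔ AN n k g := by
  have hf := ins_isP (v := 0) hg le_rfl (Nat.zero_le n)
  have hr : InsRel n n (ins n n 0 g) g := ins_rel le_rfl
  have h0 : ins n n 0 g 0 = g 0 + 1 := by simp [ins, up]; omega
  have hnn : ins n n 0 g n = 0 := ins_p le_rfl
  set f := ins n n 0 g with hfdef
  have hm : ∀ j, Mid (n+1) f j → j < n ∧ Mid n g j := by
    rintro j ⟨i, l, h1, h2, h3, h4, h5⟩
    have hj : j < n := by omega
    have hs : sk n j = j := by simp [sk, hj]
    refine ⟨hj, hr.mid' (i := i) (k := l) (by omega) ?_ ?_ ?_ h3 ?_ ?_⟩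
    · rintro rfl; omega
    all_goals rw [hs]; assumption
  have hk : {j | Key (n+1) f j} = {j | Key n g j} := by
    ext j
    simp only [Set.mem_ofPred_eq]
    by_cases hj : j < n
    · exact hr.key hf hj (fun h => (hm j h).2) (fun i _ h => by omega)
    · constructor
      · intro h; exact absurd (hm j h.1).1 hj
      · rintro ⟨⟨i, l, h1, h2, h3, h4, h5⟩, _⟩; omega
  have hkc : kc (n+1) f = kc n g := by unfold kc; rw [hk]
  constructor
  · intro h
    refine ⟨hg, ?_, fun hc => h.c1 (hr.c1 hc), fun hc => h.c2 (hr.c2 hc), by rw [← hkc]; exact h.kc⟩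
    have := h.ss
    omega
  · intro h
    refine ⟨hf, ?_, ?_, ?_, by rw [hkc]; exact h.kc⟩
    · have := h.ss
      omega
    · rintro ⟨i, j, k, l, h1, h2, h3, h4, h5, h6, h7⟩
      rcases hr.c1' h.c1 h1 h2 h3 h4 h5 h6 h7 with rfl | rfl | rfl | rfl <;> omega
    · rintro ⟨i, j, k, l, h1, h2, h3, h4, h5, h6, h7⟩
      rcases hr.c2' h.c2 h1 h2 h3 h4 h5 h6 h7 with rfl | rfl | rfl | rfl <;> omega

theorem endmin_card {n k : ℕ} (hn : 1 ≤ n) :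
    Nat.card {f | AN (n+1) k f ∧ f n = 0} = Nat.card {g | AN n k g} := by
  apply card_eq _ _ (del n n 0) (ins n n 0)
  · rintro f ⟨hf, h0⟩
    have h1 := ins_del hf.p le_rfl h0
    have h2 := del_isP hf.p le_rfl h0
    exact (endmin_iff hn h2).1 (by rw [h1]; exact hf)
  · intro g hg
    exact ⟨(endmin_iff hn (AN.p hg)).2 hg, ins_p le_rfl⟩
  · rintro f ⟨hf, h0⟩
    exact ins_del hf.p le_rfl h0
  · intro g hg
    exact del_ins (AN.p hg) le_rfl

theorem PN.struct {n k q d : ℕ} {f : ℕ → ℕ} (h : PN n k q f) (hn : n = q + 1 + d) :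
    ∃ α t, α < q ∧ q < t ∧ t < n ∧ f α < f q ∧ f q < f t ∧
      ∀ i, i < n → (f i < d ↔ i = α ∨ (q < i ∧ i ≠ t)) := by
  obtain ⟨i0, t, h1, h2, h3, h4, h5⟩ := h.mid
  obtain ⟨α, hα, hmin⟩ := Finset.exists_min_image (Finset.range q) f ⟨i0, by simpa using h1⟩
  simp only [Finset.mem_range] at hα hmin
  have hαq : f α < f q := lt_of_le_of_lt (hmin i0 h1) h4
  have hinj := h.a.p.inj
  have hafter : ∀ u, q < u → u < n → u ≠ t → f u < f q := by
    intro u hu hun hut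
    by_contra hc
    have e1 := hinj u q hun (by omega)
    have e2 := hinj u t hun (by omega)
    rcases lt_trichotomy u t with hl | hl | hl
    · rcases lt_or_ge (f u) (f t) with hh | hh
      · exact h.last u hu ⟨q, t, hu, hl, h3, by omega, hh⟩
      · exact h.a.c1 ⟨α, q, u, t, hα, hu, hl, h3, hαq, h5, by omega⟩
    · exact hut hl
    · rcases lt_or_ge (f u) (f t) with hh | hh
      · exact h.a.c1 ⟨α, q, t, u, hα, h2, hl, hun, hαq, by omega, hh⟩
      · exact h.last t h2 ⟨q, u, h2, hl, hun, h5, by omega⟩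
  have hbef : ∀ u, q < u → u < n → u ≠ t → ∀ x, x < q → x ≠ α → f u < f x := by
    intro u hu hun hut x hx hxα
    by_contra hc
    have e1 := hinj u x hun (by omega)
    have e2 := hinj x α (by omega) (by omega)
    have e3 := hmin x hx
    have e4 := hafter u hu hun hut
    have hpos : α < x := by
      by_contra hp
      exact h.a.c2 ⟨x, α, q, t, by omega, hα, h2, h3, by omega, by omega, h5⟩
    rcases lt_or_gt_of_ne hut with hl | hl
    · exact h.last u hu ⟨x, t, by omega, hl, h3, by omega, by omega⟩
    · exact h.a.c1 ⟨α, x, t, u, hpos, by omega, hl, hun, by omega, by omega, by omega⟩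
  refine ⟨α, t, hα, h2, h3, hαq, h5, ?_⟩
  have hD := h.a.p.low (insert α ((Finset.Ioo q n).erase t)) ?_ ?_
  · intro i hi
    have hcard : (insert α ((Finset.Ioo q n).erase t)).card = d := by
      rw [Finset.card_insert_of_notMem (by simp; omega), Finset.card_erase_of_mem (by simp; omega)]
      simp; omega
    rw [← hcard, hD i hi]
    simp only [Finset.mem_insert, Finset.mem_erase, Finset.mem_Ioo]
    constructor
    · rintro (h | h) <;> omega
    · rintro (h | h) <;> omega
  · intro i hi
    simp only [Finset.mem_insert, Finset.mem_erase, Finset.mem_Ioo] at hi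
    omega
  · intro i hi j hj hjD
    simp only [Finset.mem_insert, Finset.mem_erase, Finset.mem_Ioo] at hi hjD
    have hj' : j ≠ α ∧ (j = t ∨ j ≤ q) := by omega
    rcases hi with rfl | ⟨hit, hiq, hin⟩
    · rcases hj'.2 with rfl | hjq
      · omega
      · rcases eq_or_lt_of_le hjq with rfl | hjq
        · exact hαq
        · have := hmin j hjq
          have := hinj j i hj (by omega)
          omega
    · have := hafter i hiq hin hit
      rcases hj'.2 with rfl | hjq
      · omega
      · rcases eq_or_lt_of_le hjq with rfl | hjq
        · exact this
        · exact hbef i hiq hin hit j hjq hj'.1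

theorem keys_eq {n p α t : ℕ} {f g : ℕ → ℕ} (hr : InsRel n p f g) (hf : IsP (n+1) f)
    (_hα : α < p) (ht : p < t) (htn : t < n + 1) (_h1 : f α < f p) (h2 : f p < f t)
    (hlast : ∀ i, p < i → ¬ Mid (n+1) f i) (j : ℕ) :
    Key n g j ↔ j < p ∧ Key (n+1) f j := by
  by_cases hj : j < p
  · rw [hr.key hf hj ?_ ?_]
    · simp [hj]
    · rintro ⟨i, k, a1, a2, a3, a4, a5⟩
      have hs : sk p j = j := by simp [sk, hj]
      by_cases hk : k = p
      · subst hk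
        exact hr.mid' (i := i) (k := t) (by omega) (by omega) (by omega) (by omega) htn
          (by rw [hs]; exact a4) (by rw [hs]; omega)
      · exact hr.mid' (i := i) (k := k) (by omega) hk (by omega) (by omega) a3
          (by rw [hs]; exact a4) (by rw [hs]; omega)
    · intro i hi hlt
      exact ⟨t, ht, htn, by omega⟩
  · simp only [hj, false_and, iff_false]
    rintro ⟨hm, _⟩
    refine hlast _ ?_ (hr.mid hm)
    unfold sk; split_ifs; omega


theorem PN.nonkey {n k q d : ℕ} {f : ℕ → ℕ} (h : PN n k q f) (hn : n = q + 1 + d)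
    (hk : ¬ Key n f q) : f q = d := by
  obtain ⟨α, t, hα, ht, htn, h1, h2, hlow⟩ := h.struct hn
  have hinj := h.a.p.inj
  obtain ⟨i0, hi0, hv⟩ := h.a.p.surj (v := d) (by omega)
  have a1 := hlow q (by omega)
  have a2 := hlow i0 hi0
  have a3 := hlow t htn
  by_contra hne
  have hk' : ¬ (f (q-1) < f q ∨ RL n f (q-1)) := fun hh => hk ⟨h.mid, hh⟩
  have b1 := hinj (q-1) q (by omega) (by omega)
  have hi : i0 < q := by
    by_contra hc
    have : i0 ≠ q := by rintro rfl; omega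
    have : i0 ≠ t := by rintro rfl; omega
    omega
  have hiα : i0 ≠ α := by rintro rfl; omega
  have c1 := hlow α (by omega)
  have hpos : α < i0 := by
    by_contra hp
    exact h.a.c2 ⟨i0, α, q, t, by omega, hα, ht, htn, by omega, by omega, h2⟩
  have : i0 ≠ q - 1 := by rintro rfl; omega
  exact h.a.c1 ⟨α, i0, q-1, q, hpos, by omega, by omega, by omega, by omega, by omega, by omega⟩

theorem nk_fwd {n k q d : ℕ} {g : ℕ → ℕ} (hn : n = q + 1 + d) (hg : IsP n g)
    (h : PN (n+1) k (q+1) (ins n (q+1) d g)) (hk : ¬ Key (n+1) (ins n (q+1) d g) (q+1)) :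
    PN n k q g := by
  have hr : InsRel n (q+1) (ins n (q+1) d g) g := ins_rel (by omega)
  have h0 : ins n (q+1) d g 0 = up d (g 0) := by simp [ins]
  set f := ins n (q+1) d g with hfdef
  have hfp : f (q+1) = d := ins_p (by omega)
  have hf := h.a.p
  obtain ⟨α, t, hα, ht, htn, h1, h2, hlow⟩ := h.struct (d := d) (by omega)
  have hkeys := keys_eq hr hf hα ht htn h1 h2 h.last
  have hk' : ¬ (f q < f (q+1) ∨ RL (n+1) f q) := fun hh => hk ⟨h.mid, hh⟩
  push Not at hk'
  obtain ⟨hk1, hk2⟩ := hk'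
  have hk3 : ∃ m, q < m ∧ m < n + 1 ∧ f q ≤ f m := by
    unfold RL at hk2; push Not at hk2; exact hk2
  obtain ⟨m, hm1, hm2, hm3⟩ := hk3
  have e1 := hf.inj q (q+1) (by omega) (by omega)
  have e2 := hf.inj q m (by omega) (by omega)
  have hs : sk (q+1) q = q := by simp [sk]
  have hαq : α ≠ q := by rintro rfl; omega
  have hmq : m ≠ q+1 := by rintro rfl; omega
  refine ⟨⟨hg, ?_, fun hc => h.a.c1 (hr.c1 hc), fun hc => h.a.c2 (hr.c2 hc), ?_⟩, ?_, ?_⟩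
  · have := h.a.ss
    rw [h0] at this
    unfold up at this; split_ifs at this <;> omega
  · rw [← h.a.kc]
    unfold kc
    congr 1
    ext j
    simp only [Set.mem_ofPred_eq]
    rw [hkeys]
    constructor
    · exact fun h => h.2
    · intro hj
      refine ⟨?_, hj⟩
      by_contra hc
      rcases eq_or_lt_of_le (not_lt.1 hc) with he | he
      · exact hk (he ▸ hj)
      · exact h.last j he hj.1
  · exact hr.mid' (i := α) (k := m) (by omega) hmq (by omega) (by omega) hm2 (by rw [hs]; omega) (by rw [hs]; omega)
  · intro i hi hm
    refine h.last _ ?_ (hr.mid hm)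
    unfold sk; split_ifs <;> omega

theorem nk_bwd {n k q d : ℕ} {g : ℕ → ℕ} (hn : n = q + 1 + d)
    (h : PN n k q g) :
    PN (n+1) k (q+1) (ins n (q+1) d g) ∧ ¬ Key (n+1) (ins n (q+1) d g) (q+1) := by
  have hg := h.a.p
  have hr : InsRel n (q+1) (ins n (q+1) d g) g := ins_rel (by omega)
  have h0 : ins n (q+1) d g 0 = up d (g 0) := by simp [ins]
  have hf : IsP (n+1) (ins n (q+1) d g) := ins_isP hg (by omega) (by omega)
  obtain ⟨α, t, hα, ht, htn, h1, h2, hlow⟩ := h.struct hn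
  have hlow' : ∀ i, i < n + 1 → (ins n (q+1) d g i < d ↔ i = α ∨ (q + 1 < i ∧ i ≠ t + 1)) := by
    intro i hi
    have e1 := hlow i
    have e2 := hlow (i-1)
    unfold ins
    split_ifs <;> (try simp only [up_lt']) <;> omega
  have hq : d < ins n (q+1) d g q := by
    have := hlow q (by omega)
    have e : ins n (q+1) d g q = up d (g q) := by
      unfold ins; rw [if_neg (by omega), if_pos (by omega)]
    rw [e, lt_up]
    omega
  set f := ins n (q+1) d g with hfdef
  have hfp : f (q+1) = d := ins_p (by omega)
  have hft : d < f (t+1) := by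
    have := hlow' (t+1) (by omega)
    have := hf.inj (t+1) (q+1) (by omega) (by omega)
    omega
  have hqt : f q < f (t+1) := by
    have e : sk (q+1) q = q := by simp [sk]
    have e' : sk (q+1) t = t+1 := by unfold sk; split_ifs <;> omega
    rw [← e, ← e', hr.lt _ _ (by omega) (by omega)]
    exact h2
  have hfα : f α < d := by
    have := hlow' α (by omega)
    omega
  have hlast : ∀ i, q + 1 < i → ¬ Mid (n+1) f i := by
    rintro i hi ⟨a, b, a1, a2, a3, a4, a5⟩
    have hs : sk (q+1) (i-1) = i := by unfold sk; split_ifs <;> omega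
    refine h.last (i-1) (by omega) ?_
    by_cases ha : a = q + 1
    · subst ha
      exact hr.mid' (i := α) (k := b) (by omega) (by omega) (by omega) (by omega) a3 (by rw [hs]; omega) (by rw [hs]; omega)
    · exact hr.mid' (i := a) (k := b) (by omega) (by omega) (by omega) (by omega) a3 (by rw [hs]; omega) (by rw [hs]; omega)
  have hkeys := keys_eq hr hf (α := α) (t := t+1) (by omega) (by omega) (by omega) (by omega) (by omega) hlast
  have hnk : ¬ Key (n+1) f (q+1) := by
    rintro ⟨_, hh | hh⟩
    · simp at hh; omega
    · have := hh (t+1) (by omega) (by omega)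
      simp at this; omega
  refine ⟨⟨⟨hf, ?_, ?_, ?_, ?_⟩, ?_, hlast⟩, hnk⟩
  · have := h.a.ss
    have := hg.lt 0 (by omega)
    rw [h0]
    unfold up; split_ifs <;> omega
  · rintro ⟨i, j, k, l, b1, b2, b3, b4, b5, b6, b7⟩
    have := hr.c1' h.a.c1 b1 b2 b3 b4 b5 b6 b7
    have c1 := hlow' i (by omega)
    have c2 := hlow' j (by omega)
    have c3 := hlow' k (by omega)
    have c4 := hlow' l (by omega)
    rcases this with rfl | rfl | rfl | rfl <;> omega
  · rintro ⟨i, j, k, l, b1, b2, b3, b4, b5, b6, b7⟩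
    have := hr.c2' h.a.c2 b1 b2 b3 b4 b5 b6 b7
    have c1 := hlow' i (by omega)
    have c2 := hlow' j (by omega)
    have c3 := hlow' k (by omega)
    have c4 := hlow' l (by omega)
    rcases this with rfl | rfl | rfl | rfl <;> omega
  · rw [← h.a.kc]
    unfold kc
    congr 1
    ext j
    simp only [Set.mem_ofPred_eq]
    rw [hkeys]
    constructor
    · intro hj
      refine ⟨?_, hj⟩
      by_contra hc
      rcases eq_or_lt_of_le (not_lt.1 hc) with he | he
      · exact hnk (he ▸ hj)
      · exact hlast j he hj.1
    · exact fun h => h.2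
  · exact ⟨α, t+1, by omega, by omega, by omega, by omega, by omega⟩

theorem nk_card {n k q d : ℕ} (hn : n = q + 1 + d) :
    Nat.card {f | PN (n+1) k (q+1) f ∧ ¬ Key (n+1) f (q+1)} = Nat.card {g | PN n k q g} := by
  apply card_eq _ _ (del n (q+1) d) (ins n (q+1) d)
  · rintro f ⟨hf, h0⟩
    have h00 := hf.nonkey (d := d) (by omega) h0
    have h1 := ins_del hf.a.p (by omega) h00
    have h2 := del_isP hf.a.p (by omega) h00
    exact nk_fwd hn h2 (by rw [h1]; exact hf) (by rw [h1]; exact h0)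
  · intro g hg
    exact nk_bwd hn hg
  · rintro f ⟨hf, h0⟩
    have h00 := hf.nonkey (d := d) (by omega) h0
    exact ins_del hf.a.p (by omega) h00
  · intro g hg
    exact del_ins (PN.a hg).p (by omega)

structure KP (n k q d : ℕ) (f : ℕ → ℕ) : Prop where
  a : AN n k f
  last : ∀ i, q ≤ i → ¬ Mid n f i
  low : ∃ α t, α < q ∧ q ≤ t ∧ t < n ∧ ∀ i, i < n → (f i < d ↔ i = α ∨ (q ≤ i ∧ i ≠ t))

def VV (n q d : ℕ) (g : ℕ → ℕ) (v : ℕ) : Prop :=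
  ∃ t y, q ≤ t ∧ t < n ∧ d ≤ g t ∧ y < q ∧ g y < g t ∧ (∀ x, y < x → x < q → g t < g x) ∧
    v = max d (g y + 1)

theorem k_fwd {n k q d : ℕ} {g : ℕ → ℕ} {v : ℕ} (hn : n = q + d) (hg : IsP n g) (hv : v ≤ n)
    (h : PN (n+1) (k+1) q (ins n q v g)) (hk : Key (n+1) (ins n q v g) q) :
    KP n k q d g ∧ VV n q d g v := by
  have hr : InsRel n q (ins n q v g) g := ins_rel (by omega)
  obtain ⟨α, t, hα, ht, htn, h1, h2, hlow⟩ := h.struct (d := d) (by omega)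
  have hs1 : ∀ i, i < q → ins n q v g i = up v (g i) := by
    intro i hi
    have e : sk q i = i := by simp [sk, hi]
    conv_lhs => rw [← e]
    exact ins_sk (by omega) (by omega)
  have hs2 : ∀ i, q ≤ i → i < n → ins n q v g (i+1) = up v (g i) := by
    intro i hi hin
    have e : sk q i = i + 1 := by unfold sk; split_ifs <;> omega
    conv_lhs => rw [← e]
    exact ins_sk (by omega) (by omega)
  set f := ins n q v g with hfdef
  have hfp : f q = v := ins_p (by omega)
  have hf := h.a.p
  have hinj := hf.inj
  have hkeys := keys_eq hr hf hα ht htn h1 h2 h.last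
  have hdv : d ≤ v := by
    have := hlow q (by omega)
    omega
  have hup : ∀ u, up v u < d ↔ u < d := by
    intro u; unfold up; split_ifs <;> omega
  refine ⟨⟨⟨hg, ?_, fun hc => h.a.c1 (hr.c1 hc), fun hc => h.a.c2 (hr.c2 hc), ?_⟩, ?_, ?_⟩, ?_⟩
  · have a1 := h.a.ss
    have a2 := hf.lt t htn
    rw [hs1 0 (by omega)] at a1
    unfold up at a1; split_ifs at a1 <;> omega
  · have a1 := h.a.kc
    have : {j | Key (n+1) f j} = insert q {j | Key n g j} := by
      ext j
      simp only [Set.mem_ofPred_eq, Set.mem_insert_iff]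
      rw [hkeys]
      constructor
      · intro hj
        rcases lt_trichotomy j q with hl | hl | hl
        · exact Or.inr ⟨hl, hj⟩
        · exact Or.inl hl
        · exact absurd hj.1 (h.last j hl)
      · rintro (rfl | hj)
        · exact hk
        · exact hj.2
    have hfin : Set.Finite {j | Key n g j} := by
      apply Set.Finite.subset (Set.finite_Iio q)
      intro j hj
      exact ((hkeys j).1 hj).1
    unfold kc at a1 ⊢
    rw [this, Set.ncard_insert_of_notMem ?_ hfin] at a1
    · omega
    · simp only [Set.mem_ofPred_eq]; rw [hkeys]; simp
  · intro i hi hm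
    refine h.last _ ?_ (hr.mid hm)
    unfold sk; split_ifs <;> omega
  · refine ⟨α, t-1, hα, by omega, by omega, ?_⟩
    intro i hi
    rw [← hup (g i)]
    by_cases hiq : i < q
    · rw [← hs1 i hiq, hlow i (by omega)]; omega
    · rw [← hs2 i (by omega) hi, hlow (i+1) (by omega)]; omega
  · -- the value
    have hex : ∃ y, y < q ∧ f y < f t ∧ ∀ x, y < x → x < q → f t < f x := by
      obtain ⟨y, hy, hmax⟩ := Finset.exists_max_image ((Finset.range q).filter (fun x => f x < f t)) id
        ⟨α, by simp; omega⟩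
      simp only [Finset.mem_filter, Finset.mem_range, id] at hy hmax
      refine ⟨y, hy.1, hy.2, ?_⟩
      intro x hx hxq
      by_contra hc
      have := hinj x t (by omega) htn
      have := hmax x ⟨hxq, by omega⟩
      omega
    obtain ⟨y, hyq, hyt, hyl⟩ := hex
    have hyv : f y < f q := by
      by_contra hc
      have e1 := hinj y q (by omega) (by omega)
      have hyα : y ≠ α := by rintro rfl; omega
      have hαy : α < y := by
        by_contra hh
        have := hyl α (by omega) hα
        omega
      have hyq1 : y ≠ q - 1 := by
        rintro rfl
        rcases hk.2 with hh | hh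
        · omega
        · have := hh t (by omega) htn
          omega
      have e2 := hyl (q-1) (by omega) (by omega)
      exact h.a.c1 ⟨α, y, q-1, t, hαy, by omega, by omega, htn, by omega, by omega, by omega⟩
    have hgy : g y = f y := by
      rw [hs1 y hyq] at hyv ⊢
      rw [hfp, up_lt'] at hyv
      unfold up; split_ifs <;> omega
    have hgt : up v (g (t-1)) = f t := by
      rw [← hs2 (t-1) (by omega) (by omega)]; congr 1; omega
    have hgt2 : v ≤ g (t-1) := by
      rw [← lt_up, hgt]; omega
    refine ⟨t-1, y, by omega, by omega, by omega, hyq, by omega, ?_, ?_⟩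
    · intro x hx hxq
      rw [← up_lt v, hgt, ← hs1 x hxq]
      exact hyl x hx hxq
    · by_contra hne
      have hlt : max d (g y + 1) < v := by omega
      obtain ⟨i0, hi0, hiv⟩ := hf.surj (v := v - 1) (by omega)
      have e1 := hlow i0 hi0
      have e2 : i0 ≠ q := by rintro rfl; omega
      have e3 : i0 ≠ t := by rintro rfl; omega
      have e4 : i0 < q := by omega
      have e5 : i0 ≠ y := by rintro rfl; omega
      have e6 : i0 < y := by
        by_contra hh
        have := hyl i0 (by omega) e4
        omega
      exact h.a.c2 ⟨i0, y, q, t, e6, hyq, ht, htn, by omega, by omega, by omega⟩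

theorem k_bwd {n k q d : ℕ} {g : ℕ → ℕ} (hn : n = q + d) (h : KP n k q d g) :
    ∃ v, v ≤ n ∧ VV n q d g v ∧ PN (n+1) (k+1) q (ins n q v g) ∧ Key (n+1) (ins n q v g) q := by
  have hg := h.a.p
  obtain ⟨α, t, hα, ht, htn, hlow⟩ := h.low
  have hdt : d ≤ g t := by
    have := hlow t htn
    omega
  have hαd : g α < d := by
    have := hlow α (by omega)
    omega
  have hex : ∃ y, y < q ∧ g y < g t ∧ ∀ x, y < x → x < q → g t < g x := by
    obtain ⟨y, hy, hmax⟩ := Finset.exists_max_image ((Finset.range q).filter (fun x => g x < g t)) id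
      ⟨α, by simp; omega⟩
    simp only [Finset.mem_filter, Finset.mem_range, id] at hy hmax
    refine ⟨y, hy.1, hy.2, ?_⟩
    intro x hx hxq
    by_contra hc
    have := hg.inj x t (by omega) htn
    have := hmax x ⟨hxq, by omega⟩
    omega
  obtain ⟨y, hyq, hyt, hyl⟩ := hex
  obtain ⟨v, hv⟩ : ∃ v, v = max d (g y + 1) := ⟨_, rfl⟩
  have hvt : v ≤ g t := by omega
  have hgt := hg.lt t htn
  refine ⟨v, by omega, ⟨t, y, ht, htn, hdt, hyq, hyt, hyl, hv⟩, ?_⟩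
  have hr : InsRel n q (ins n q v g) g := ins_rel (by omega)
  have hf : IsP (n+1) (ins n q v g) := ins_isP hg (by omega) (by omega)
  have hs1 : ∀ i, i < q → ins n q v g i = up v (g i) := by
    intro i hi
    have e : sk q i = i := by simp [sk, hi]
    conv_lhs => rw [← e]
    exact ins_sk (by omega) (by omega)
  have hs2 : ∀ i, q ≤ i → i < n → ins n q v g (i+1) = up v (g i) := by
    intro i hi hin
    have e : sk q i = i + 1 := by unfold sk; split_ifs <;> omega
    conv_lhs => rw [← e]
    exact ins_sk (by omega) (by omega)
  have hup : ∀ u, up v u < d ↔ u < d := by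
    intro u; unfold up; split_ifs <;> omega
  have hfp : ins n q v g q = v := ins_p (by omega)
  have hlow' : ∀ i, i < n + 1 → (ins n q v g i < d ↔ i = α ∨ (q < i ∧ i ≠ t + 1)) := by
    intro i hi
    rcases lt_trichotomy i q with hl | hl | hl
    · rw [hs1 i hl, hup, hlow i (by omega)]; omega
    · subst hl; omega
    · obtain ⟨i, rfl⟩ : ∃ i', i = i' + 1 := ⟨i-1, by omega⟩
      rw [hs2 i (by omega) (by omega), hup, hlow i (by omega)]; omega
  have hft : ins n q v g (t+1) = g t + 1 := by
    rw [hs2 t ht htn]; unfold up; split_ifs; rfl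
  have hfy : ins n q v g y = g y := by
    rw [hs1 y hyq]; unfold up; split_ifs <;> omega
  have hyl' : ∀ x, y < x → x < q → ins n q v g (t+1) < ins n q v g x := by
    intro x hx hxq
    rw [hs2 t ht htn, hs1 x hxq, up_lt]
    exact hyl x hx hxq
  have hbelow : ∀ x, x < q → ins n q v g x < v → ins n q v g x < d ∨ ins n q v g x ≤ ins n q v g y := by
    intro x hxq hx
    rw [hfy]
    rw [hs1 x hxq] at hx ⊢
    unfold up at hx ⊢; split_ifs at hx ⊢ <;> omega
  have h0 := hs1 0 (by omega)
  set f := ins n q v g with hfdef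
  have hinj := hf.inj
  have hlast : ∀ i, q < i → ¬ Mid (n+1) f i := by
    rintro i hi ⟨a, b, a1, a2, a3, a4, a5⟩
    have hs : sk q (i-1) = i := by unfold sk; split_ifs <;> omega
    refine h.last (i-1) (by omega) ?_
    by_cases ha : a = q
    · have e1 := hlow' i (by omega)
      have e2 := hlow' b (by omega)
      subst ha
      omega
    · exact hr.mid' (i := a) (k := b) (by omega) (by omega) (by omega) (by omega) a3 (by rw [hs]; omega) (by rw [hs]; omega)
  have hfα : f α < d := by
    have := hlow' α (by omega)
    omega
  have hkeys := keys_eq hr hf (α := α) (t := t+1) (by omega) (by omega) (by omega) (by omega) (by omega) hlast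
  have hmid : Mid (n+1) f q := ⟨α, t+1, by omega, by omega, by omega, by omega, by omega⟩
  have hkey : Key (n+1) f q := by
    refine ⟨hmid, ?_⟩
    by_cases hyq1 : y = q - 1
    · left; subst hyq1; omega
    · right
      intro m hm1 hm2
      have e1 := hyl' (q-1) (by omega) (by omega)
      have e2 := hlow' m hm2
      by_cases hmq : m = q
      · subst hmq; omega
      by_cases hmt : m = t+1
      · subst hmt; omega
      · omega
  refine ⟨⟨⟨hf, ?_, ?_, ?_, ?_⟩, hmid, hlast⟩, hkey⟩
  · have := h.a.ss
    have := hg.lt 0 (by omega)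
    rw [h0]
    unfold up; split_ifs <;> omega
  · rintro ⟨i, j, k, l, b1, b2, b3, b4, b5, b6, b7⟩
    have hor := hr.c1' h.a.c1 b1 b2 b3 b4 b5 b6 b7
    have c1 := hlow' i (by omega)
    have c2 := hlow' j (by omega)
    have c3 := hlow' k (by omega)
    have c4 := hlow' l (by omega)
    have hlt : l = t + 1 → f l = f (t+1) := fun hh => by rw [hh]
    have hl : l = q := by
      rcases hor with rfl | rfl | rfl | rfl <;> omega
    subst hl
    have d1 := hbelow j (by omega) (by omega)
    have d2 := hinj j y (by omega) (by omega)
    have d3 := hinj k (t+1) (by omega) (by omega)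
    have key1 : f (t+1) < f k → False := by
      intro hh
      have := hr.c1' h.a.c1 b1 b2 (show k < t+1 by omega) (by omega) b5 (by omega) hh
      omega
    have hkt : f k < f (t+1) := by
      by_contra hc
      exact key1 (by omega)
    have hky : k ≤ y := by
      by_contra hc
      have := hyl' k (by omega) (by omega)
      omega
    have hky' : k ≠ y := by rintro rfl; omega
    have := hr.c1' h.a.c1 b1 b2 (show k < y by omega) (by omega) b5 (by omega) (by omega)
    omega
  · rintro ⟨i, j, k, l, b1, b2, b3, b4, b5, b6, b7⟩
    have hor := hr.c2' h.a.c2 b1 b2 b3 b4 b5 b6 b7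
    have c1 := hlow' i (by omega)
    have c2 := hlow' j (by omega)
    have c3 := hlow' k (by omega)
    have c4 := hlow' l (by omega)
    have hl : k = q ∨ l = q := by
      rcases hor with rfl | rfl | rfl | rfl <;> omega
    rcases hl with hl | hl
    · subst hl
      have d1 := hbelow i (by omega) (by omega)
      have d2 := hinj i y (by omega) (by omega)
      have hjy : j ≤ y := by
        by_contra hc
        have := hyl' j (by omega) (by omega)
        omega
      have hjy' : j ≠ y := by rintro rfl; omega
      have := hr.c2' h.a.c2 b1 (show j < y by omega) (show y < t+1 by omega) (by omega) b5 (by omega) (by omega)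
      omega
    · subst hl
      have := hr.c2' h.a.c2 b1 b2 (show k < t+1 by omega) (by omega) b5 b6 (by omega)
      omega
  · have a1 := h.a.kc
    have : {j | Key (n+1) f j} = insert q {j | Key n g j} := by
      ext j
      simp only [Set.mem_ofPred_eq, Set.mem_insert_iff]
      rw [hkeys]
      constructor
      · intro hj
        rcases lt_trichotomy j q with hl | hl | hl
        · exact Or.inr ⟨hl, hj⟩
        · exact Or.inl hl
        · exact absurd hj.1 (hlast j hl)
      · rintro (rfl | hj)
        · exact hkey
        · exact hj.2
    have hfin : Set.Finite {j | Key n g j} := by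
      apply Set.Finite.subset (Set.finite_Iio q)
      intro j hj
      exact ((hkeys j).1 hj).1
    unfold kc at a1 ⊢
    rw [this, Set.ncard_insert_of_notMem ?_ hfin]
    · omega
    · simp only [Set.mem_ofPred_eq]; rw [hkeys]; simp

theorem VV_unique {n k q d : ℕ} {g : ℕ → ℕ} (h : KP n k q d g) {v v' : ℕ} (h1 : VV n q d g v)
    (h2 : VV n q d g v') : v = v' := by
  obtain ⟨α, t, hα, ht, htn, hlow⟩ := h.low
  obtain ⟨t1, y1, a1, a2, a3, a4, a5, a6, a7⟩ := h1
  obtain ⟨t2, y2, b1, b2, b3, b4, b5, b6, b7⟩ := h2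
  have e1 : t1 = t := by have := hlow t1 a2; omega
  have e2 : t2 = t := by have := hlow t2 b2; omega
  subst e1; subst e2
  have : y1 = y2 := by
    rcases lt_trichotomy y1 y2 with hl | hl | hl
    · have := a6 y2 hl b4; omega
    · exact hl
    · have := b6 y1 hl a4; omega
  subst this
  omega

theorem k_card {n k q d : ℕ} (hn : n = q + d) :
    Nat.card {f | PN (n+1) (k+1) q f ∧ Key (n+1) f q} = Nat.card {g | KP n k q d g} := by
  apply card_rel _ _ (fun f g => ∃ v, VV n q d g v ∧ f = ins n q v g)
  · rintro f ⟨hf, hk⟩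
    have h1 := ins_del hf.a.p (p := q) (by omega) rfl
    have h2 := del_isP hf.a.p (p := q) (by omega) rfl
    have h3 := hf.a.p.lt q (by omega)
    obtain ⟨h4, h5⟩ := k_fwd hn h2 (v := f q) (k := k) (by omega) (by rw [h1]; exact hf) (by rw [h1]; exact hk)
    exact ⟨_, h4, _, h5, h1.symm⟩
  · intro g hg
    obtain ⟨v, h1, h2, h3, h4⟩ := k_bwd hn hg
    exact ⟨_, ⟨h3, h4⟩, v, h2, rfl⟩
  · rintro f ⟨hf, hk⟩ g hg g' hg' ⟨v, hv, e⟩ ⟨v', hv', e'⟩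
    have e1 : f q = v := by rw [e]; exact ins_p (by omega)
    have e2 : f q = v' := by rw [e']; exact ins_p (by omega)
    have e3 : v = v' := by omega
    subst e3
    rw [← del_ins (v := v) (KP.a hg).p (show q ≤ n by omega), ← del_ins (v := v) (KP.a hg').p (show q ≤ n by omega), ← e, ← e']
  · rintro f _ f' _ g hg ⟨v, hv, e⟩ ⟨v', hv', e'⟩
    rw [e, e', VV_unique hg hv hv']


theorem AN.nomid {n : ℕ} {f : ℕ → ℕ} (h : AN n 0 f) (j : ℕ) : ¬ Mid n f j := by
  classical
  intro hj
  have hex : ∃ j, Mid n f j := ⟨j, hj⟩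
  have hm := Nat.find_spec hex
  have hmin := fun m => Nat.find_min hex (m := m)
  generalize Nat.find hex = j0 at hm hmin
  have hk : Key n f j0 := by
    refine ⟨hm, ?_⟩
    by_contra hc
    unfold RL at hc
    push Not at hc
    obtain ⟨hc1, m, hm1, hm2, hm3⟩ := hc
    obtain ⟨a, b, h1, h2, h3, h4, h5⟩ := hm
    have e1 := h.p.inj (j0-1) j0 (by omega) (by omega)
    have e2 := h.p.inj (j0-1) m (by omega) (by omega)
    have e3 : a ≠ j0 - 1 := by rintro rfl; omega
    exact hmin (j0-1) (by omega) ⟨a, m, by omega, hm1, hm2, by omega, by omega⟩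
  have hfin : Set.Finite {j | Key n f j} := by
    apply Set.Finite.subset (Set.finite_Iio n)
    rintro j ⟨⟨a, b, h1, h2, h3, _⟩, _⟩
    exact Set.mem_Iio.2 (by omega)
  have := h.kc
  unfold _root_.kc at this
  rw [Set.ncard_eq_zero hfin] at this
  have h' : j0 ∈ {j | Key n f j} := hk
  rw [this] at h'
  exact h'

theorem AN.of_nomid {n : ℕ} {f : ℕ → ℕ} (hp : IsP n f) (hs : f 0 + 1 ≠ n) (h : ∀ j, ¬ Mid n f j) :
    AN n 0 f := by
  refine ⟨hp, hs, ?_, ?_, ?_⟩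
  · rintro ⟨i, j, k, l, b1, b2, b3, b4, b5, b6, b7⟩
    exact h j ⟨i, k, b1, b2, by omega, b5, by omega⟩
  · rintro ⟨i, j, k, l, b1, b2, b3, b4, b5, b6, b7⟩
    exact h k ⟨i, l, by omega, b3, b4, b6, b7⟩
  · unfold _root_.kc
    have : {j | Key n f j} = ∅ := by
      ext j; simp only [Set.mem_ofPred_eq, Set.mem_empty_iff_false, iff_false]
      exact fun hk => h j hk.1
    rw [this, Set.ncard_empty]

structure Glue (n q d α t : ℕ) (ρ lam σ : ℕ → ℕ) : Prop where
  hn : n = q + d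
  hd : 1 ≤ d
  hα : α < q
  ht : q ≤ t
  htn : t < n
  pr : IsP n ρ
  pl : IsP (q+1) lam
  ps : IsP (d+1) σ
  low : ∀ i, i < n → (ρ i < d ↔ i = α ∨ (q ≤ i ∧ i ≠ t))
  l0 : lam α = 0
  l1 : ∀ i, i < q → i ≠ α → ρ i = lam i + (d - 1) ∧ 1 ≤ lam i
  l2 : ρ t = lam q + (d - 1) ∧ 1 ≤ lam q
  s0 : σ 0 = ρ α
  s1 : ∀ i, q ≤ i → i < n → i ≠ t → σ (i - q + 1) = ρ i
  s2 : σ (t - q + 1) = d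

theorem Glue.cmpL {n q d α t : ℕ} {ρ lam σ : ℕ → ℕ} (h : Glue n q d α t ρ lam σ) (i j : ℕ)
    (hi : i < q) (hj : j < q) : ρ i < ρ j ↔ lam i < lam j := by
  have := h.hn; have := h.hd; have := h.hα
  have a1 := h.l1 i hi
  have a2 := h.l1 j hj
  have b1 := h.low i (by omega)
  have b2 := h.low j (by omega)
  have c := h.l0
  by_cases e1 : i = α
  · by_cases e2 : j = α
    · subst e1; subst e2; omega
    · subst e1; omega
  · by_cases e2 : j = α
    · subst e2; omega
    · omega

theorem Glue.cmpM {n q d α t : ℕ} {ρ lam σ : ℕ → ℕ} (h : Glue n q d α t ρ lam σ) (i : ℕ)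
    (hi : i < q) : (ρ i < ρ t ↔ lam i < lam q) ∧ (ρ t < ρ i ↔ lam q < lam i) := by
  have := h.hn; have := h.hd; have := h.hα; have := h.ht
  have a1 := h.l1 i hi
  have a2 := h.l2
  have b1 := h.low i (by omega)
  have b2 := h.low t h.htn
  have c := h.l0
  by_cases e1 : i = α
  · subst e1; omega
  · omega

def eL (q t i : ℕ) : ℕ := if i < q then i else t
def eS (q α i : ℕ) : ℕ := if i = 0 then α else q + i - 1

theorem Glue.eL_cmp {n q d α t : ℕ} {ρ lam σ : ℕ → ℕ} (h : Glue n q d α t ρ lam σ) (i j : ℕ)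
    (hi : i < q + 1) (hj : j < q + 1) : ρ (eL q t i) < ρ (eL q t j) ↔ lam i < lam j := by
  unfold eL
  split_ifs with a b b
  · exact h.cmpL i j a b
  · obtain rfl : j = q := by omega
    exact (h.cmpM i a).1
  · obtain rfl : i = q := by omega
    exact (h.cmpM j b).2
  · obtain rfl : j = q := by omega
    obtain rfl : i = j := by omega
    simp

theorem Glue.eS_val {n q d α t : ℕ} {ρ lam σ : ℕ → ℕ} (h : Glue n q d α t ρ lam σ) (i : ℕ)
    (hi : i < d + 1) : (eS q α i = t ∧ σ i = d) ∨ (σ i = ρ (eS q α i) ∧ ρ (eS q α i) < d) := by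
  have := h.hn; have := h.hd; have := h.hα; have := h.ht
  unfold eS
  split_ifs with a
  · subst a
    right
    have := h.low α (by omega)
    exact ⟨h.s0, by omega⟩
  · by_cases e : q + i - 1 = t
    · left
      refine ⟨e, ?_⟩
      rw [← h.s2]; congr 1; omega
    · right
      have := h.low (q+i-1) (by omega)
      refine ⟨?_, by omega⟩
      rw [← h.s1 (q+i-1) (by omega) (by omega) e]; congr 1; omega

theorem Glue.eS_cmp {n q d α t : ℕ} {ρ lam σ : ℕ → ℕ} (h : Glue n q d α t ρ lam σ) (i j : ℕ)
    (hi : i < d + 1) (hj : j < d + 1) : ρ (eS q α i) < ρ (eS q α j) ↔ σ i < σ j := by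
  have := h.ht
  have b2 := h.low t h.htn
  have := h.hα
  rcases h.eS_val i hi with ⟨a1, a2⟩ | ⟨a1, a2⟩ <;> rcases h.eS_val j hj with ⟨b1, b2⟩ | ⟨b1, b2⟩
  · rw [a1, b1]; omega
  · rw [a1]; omega
  · rw [b1]; omega
  · omega

theorem Glue.kc_eq {n q d α t : ℕ} {ρ lam σ : ℕ → ℕ} (h : Glue n q d α t ρ lam σ)
    (hlast : ∀ i, q ≤ i → ¬ Mid n ρ i) : kc n ρ = kc (q+1) lam := by
  have hn := h.hn; have hd := h.hd; have hα := h.hα; have ht := h.ht; have htn := h.htn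
  unfold kc
  congr 1
  ext j
  simp only [Set.mem_ofPred_eq]
  by_cases hj : j < q
  · unfold Key
    have hM : Mid n ρ j ↔ Mid (q+1) lam j := by
      constructor
      · rintro ⟨a, b, h1, h2, h3, h4, h5⟩
        have e1 := h.low j (by omega)
        have e2 := h.low b (by omega)
        have e3 := h.low a (by omega)
        by_cases hb : b < q
        · exact ⟨a, b, h1, h2, by omega, (h.cmpL _ _ (by omega) hj).1 h4, (h.cmpL _ _ hj hb).1 h5⟩
        · have : b = t := by omega
          subst this
          exact ⟨a, q, h1, hj, by omega, (h.cmpL _ _ (by omega) hj).1 h4, (h.cmpM _ hj).1.1 h5⟩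
      · rintro ⟨a, b, h1, h2, h3, h4, h5⟩
        by_cases hb : b < q
        · exact ⟨a, b, h1, h2, by omega, (h.cmpL _ _ (by omega) hj).2 h4, (h.cmpL _ _ hj hb).2 h5⟩
        · have : b = q := by omega
          subst this
          exact ⟨a, t, h1, by omega, by omega, (h.cmpL _ _ (by omega) hj).2 h4, (h.cmpM _ hj).1.2 h5⟩
    rw [hM]
    refine and_congr_right (fun hmm => or_congr (h.cmpL _ _ (by omega) hj) ?_)
    have hj0 : 0 < j := by obtain ⟨a, b, h1, _⟩ := hmm; omega
    constructor
    · intro hR m hm1 hm2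
      by_cases hm : m < q
      · exact (h.cmpL _ _ hm (by omega)).1 (hR m hm1 (by omega))
      · have : m = q := by omega
        subst this
        exact (h.cmpM _ (by omega)).2.1 (hR t (by omega) (by omega))
    · intro hR m hm1 hm2
      have hq := hR q (by omega) (by omega)
      by_cases hm : m < q
      · exact (h.cmpL _ _ hm (by omega)).2 (hR m hm1 (by omega))
      · by_cases hmt : m = t
        · subst hmt
          exact (h.cmpM _ (by omega)).2.2 hq
        · have e1 := h.low m hm2
          have e2 := h.low (j-1) (by omega)
          have : j - 1 ≠ α := by
            intro hh
            rw [hh, h.l0] at hq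
            omega
          omega
  · constructor
    · intro hk; exact absurd hk.1 (hlast j (by omega))
    · rintro ⟨⟨a, b, h1, h2, h3, _⟩, _⟩; omega

theorem Glue.ss {n q d α t : ℕ} {ρ lam σ : ℕ → ℕ} (h : Glue n q d α t ρ lam σ) :
    ρ 0 + 1 ≠ n ↔ lam 0 + 1 ≠ q + 1 := by
  have hn := h.hn; have hd := h.hd; have hα := h.hα; have ht := h.ht; have htn := h.htn
  have e1 := h.low 0 (by omega)
  have e2 := h.l1 0 (by omega)
  have e3 := h.l0
  by_cases e : α = 0
  · subst e; omega
  · omega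

theorem Glue.fwd {n q d α t k : ℕ} {ρ lam σ : ℕ → ℕ} (h : Glue n q d α t ρ lam σ)
    (ha : AN n k ρ) (hlast : ∀ i, q ≤ i → ¬ Mid n ρ i) : AN (q+1) k lam ∧ AN (d+1) 0 σ := by
  have hn := h.hn; have hd := h.hd; have hα := h.hα; have ht := h.ht; have htn := h.htn
  have mono : ∀ i j, i < j → j < q + 1 → eL q t i < eL q t j := by
    intro i j hij hj; unfold eL; split_ifs <;> omega
  have bd : ∀ i, eL q t i < n := by
    intro i; unfold eL; split_ifs <;> omega
  constructor
  · refine ⟨h.pl, h.ss.1 ha.ss, ?_, ?_, by rw [← h.kc_eq hlast]; exact ha.kc⟩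
    · rintro ⟨i, j, k, l, b1, b2, b3, b4, b5, b6, b7⟩
      exact ha.c1 ⟨_, _, _, _, mono i j b1 (by omega), mono j k b2 (by omega), mono k l b3 b4, bd l,
        (h.eL_cmp _ _ (by omega) (by omega)).2 b5, (h.eL_cmp _ _ (by omega) (by omega)).2 b6,
        (h.eL_cmp _ _ (by omega) (by omega)).2 b7⟩
    · rintro ⟨i, j, k, l, b1, b2, b3, b4, b5, b6, b7⟩
      exact ha.c2 ⟨_, _, _, _, mono i j b1 (by omega), mono j k b2 (by omega), mono k l b3 b4, bd l,
        (h.eL_cmp _ _ (by omega) (by omega)).2 b5, (h.eL_cmp _ _ (by omega) (by omega)).2 b6,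
        (h.eL_cmp _ _ (by omega) (by omega)).2 b7⟩
  · apply AN.of_nomid h.ps
    · have := h.low α (by omega)
      rw [h.s0]; omega
    · rintro j ⟨a, b, h1, h2, h3, h4, h5⟩
      have hs : ∀ i, eS q α i = if i = 0 then α else q + i - 1 := fun _ => rfl
      refine hlast (eS q α j) ?_ ⟨eS q α a, eS q α b, ?_, ?_, ?_,
        (h.eS_cmp _ _ (by omega) (by omega)).2 h4, (h.eS_cmp _ _ (by omega) (by omega)).2 h5⟩
      all_goals unfold eS; split_ifs <;> omega

theorem Glue.bwd {n q d α t k : ℕ} {ρ lam σ : ℕ → ℕ} (h : Glue n q d α t ρ lam σ)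
    (hl : AN (q+1) k lam) (hs : AN (d+1) 0 σ) : KP n k q d ρ := by
  have hn := h.hn; have hd := h.hd; have hα := h.hα; have ht := h.ht; have htn := h.htn
  have tL : ∀ x, x < q ∨ x = t → ∃ x', x' < q + 1 ∧ x = eL q t x' := by
    rintro x (hx | hx)
    · exact ⟨x, by omega, by simp [eL, hx]⟩
    · exact ⟨q, by omega, by simp [eL, hx]⟩
  have monoL : ∀ x y, x < q + 1 → y < q + 1 → eL q t x < eL q t y → x < y := by
    intro x y hx hy; unfold eL; split_ifs <;> omega
  have tS : ∀ x, x = α ∨ (q ≤ x ∧ x < n) → ∃ x', x' < d + 1 ∧ x = eS q α x' := by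
    rintro x (hx | hx)
    · exact ⟨0, by omega, by simp [eS, hx]⟩
    · exact ⟨x - q + 1, by omega, by rw [eS, if_neg (by omega)]; omega⟩
  have monoS : ∀ x y, eS q α x < eS q α y → x < y := by
    intro x y; unfold eS; split_ifs <;> omega
  have hlast : ∀ i, q ≤ i → ¬ Mid n ρ i := by
    rintro i hi ⟨a, b, h1, h2, h3, h4, h5⟩
    have e1 := h.low a (by omega)
    have e2 := h.low i (by omega)
    have e3 := h.low b (by omega)
    obtain ⟨a', ha, rfl⟩ := tS a (by omega)
    obtain ⟨i', hi', rfl⟩ := tS i (by omega)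
    obtain ⟨b', hb, rfl⟩ := tS b (by omega)
    exact hs.nomid i' ⟨a', b', monoS _ _ h1, monoS _ _ h2, hb, (h.eS_cmp _ _ ha hi').1 h4, (h.eS_cmp _ _ hi' hb).1 h5⟩
  refine ⟨⟨h.pr, h.ss.2 hl.ss, ?_, ?_, by rw [h.kc_eq hlast]; exact hl.kc⟩, hlast,
    ⟨α, t, hα, ht, htn, h.low⟩⟩
  · rintro ⟨i, j, k, l, b1, b2, b3, b4, b5, b6, b7⟩
    have hj : j < q := by
      by_contra hc
      exact hlast j (by omega) ⟨i, k, b1, b2, by omega, b5, by omega⟩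
    have e1 := h.low i (by omega)
    have e2 := h.low j (by omega)
    have e3 := h.low k (by omega)
    have e4 := h.low l (by omega)
    obtain ⟨i', hi', rfl⟩ := tL i (by omega)
    obtain ⟨j', hj', rfl⟩ := tL j (by omega)
    obtain ⟨k', hk', rfl⟩ := tL k (by omega)
    obtain ⟨l', hl', rfl⟩ := tL l (by omega)
    exact hl.c1 ⟨i', j', k', l', monoL _ _ hi' hj' b1, monoL _ _ hj' hk' b2, monoL _ _ hk' hl' b3, hl',
      (h.eL_cmp _ _ hi' hj').1 b5, (h.eL_cmp _ _ hj' hl').1 b6, (h.eL_cmp _ _ hl' hk').1 b7⟩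
  · rintro ⟨i, j, k, l, b1, b2, b3, b4, b5, b6, b7⟩
    have hj : k < q := by
      by_contra hc
      exact hlast k (by omega) ⟨i, l, by omega, b3, by omega, b6, b7⟩
    have e1 := h.low i (by omega)
    have e2 := h.low j (by omega)
    have e3 := h.low k (by omega)
    have e4 := h.low l (by omega)
    obtain ⟨i', hi', rfl⟩ := tL i (by omega)
    obtain ⟨j', hj', rfl⟩ := tL j (by omega)
    obtain ⟨k', hk', rfl⟩ := tL k (by omega)
    obtain ⟨l', hl', rfl⟩ := tL l (by omega)
    exact hl.c2 ⟨i', j', k', l', monoL _ _ hi' hj' b1, monoL _ _ hj' hk' b2, monoL _ _ hk' hl' b3, hl',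
      (h.eL_cmp _ _ hj' hi').1 b5, (h.eL_cmp _ _ hi' hk').1 b6, (h.eL_cmp _ _ hk' hl').1 b7⟩

theorem Glue.exists_ls {n q d k : ℕ} {ρ : ℕ → ℕ} (hn : n = q + d) (hd : 1 ≤ d) (h : KP n k q d ρ) :
    ∃ α t lam σ, Glue n q d α t ρ lam σ := by
  obtain ⟨α, t, hα, ht, htn, hlow⟩ := h.low
  have hp := h.a.p
  have hlt := hp.lt
  have hinj := hp.inj
  refine ⟨α, t, fun i => if q + 1 ≤ i then 0 else if i = α then 0 else ρ (eL q t i) - (d-1),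
    fun i => if d + 1 ≤ i then 0 else if eS q α i = t then d else ρ (eS q α i),
    hn, hd, hα, ht, htn, hp, ?_, ?_, hlow, ?_, ?_, ?_, ?_, ?_, ?_⟩
  · have e1 : ∀ i, i < q + 1 → eL q t i < n ∧ (i ≠ α → d ≤ ρ (eL q t i)) := by
      intro i hi
      have : eL q t i < n := by unfold eL; split_ifs <;> omega
      refine ⟨this, fun hne => ?_⟩
      have e := hlow _ this
      by_contra hc
      have := e.1 (by omega)
      unfold eL at this; split_ifs at this <;> omega
    refine ⟨?_, ?_, ?_⟩
    · intro i hi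
      have := e1 i hi
      have := hlt (eL q t i) this.1
      split_ifs <;> omega
    · intro i j hi hj
      have a1 := e1 i hi
      have a2 := e1 j hj
      have a3 := hinj (eL q t i) (eL q t j) a1.1 a2.1
      have a4 : eL q t i = eL q t j → i = j := by unfold eL; split_ifs <;> omega
      split_ifs <;> omega
    · intro i hi
      simp [hi]
  · have e1 : ∀ i, i < d + 1 → eS q α i < n ∧ (eS q α i ≠ t → ρ (eS q α i) < d) := by
      intro i hi
      have : eS q α i < n := by unfold eS; split_ifs <;> omega
      refine ⟨this, fun hne => ?_⟩
      rw [hlow _ this]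
      unfold eS at *; split_ifs at * <;> omega
    refine ⟨?_, ?_, ?_⟩
    · intro i hi
      have := e1 i hi
      split_ifs <;> omega
    · intro i j hi hj
      have a1 := e1 i hi
      have a2 := e1 j hj
      have a3 := hinj (eS q α i) (eS q α j) a1.1 a2.1
      have a4 : eS q α i = eS q α j → i = j := by unfold eS; split_ifs <;> omega
      split_ifs <;> omega
    · intro i hi
      simp [hi]
  · simp
  · intro i hi hne
    have := hlow i (by omega)
    have e : eL q t i = i := by simp [eL, hi]
    simp only [e, hne, if_false]
    rw [if_neg (by omega)]; omega
  · have := hlow t (by omega)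
    have e : eL q t q = t := by simp [eL]
    simp only [e]
    rw [if_neg (by omega), if_neg (by omega)]; omega
  · have e : eS q α 0 = α := by simp [eS]
    simp only [e]
    rw [if_neg (by omega), if_neg (by omega)]
  · intro i hi hin hne
    have e : eS q α (i - q + 1) = i := by rw [eS, if_neg (by omega)]; omega
    simp only [e]
    rw [if_neg (by omega), if_neg (by omega)]
  · have e : eS q α (t - q + 1) = t := by rw [eS, if_neg (by omega)]; omega
    simp only [e]
    rw [if_neg (by omega)]; simp

theorem Glue.exists_rho {n q d k : ℕ} {lam σ : ℕ → ℕ} (hn : n = q + d) (hd : 1 ≤ d)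
    (hl : AN (q+1) k lam) (hl0 : lam q ≠ 0) (hs : AN (d+1) 0 σ) :
    ∃ α t ρ, Glue n q d α t ρ lam σ := by
  obtain ⟨α, hα, hα0⟩ := hl.p.surj (v := 0) (by omega)
  obtain ⟨t', ht', ht0⟩ := hs.p.surj (v := d) (by omega)
  have hαq : α ≠ q := by rintro rfl; omega
  have ht'0 : t' ≠ 0 := by
    rintro rfl
    exact hs.ss (by omega)
  have lneq : ∀ i, i < q + 1 → i ≠ α → 1 ≤ lam i := by
    intro i hi hne
    have := hl.p.inj i α hi hα
    omega
  have sneq : ∀ i, i < d + 1 → i ≠ t' → σ i < d := by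
    intro i hi hne
    have := hs.p.inj i t' hi ht'
    have := hs.p.lt i hi
    omega
  refine ⟨α, q + t' - 1, fun i => if n ≤ i then 0 else if i < q then
      (if i = α then σ 0 else lam i + (d-1)) else
      (if i = q + t' - 1 then lam q + (d-1) else σ (i - q + 1)),
    hn, hd, by omega, by omega, by omega, ?_, hl.p, hs.p, ?_, hα0, ?_, ?_, ?_, ?_, ?_⟩
  · refine ⟨?_, ?_, ?_⟩
    · intro i hi
      have a1 := hl.p.lt i
      have a2 := hl.p.lt q
      have a3 := hs.p.lt 0
      have a4 := sneq (i-q+1)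
      split_ifs <;> omega
    · have cl : ∀ i, i < n → ∀ v, v = (if n ≤ i then 0 else if i < q then
          (if i = α then σ 0 else lam i + (d-1)) else
          (if i = q + t' - 1 then lam q + (d-1) else σ (i - q + 1))) →
          (i = α ∧ v = σ 0 ∧ v < d) ∨ (q ≤ i ∧ v = σ (i - q + 1) ∧ v < d) ∨
          (i < q ∧ v = lam i + (d-1) ∧ d ≤ v) ∨
          (i = q + t' - 1 ∧ v = lam q + (d-1) ∧ d ≤ v) := by
        intro i hi v hv
        rw [if_neg (by omega)] at hv
        by_cases h1 : i < q
        · rw [if_pos h1] at hv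
          by_cases h2 : i = α
          · rw [if_pos h2] at hv
            have := sneq 0 (by omega) (by omega)
            omega
          · rw [if_neg h2] at hv
            have := lneq i (by omega) h2
            omega
        · rw [if_neg h1] at hv
          by_cases h2 : i = q + t' - 1
          · rw [if_pos h2] at hv
            omega
          · rw [if_neg h2] at hv
            have := sneq (i-q+1) (by omega) (by omega)
            omega
      intro i j hi hj hij
      have ci := cl i hi _ rfl
      have cj := cl j hj _ hij
      clear hij cl
      generalize (if n ≤ i then 0 else if i < q then
          (if i = α then σ 0 else lam i + (d-1)) else
          (if i = q + t' - 1 then lam q + (d-1) else σ (i - q + 1))) = v at ci cj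
      clear sneq lneq
      rcases ci with ci | ci | ci | ci <;> rcases cj with cj | cj | cj | cj
      all_goals first | (clear hl hs; omega) | skip
      · have := hs.p.inj 0 (j-q+1) (by omega) (by omega) (by omega)
        omega
      · have := hs.p.inj 0 (i-q+1) (by omega) (by omega) (by omega)
        omega
      · have := hs.p.inj (i-q+1) (j-q+1) (by omega) (by omega) (by omega)
        omega
      · exact hl.p.inj i j (by omega) (by omega) (by omega)
      · have := hl.p.inj i q (by omega) (by omega) (by omega)
        omega
      · have := hl.p.inj j q (by omega) (by omega) (by omega)
        omega
    · intro i hi; simp [hi]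
  · intro i hi
    have b1 := sneq 0
    have b2 := sneq (i-q+1)
    have b4 := lneq i
    have b6 := lneq q
    split_ifs <;> omega
  · intro i hi hne
    have := lneq i (by omega) hne
    simp only [hi, hne, if_true, if_false]
    rw [if_neg (by omega)]; omega
  · rw [if_neg (by omega), if_neg (by omega), if_pos rfl]; omega
  · rw [if_neg (by omega), if_pos (by omega), if_pos rfl]
  · intro i hi hin hne
    rw [if_neg (by omega), if_neg (by omega), if_neg hne]
  · rw [← ht0]; congr 1; omega

theorem Glue.uniq_ls {n q d α t α' t' : ℕ} {ρ lam σ lam' σ' : ℕ → ℕ} (h : Glue n q d α t ρ lam σ)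
    (h' : Glue n q d α' t' ρ lam' σ') : lam = lam' ∧ σ = σ' := by
  have hn := h.hn; have hd := h.hd; have hα := h.hα; have ht := h.ht; have htn := h.htn
  have hα' := h'.hα; have ht' := h'.ht; have htn' := h'.htn
  have eα : α = α' := by
    have := h.low α (by omega)
    have := h'.low α (by omega)
    omega
  have et : t = t' := by
    have := h.low t (by omega)
    have := h'.low t (by omega)
    omega
  subst eα; subst et
  constructor
  · funext i
    by_cases hi : q + 1 ≤ i
    · rw [h.pl.out i hi, h'.pl.out i hi]
    · by_cases hiq : i = q
      · subst hiq
        have := h.l2; have := h'.l2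
        omega
      · by_cases hiα : i = α
        · subst hiα; rw [h.l0, h'.l0]
        · have := h.l1 i (by omega) hiα
          have := h'.l1 i (by omega) hiα
          omega
  · funext i
    by_cases hi : d + 1 ≤ i
    · rw [h.ps.out i hi, h'.ps.out i hi]
    · have := h.eS_val i (by omega)
      have := h'.eS_val i (by omega)
      have := h.low t htn
      have e : eS q α i = t → ρ (eS q α i) = ρ t := fun hh => by rw [hh]
      omega

theorem Glue.uniq_rho {n q d α t α' t' : ℕ} {ρ lam σ ρ' : ℕ → ℕ} (h : Glue n q d α t ρ lam σ)
    (h' : Glue n q d α' t' ρ' lam σ) : ρ = ρ' := by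
  have hn := h.hn; have hd := h.hd; have hα := h.hα; have ht := h.ht; have htn := h.htn
  have hα' := h'.hα; have ht' := h'.ht; have htn' := h'.htn
  have eα : α = α' := h.pl.inj _ _ (by omega) (by omega) (by rw [h.l0, h'.l0])
  have et : t = t' := by
    have := h.ps.inj (t-q+1) (t'-q+1) (by omega) (by omega) (by rw [h.s2, h'.s2])
    omega
  subst eα; subst et
  funext i
  by_cases hi : n ≤ i
  · rw [h.pr.out i hi, h'.pr.out i hi]
  · by_cases hiq : i < q
    · by_cases hiα : i = α
      · subst hiα; rw [← h.s0, ← h'.s0]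
      · rw [(h.l1 i hiq hiα).1, (h'.l1 i hiq hiα).1]
    · by_cases hit : i = t
      · subst hit; rw [h.l2.1, h'.l2.1]
      · rw [← h.s1 i (by omega) (by omega) hit, ← h'.s1 i (by omega) (by omega) hit]

theorem glue_card {n q d k : ℕ} (hn : n = q + d) (hd : 1 ≤ d) :
    Nat.card {ρ | KP n k q d ρ} =
      Nat.card {f | AN (q+1) k f ∧ f q ≠ 0} * Nat.card {f | AN (d+1) 0 f} := by
  rw [← Nat.card_prod, ← Nat.card_congr (Equiv.Set.prod _ _)]
  apply card_rel _ _ (fun ρ x => ∃ α t, Glue n q d α t ρ x.1 x.2)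
  · intro ρ hρ
    obtain ⟨α, t, lam, σ, h⟩ := Glue.exists_ls hn hd hρ
    have := h.fwd (KP.a hρ) (KP.last hρ)
    have := h.l2
    exact ⟨(lam, σ), ⟨⟨by tauto, by simp only; omega⟩, by tauto⟩, α, t, h⟩
  · rintro ⟨lam, σ⟩ ⟨⟨h1, h2⟩, h3⟩
    obtain ⟨α, t, ρ, h⟩ := Glue.exists_rho hn hd h1 h2 h3
    exact ⟨ρ, h.bwd h1 h3, α, t, h⟩
  · rintro ρ _ ⟨l, s⟩ _ ⟨l', s'⟩ _ ⟨α, t, h⟩ ⟨α', t', h'⟩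
    have := h.uniq_ls h'
    exact Prod.ext this.1 this.2
  · rintro ρ _ ρ' _ ⟨l, s⟩ _ ⟨α, t, h⟩ ⟨α', t', h'⟩
    exact h.uniq_rho h'


noncomputable def toF {n : ℕ} (π : Equiv.Perm (Fin n)) (i : ℕ) : ℕ :=
  if h : i < n then (π ⟨i, h⟩ : ℕ) else 0

theorem toF_fin {n : ℕ} (π : Equiv.Perm (Fin n)) (i : Fin n) : toF π i = (π i : ℕ) := by
  simp [toF]

theorem toF_isP {n : ℕ} (π : Equiv.Perm (Fin n)) : IsP n (toF π) := by
  refine ⟨?_, ?_, ?_⟩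
  · intro i hi
    have := toF_fin π ⟨i, hi⟩
    simp only at this
    rw [this]; exact (π ⟨i, hi⟩).2
  · intro i j hi hj h
    have h1 := toF_fin π ⟨i, hi⟩
    have h2 := toF_fin π ⟨j, hj⟩
    simp only at h1 h2
    rw [h1, h2] at h
    have := π.injective (Fin.ext h)
    simpa using this
  · intro i hi
    unfold toF; rw [dif_neg (by omega)]

theorem toF_inj {n : ℕ} : Function.Injective (toF (n := n)) := by
  intro π π' h
  ext i
  rw [← toF_fin, ← toF_fin, h]

theorem toF_surj {n : ℕ} {f : ℕ → ℕ} (hf : IsP n f) : ∃ π : Equiv.Perm (Fin n), toF π = f := by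
  let F : Fin n → Fin n := fun i => ⟨f i, hf.lt i i.2⟩
  have hF : Function.Injective F := by
    intro i j h
    have : f i = f j := by simpa [F] using h
    exact Fin.ext (hf.inj _ _ i.2 j.2 this)
  refine ⟨Equiv.ofBijective F (Finite.injective_iff_bijective.1 hF), ?_⟩
  funext i
  by_cases hi : i < n
  · simp [toF, hi, F]
  · rw [hf.out i (by omega)]; simp [toF, hi]

theorem toF_lt {n : ℕ} (π : Equiv.Perm (Fin n)) (i j : Fin n) : π i < π j ↔ toF π i < toF π j := by
  rw [toF_fin, toF_fin, Fin.lt_def]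

theorem toF_c1 {n : ℕ} (π : Equiv.Perm (Fin n)) : Contains1243 π ↔ C1 n (toF π) := by
  constructor
  · rintro ⟨i, j, k, l, h1, h2, h3, h4, h5, h6⟩
    rw [toF_lt] at h4 h5 h6
    exact ⟨i, j, k, l, h1, h2, h3, l.2, h4, h5, h6⟩
  · rintro ⟨i, j, k, l, h1, h2, h3, h0, h4, h5, h6⟩
    refine ⟨⟨i, by omega⟩, ⟨j, by omega⟩, ⟨k, by omega⟩, ⟨l, by omega⟩, h1, h2, h3, ?_⟩
    rw [toF_lt, toF_lt, toF_lt]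
    exact ⟨h4, h5, h6⟩

theorem toF_c2 {n : ℕ} (π : Equiv.Perm (Fin n)) : Contains2134 π ↔ C2 n (toF π) := by
  constructor
  · rintro ⟨i, j, k, l, h1, h2, h3, h4, h5, h6⟩
    rw [toF_lt] at h4 h5 h6
    exact ⟨i, j, k, l, h1, h2, h3, l.2, h4, h5, h6⟩
  · rintro ⟨i, j, k, l, h1, h2, h3, h0, h4, h5, h6⟩
    refine ⟨⟨i, by omega⟩, ⟨j, by omega⟩, ⟨k, by omega⟩, ⟨l, by omega⟩, h1, h2, h3, ?_⟩
    rw [toF_lt, toF_lt, toF_lt]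
    exact ⟨h4, h5, h6⟩

theorem toF_mid {n : ℕ} (π : Equiv.Perm (Fin n)) (j : Fin n) : IsMid123 π j ↔ Mid n (toF π) j := by
  constructor
  · rintro ⟨i, k, h1, h2, h3, h4⟩
    rw [toF_lt] at h3 h4
    exact ⟨i, k, h1, h2, k.2, h3, h4⟩
  · rintro ⟨i, k, h1, h2, h3, h4, h5⟩
    refine ⟨⟨i, by omega⟩, ⟨k, by omega⟩, h1, h2, ?_⟩
    rw [toF_lt, toF_lt]
    exact ⟨h4, h5⟩

theorem toF_rl {n : ℕ} (π : Equiv.Perm (Fin n)) (j : Fin n) : IsRLMax π j ↔ RL n (toF π) j := by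
  constructor
  · intro h m h1 h2
    exact (toF_lt π ⟨m, h2⟩ j).1 (h ⟨m, h2⟩ h1)
  · intro h m h1
    rw [toF_lt]
    exact h m h1 m.2

theorem toF_key {n : ℕ} (π : Equiv.Perm (Fin n)) (j : Fin n) : IsKeyMid123 π j ↔ Key n (toF π) j := by
  unfold IsKeyMid123 Key
  rw [toF_mid]
  refine and_congr_right (fun hm => ?_)
  have hj : 0 < (j : ℕ) := by obtain ⟨a, b, h1, _⟩ := hm; omega
  constructor
  · rintro ⟨j', h1, h2⟩
    rw [toF_lt, toF_rl] at h2
    have : (j : ℕ) - 1 = j' := by omega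
    rw [this]; exact h2
  · intro h
    refine ⟨⟨j - 1, by omega⟩, by simp only; omega, ?_⟩
    rw [toF_lt, toF_rl]
    exact h

theorem toF_kc {n : ℕ} (π : Equiv.Perm (Fin n)) : keyCount π = kc n (toF π) := by
  unfold keyCount kc
  rw [← Nat.card_coe_set_eq]
  refine Nat.card_congr ⟨fun j => ⟨j.1, (toF_key π j.1).1 j.2⟩, fun j => ⟨⟨j.1, ?_⟩, ?_⟩, ?_, ?_⟩
  · obtain ⟨⟨a, b, h1, h2, h3, _⟩, _⟩ := j.2; omega
  · exact (toF_key π _).2 j.2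
  · intro j; rfl
  · intro j; rfl

theorem toF_mem {n k : ℕ} (π : Equiv.Perm (Fin n)) : π ∈ A n k ↔ AN n k (toF π) := by
  have hss : StartSmall π ↔ toF π 0 + 1 ≠ n := by
    unfold StartSmall
    by_cases h : 0 < n
    · have := toF_fin π ⟨0, h⟩
      simp only at this
      rw [this]
      exact ⟨fun hh => hh h, fun hh _ => hh⟩
    · exact ⟨fun _ => by omega, fun _ h' => absurd h' h⟩
  constructor
  · rintro ⟨h1, ⟨h2, h3⟩, h4⟩
    exact ⟨toF_isP π, hss.1 h1, fun h => h2 ((toF_c1 π).2 h), fun h => h3 ((toF_c2 π).2 h),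
      by rw [← toF_kc]; exact h4⟩
  · intro h
    exact ⟨hss.2 h.ss, ⟨fun hh => h.c1 ((toF_c1 π).1 hh), fun hh => h.c2 ((toF_c2 π).1 hh)⟩,
      by rw [toF_kc]; exact h.kc⟩

theorem card_A (n k : ℕ) : Nat.card (A n k) = Nat.card {f | AN n k f} := by
  apply card_rel _ _ (fun π f => toF π = f)
  · intro π hπ; exact ⟨_, (toF_mem π).1 hπ, rfl⟩
  · intro f hf
    obtain ⟨π, hπ⟩ := toF_surj (AN.p hf)
    refine ⟨π, (toF_mem π).2 ?_, hπ⟩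
    rw [hπ]; exact hf
  · rintro _ _ _ _ _ _ rfl rfl; rfl
  · rintro x _ y _ _ _ h h'; exact toF_inj (h.trans h'.symm)

theorem AN_finite (n k : ℕ) : {f | AN n k f}.Finite := by
  apply Set.Finite.subset (Set.finite_range (toF (n := n)))
  intro f hf
  obtain ⟨π, hπ⟩ := toF_surj (AN.p hf)
  exact ⟨π, hπ⟩

theorem card_split (S : Set (ℕ → ℕ)) (hS : S.Finite) (P : (ℕ → ℕ) → Prop) :
    Nat.card S = Nat.card {f | f ∈ S ∧ P f} + Nat.card {f | f ∈ S ∧ ¬ P f} := by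
  simp only [Nat.card_coe_set_eq]
  have f1 : {f | f ∈ S ∧ P f}.Finite := hS.subset (fun f hf => hf.1)
  have f2 : {f | f ∈ S ∧ ¬ P f}.Finite := hS.subset (fun f hf => hf.1)
  rw [← Set.ncard_union_eq ?_ f1 f2]
  · congr 1
    ext f
    simp only [Set.mem_union, Set.mem_ofPred_eq]
    tauto
  · rw [Set.disjoint_left]
    rintro f ⟨_, h1⟩ ⟨_, h2⟩
    exact h2 h1

theorem P_eq (k d : ℕ) (hd : 1 ≤ d) (q : ℕ) :
    Nat.card {f | PN (q+1+d) (k+1) q f} =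
      Nat.card {f | AN (q+1) k f} * Nat.card {f | AN (d+1) 0 f} := by
  induction q with
  | zero =>
    have h1 : {f | PN (0+1+d) (k+1) 0 f} = ∅ := by
      ext f
      simp only [Set.mem_ofPred_eq, Set.mem_empty_iff_false, iff_false]
      intro h
      obtain ⟨a, b, h1, _⟩ := h.mid
      omega
    have h2 : {f | AN (0+1) k f} = ∅ := by
      ext f
      simp only [Set.mem_ofPred_eq, Set.mem_empty_iff_false, iff_false]
      intro h
      have := h.ss
      have := h.p.lt 0 (by omega)
      omega
    rw [h1, h2]; simp
  | succ q ih =>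
    have hfin : {f | PN (q+1+d+1) (k+1) (q+1) f}.Finite :=
      (AN_finite (q+1+d+1) (k+1)).subset (fun f hf => PN.a hf)
    have e : q + 1 + 1 + d = q + 1 + d + 1 := by omega
    rw [e, card_split _ hfin (fun f => Key (q+1+d+1) f (q+1)),
      card_split _ (AN_finite (q+1+1) k) (fun f => f (q+1) = 0)]
    have h1 := k_card (n := q+1+d) (k := k) (q := q+1) (d := d) rfl
    have h2 := nk_card (n := q+1+d) (k := k+1) (q := q) (d := d) rfl
    have h3 := glue_card (n := q+1+d) (k := k) (q := q+1) (d := d) rfl hd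
    have h4 := endmin_card (n := q+1) (k := k) (by omega)
    simp only [Set.mem_ofPred_eq]
    rw [h1, h2, h3, h4, ih]
    ring

theorem AN.exists_last {n k : ℕ} {f : ℕ → ℕ} (h : AN n k f) (hk : 1 ≤ k) :
    ∃ q, PN n k q f ∧ q + 1 ∈ Finset.Icc (k+1) (n-1) := by
  classical
  have hne : ∃ j, Mid n f j := by
    by_contra hc
    have := (AN.of_nomid h.p h.ss (fun j hj => hc ⟨j, hj⟩)).kc
    have := h.kc
    omega
  obtain ⟨j, hj⟩ := hne
  have hb : ∀ j, Mid n f j → j < n := by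
    rintro j ⟨a, b, h1, h2, h3, _⟩; omega
  obtain ⟨q, hq, hmax⟩ := Finset.exists_max_image ((Finset.range n).filter (fun j => Mid n f j)) id
    ⟨j, by simp [hj, hb j hj]⟩
  simp only [Finset.mem_filter, Finset.mem_range, id] at hq hmax
  have hlast : ∀ i, q < i → ¬ Mid n f i := by
    intro i hi hm
    have := hmax i ⟨hb i hm, hm⟩
    omega
  refine ⟨q, ⟨h, hq.2, hlast⟩, ?_⟩
  have hsub : {j | Key n f j} ⊆ ↑(Finset.Icc 1 q) := by
    rintro j ⟨hm, _⟩
    have : j ≤ q := by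
      by_contra hc
      exact hlast j (by omega) hm
    obtain ⟨a, b, h1, _⟩ := hm
    simp; omega
  have hcard := Set.ncard_le_ncard hsub (Finset.finite_toSet _)
  rw [Set.ncard_coe_finset] at hcard
  have := h.kc
  unfold _root_.kc at this
  obtain ⟨a, b, h1, h2, h3, _⟩ := hq.2
  simp at hcard ⊢
  omega

theorem sum_card (n k : ℕ) (hk : 1 ≤ k) :
    Nat.card {f | AN n k f} = ∑ j ∈ Finset.Icc (k+1) (n-1), Nat.card {f | PN n k (j-1) f} := by
  classical
  choose! L hL hL' using fun f (h : AN n k f) => h.exists_last hk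
  have hfin := AN_finite n k
  rw [Nat.card_coe_set_eq, Set.ncard_eq_toFinset_card _ hfin,
    Finset.card_eq_sum_card_fiberwise (f := fun f => L f + 1) (t := Finset.Icc (k+1) (n-1))]
  · apply Finset.sum_congr rfl
    intro j hj
    have hj1 := (Finset.mem_Icc.1 hj).1
    rw [Nat.card_coe_set_eq, ← Set.ncard_coe_finset]
    congr 1
    ext f
    simp only [Finset.coe_filter, Set.Finite.mem_toFinset, Set.mem_ofPred_eq]
    constructor
    · rintro ⟨h1, h2⟩
      have := hL f h1
      rwa [show j - 1 = L f by omega]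
    · intro h
      refine ⟨h.a, ?_⟩
      have h' := hL f h.a
      have : L f = j - 1 := by
        rcases lt_trichotomy (L f) (j-1) with hl | hl | hl
        · exact absurd h.mid (h'.last _ hl)
        · exact hl
        · exact absurd h'.mid (h.last _ hl)
      omega
  · intro f hf
    have : AN n k f := by simpa using hf
    exact hL' f this

theorem stmt5 (n k : ℕ) (hn : 1 ≤ n) (hk : 1 ≤ k) :
    Nat.card (A n k)
      = ∑ j ∈ Finset.Icc (k + 1) (n - 1),
          Nat.card (A j (k - 1)) * Nat.card (A (n + 1 - j) 0) := by
  rw [card_A, sum_card n k hk]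
  apply Finset.sum_congr rfl
  intro j hj
  rw [Finset.mem_Icc] at hj
  rw [card_A, card_A]
  have := P_eq (k-1) (n-j) (by omega) (j-1)
  rw [show j - 1 + 1 + (n - j) = n by omega, show k - 1 + 1 = k by omega,
    show j - 1 + 1 = j by omega, show n - j + 1 = n + 1 - j by omega] at this
  exact this
end

section
/- For every n ≥ 2, the number of start-small permutations of [n] avoiding both 1243 and 2134 equals Σ_{k=1}^{n−1} (the number of k-tuples (σ_1, ..., σ_k) of start-small 123-avoiding permutations whose lengths sum to n−1+k). Equivalently, writing s_m for the number of start-small 123-avoiding permutations of [m], the count equals Σ_{k=1}^{n−1} Σ_{(m_1,...,m_k)} s_{m_1}···s_{m_k}, where the inner sum is over all compositions (m_1,...,m_k) of n−1+k into k positive parts. -/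
/-- `π` contains the pattern 123: indices `i < j < k` with `π i < π j < π k`. -/
def Contains123 {n : ℕ} (π : Equiv.Perm (Fin n)) : Prop :=
  ∃ i j k : Fin n, i < j ∧ j < k ∧ π i < π j ∧ π j < π k

/-- `s m` is the number of start-small 123-avoiding permutations of `[m]`. -/
noncomputable def s (m : ℕ) : ℕ :=
  Nat.card {π : Equiv.Perm (Fin m) // StartSmall π ∧ ¬ Contains123 π}



namespace CAux
open Equiv

def pre {n : ℕ} (v : Fin (n+1)) (π : Perm (Fin n)) : Perm (Fin (n+1)) :=
  ((finSuccEquiv' (0 : Fin (n+1))).trans (Equiv.optionCongr π)).trans (finSuccEquiv' v).symm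

lemma pre_zero {n : ℕ} (v : Fin (n+1)) (π : Perm (Fin n)) : pre v π 0 = v := by
  simp [pre]

lemma pre_succ {n : ℕ} (v : Fin (n+1)) (π : Perm (Fin n)) (i : Fin n) :
    pre v π i.succ = v.succAbove (π i) := by
  have : (finSuccEquiv' (0 : Fin (n+1))) i.succ = some i := by
    rw [← Fin.succAbove_zero_apply, finSuccEquiv'_succAbove]
  simp [pre, this]

lemma sval {n : ℕ} (v : Fin (n+1)) (x : Fin n) :
    ((v.succAbove x : Fin (n+1)) : ℕ) = if (x : ℕ) < v then (x : ℕ) else x + 1 := by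
  unfold Fin.succAbove
  simp only [Fin.lt_def, Fin.val_castSucc]
  split_ifs <;> simp

lemma pre_inj {n : ℕ} : Function.Injective (fun p : Fin (n+1) × Perm (Fin n) => pre p.1 p.2) := by
  rintro ⟨v, π⟩ ⟨w, ρ⟩ h
  simp only at h
  have h0 : v = w := by rw [← pre_zero v π, h, pre_zero]
  subst h0
  congr 1
  ext i
  have := congrArg (fun e => e i.succ) h
  simp only [pre_succ] at this
  rw [Fin.succAbove_right_injective this]

noncomputable def preEquiv (n : ℕ) : Fin (n+1) × Perm (Fin n) ≃ Perm (Fin (n+1)) :=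
  Equiv.ofBijective (fun p => pre p.1 p.2) (by
    rw [Fintype.bijective_iff_injective_and_card]
    refine ⟨pre_inj, ?_⟩
    simp [Fintype.card_perm, Nat.factorial_succ])

lemma preEquiv_apply {n : ℕ} (p) : preEquiv n p = pre p.1 p.2 := rfl

def D {n : ℕ} (π : Perm (Fin n)) (g : ℕ) : Prop :=
  ∀ i j : Fin n, i < j → g ≤ (π i : ℕ) → g ≤ (π j : ℕ) → π j < π i
def I {n : ℕ} (π : Perm (Fin n)) (g : ℕ) : Prop :=
  ∀ i j : Fin n, i < j → g ≤ (π i : ℕ) → g ≤ (π j : ℕ) → π i < π j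
def P {n : ℕ} (π : Perm (Fin n)) (g : ℕ) : Prop :=
  ∀ i j k : Fin n, i < j → j < k → ¬ (g ≤ (π i : ℕ) ∧ π i < π k ∧ π k < π j)
def Q {n : ℕ} (π : Perm (Fin n)) (g : ℕ) : Prop :=
  ∀ i j k : Fin n, i < j → j < k → ¬ ((π i : ℕ) < g ∧ g ≤ (π j : ℕ) ∧ π j < π k)
def A {n : ℕ} (π : Perm (Fin n)) (g : ℕ) : Prop := P π g ∧ Q π g

lemma sA_lt {n : ℕ} (v : Fin (n+1)) (x y : Fin n) : v.succAbove x < v.succAbove y ↔ x < y := by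
  simp
lemma lt_sA {n : ℕ} (v : Fin (n+1)) (x : Fin n) : v < v.succAbove x ↔ (v : ℕ) ≤ x := by
  rw [Fin.lt_def, sval]; split_ifs <;> omega
lemma sA_lt' {n : ℕ} (v : Fin (n+1)) (x : Fin n) : v.succAbove x < v ↔ (x : ℕ) < v := by
  rw [Fin.lt_def, sval]; split_ifs <;> omega
lemma le_sA {n : ℕ} (v : Fin (n+1)) (x : Fin n) (g : ℕ) (h : g ≤ v) :
    g ≤ (v.succAbove x : ℕ) ↔ g ≤ (x : ℕ) := by
  rw [sval]; split_ifs <;> omega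
lemma le_sA' {n : ℕ} (v : Fin (n+1)) (x : Fin n) (g : ℕ) (h : (v : ℕ) < g) :
    g ≤ (v.succAbove x : ℕ) ↔ g - 1 ≤ (x : ℕ) := by
  rw [sval]; split_ifs <;> omega
lemma sA_ltg {n : ℕ} (v : Fin (n+1)) (x : Fin n) (g : ℕ) (h : g ≤ v) :
    (v.succAbove x : ℕ) < g ↔ (x : ℕ) < g := by
  rw [sval]; split_ifs <;> omega
lemma sA_ltg' {n : ℕ} (v : Fin (n+1)) (x : Fin n) (g : ℕ) (h : (v : ℕ) < g) :
    (v.succAbove x : ℕ) < g ↔ (x : ℕ) < g - 1 := by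
  rw [sval]; split_ifs <;> omega

section
variable {n : ℕ} (v : Fin (n+1)) (π : Perm (Fin n))

lemma D_up {g h : ℕ} (hgh : g ≤ h) (hd : D π g) : D π h :=
  fun i j hij h1 h2 => hd i j hij (by omega) (by omega)
lemma I_up {g h : ℕ} (hgh : g ≤ h) (hd : I π g) : I π h :=
  fun i j hij h1 h2 => hd i j hij (by omega) (by omega)

lemma top_absurd {g : ℕ} (hg : n ≤ g + 1) {i j : Fin n} (hij : i < j) (h1 : g ≤ (π i : ℕ))
    (h2 : g ≤ (π j : ℕ)) : False := by
  have h3 := (π i).2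
  have h4 := (π j).2
  have : π i = π j := Fin.ext (by omega)
  exact hij.ne (π.injective this)

lemma D_top {g : ℕ} (hg : n ≤ g + 1) : D π g :=
  fun _ _ hij h1 h2 => (top_absurd π hg hij h1 h2).elim
lemma I_top {g : ℕ} (hg : n ≤ g + 1) : I π g :=
  fun _ _ hij h1 h2 => (top_absurd π hg hij h1 h2).elim

lemma not_D_I {g : ℕ} (hg : g + 2 ≤ n) (hd : D π g) (hi : I π g) : False := by
  let x : Fin n := ⟨g, by omega⟩
  let y : Fin n := ⟨g+1, by omega⟩
  have hx : π (π.symm x) = x := by simp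
  have hy : π (π.symm y) = y := by simp
  have hx' : (π (π.symm x) : ℕ) = g := by rw [hx]
  have hy' : (π (π.symm y) : ℕ) = g + 1 := by rw [hy]
  rcases lt_trichotomy (π.symm x) (π.symm y) with h | h | h
  · have := hd _ _ h (by omega) (by omega)
    rw [Fin.lt_def] at this; omega
  · have := congrArg π h
    rw [Fin.ext_iff] at this; omega
  · have := hi _ _ h (by omega) (by omega)
    rw [Fin.lt_def] at this; omega

lemma D_A {g : ℕ} (hd : D π g) : A π g := by
  constructor
  · rintro i j k hij hjk ⟨h1, h2, h3⟩
    have := hd i j hij h1 (by rw [Fin.lt_def] at *; omega)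
    rw [Fin.lt_def] at *; omega
  · rintro i j k hij hjk ⟨h1, h2, h3⟩
    have := hd j k hjk h2 (by rw [Fin.lt_def] at *; omega)
    rw [Fin.lt_def] at *; omega

lemma D_pre_hi (g : ℕ) (h : (v : ℕ) < g) : D (pre v π) g ↔ D π (g-1) := by
  have h' : ¬ g ≤ (v : ℕ) := by omega
  simp only [D, Fin.forall_fin_succ, pre_zero, pre_succ, sA_lt, le_sA' v _ g h, Fin.succ_lt_succ_iff]
  simp [h']

lemma D_pre_lo (g : ℕ) (h : g ≤ (v : ℕ)) : D (pre v π) g ↔ D π g ∧ (v : ℕ) = n := by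
  simp only [D, Fin.forall_fin_succ, pre_zero, pre_succ, sA_lt, le_sA v _ g h, Fin.succ_lt_succ_iff, sA_lt']
  simp only [lt_irrefl, Fin.succ_pos, h, Fin.not_lt_zero, false_imp_iff, true_imp_iff, true_and, implies_true]
  rw [and_comm]
  refine and_congr Iff.rfl ⟨fun hh => ?_, fun hh i _ => by have := (π i).2; omega⟩
  by_contra hne
  have := v.2
  have := hh (π.symm ⟨v, by omega⟩) (by simpa using h)
  simp at this

lemma I_pre_lo (g : ℕ) (h : g ≤ (v : ℕ)) : I (pre v π) g ↔ I π g ∧ g = (v : ℕ) := by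
  simp only [I, Fin.forall_fin_succ, pre_zero, pre_succ, sA_lt, le_sA v _ g h, Fin.succ_lt_succ_iff, lt_sA]
  simp only [lt_irrefl, Fin.succ_pos, h, Fin.not_lt_zero, false_imp_iff, true_imp_iff, true_and, implies_true]
  rw [and_comm]
  refine and_congr Iff.rfl ⟨fun hh => ?_, fun hh i hi => by omega⟩
  by_contra hne
  have := v.2
  have := hh (π.symm ⟨g, by omega⟩) (by simp)
  simp at this
  omega

lemma P_pre_lo (g : ℕ) (h : g ≤ (v : ℕ)) : P (pre v π) g ↔ P π g ∧ I π v := by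
  simp only [P, I, Fin.forall_fin_succ, pre_zero, pre_succ, sA_lt, le_sA v _ g h, Fin.succ_lt_succ_iff, lt_sA]
  simp only [lt_irrefl, Fin.succ_pos, h, Fin.not_lt_zero, false_imp_iff, true_imp_iff, true_and, implies_true]
  rw [and_comm]
  refine and_congr Iff.rfl ⟨fun hh i j hij h1 h2 => ?_, ?_⟩
  · have := hh i j hij
    have hne : π i ≠ π j := fun e => hij.ne (π.injective e)
    rw [Fin.lt_def] at *
    rw [Ne, Fin.ext_iff] at hne
    omega
  · rintro hh i j hij ⟨h1, h2⟩
    have := hh i j hij (by rw [Fin.lt_def] at h2; omega) h1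
    rw [Fin.lt_def] at *; omega

lemma P_pre_hi (g : ℕ) (h : (v : ℕ) < g) : P (pre v π) g ↔ P π (g-1) := by
  have h' : ¬ g ≤ (v : ℕ) := by omega
  simp only [P, Fin.forall_fin_succ, pre_zero, pre_succ, sA_lt, le_sA' v _ g h, Fin.succ_lt_succ_iff]
  simp [h']

lemma Q_pre_lo (g : ℕ) (h : g ≤ (v : ℕ)) : Q (pre v π) g ↔ Q π g := by
  have h' : ¬ (v : ℕ) < g := by omega
  simp only [Q, Fin.forall_fin_succ, pre_zero, pre_succ, sA_lt, le_sA v _ g h, sA_ltg v _ g h, Fin.succ_lt_succ_iff]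
  simp [h']

lemma Q_pre_hi (g : ℕ) (h : (v : ℕ) < g) : Q (pre v π) g ↔ Q π (g-1) ∧ D π (g-1) := by
  simp only [Q, D, Fin.forall_fin_succ, pre_zero, pre_succ, sA_lt, le_sA' v _ g h, sA_ltg' v _ g h, Fin.succ_lt_succ_iff]
  simp only [lt_irrefl, Fin.succ_pos, h, Fin.not_lt_zero, false_imp_iff, true_imp_iff, true_and, implies_true]
  rw [and_comm]
  refine and_congr Iff.rfl ⟨fun hh i j hij h1 h2 => ?_, ?_⟩
  · have := hh i j hij
    have hne : π i ≠ π j := fun e => hij.ne (π.injective e)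
    rw [Fin.lt_def] at *
    rw [Ne, Fin.ext_iff] at hne
    omega
  · rintro hh i j hij ⟨h1, h2⟩
    have := hh i j hij h1 (by rw [Fin.lt_def] at h2; omega)
    rw [Fin.lt_def] at *; omega

lemma A_pre_lo (g : ℕ) (h : g ≤ (v : ℕ)) : A (pre v π) g ↔ A π g ∧ I π v := by
  rw [A, P_pre_lo v π g h, Q_pre_lo v π g h, A]; tauto

lemma A_pre_hi (g : ℕ) (h : (v : ℕ) < g) : A (pre v π) g ↔ D π (g-1) := by
  rw [A, P_pre_hi v π g h, Q_pre_hi v π g h]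
  refine ⟨fun hh => hh.2.2, fun hh => ?_⟩
  have := D_A π hh
  exact ⟨this.1, this.2, hh⟩

lemma av123_pre : ¬ Contains123 (pre v π) ↔ ¬ Contains123 π ∧ D π v := by
  have e : ∀ {m : ℕ} (ρ : Perm (Fin m)), ¬ Contains123 ρ ↔
      ∀ i j k, i < j → j < k → ¬ (ρ i < ρ j ∧ ρ j < ρ k) := by
    intro m ρ; simp only [Contains123]; push Not
    exact ⟨fun h i j k a b c => h i j k a b c, fun h i j k a b c => h i j k a b c⟩
  simp only [e]
  simp only [D, Fin.forall_fin_succ, pre_zero, pre_succ, sA_lt, Fin.succ_lt_succ_iff, lt_sA]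
  simp only [lt_irrefl, Fin.succ_pos, Fin.not_lt_zero, false_imp_iff, true_imp_iff, true_and, implies_true]
  rw [and_comm]
  refine and_congr Iff.rfl ⟨fun hh i j hij h1 h2 => ?_, ?_⟩
  · have := hh i j hij
    have hne : π i ≠ π j := fun e => hij.ne (π.injective e)
    rw [Fin.lt_def] at *
    rw [Ne, Fin.ext_iff] at hne
    omega
  · rintro hh i j hij ⟨h1, h2⟩
    have := hh i j hij h1 (by rw [Fin.lt_def] at h2; omega)
    rw [Fin.lt_def] at *; omega

lemma c1243_pre : ¬ Contains1243 (pre v π) ↔ ¬ Contains1243 π ∧ P π v := by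
  have e : ∀ {m : ℕ} (ρ : Perm (Fin m)), ¬ Contains1243 ρ ↔
      ∀ i j k l, i < j → j < k → k < l → ¬ (ρ i < ρ j ∧ ρ j < ρ l ∧ ρ l < ρ k) := by
    intro m ρ; simp only [Contains1243]; push Not
    exact ⟨fun h i j k l a b c d => h i j k l a b c d, fun h i j k l a b c d => h i j k l a b c d⟩
  simp only [e]
  simp only [P, Fin.forall_fin_succ, pre_zero, pre_succ, sA_lt, Fin.succ_lt_succ_iff, lt_sA]
  simp only [lt_irrefl, Fin.succ_pos, Fin.not_lt_zero, false_imp_iff, true_imp_iff, true_and, implies_true]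
  rw [and_comm]

lemma c2134_pre : ¬ Contains2134 (pre v π) ↔ ¬ Contains2134 π ∧ Q π v := by
  have e : ∀ {m : ℕ} (ρ : Perm (Fin m)), ¬ Contains2134 ρ ↔
      ∀ i j k l, i < j → j < k → k < l → ¬ (ρ j < ρ i ∧ ρ i < ρ k ∧ ρ k < ρ l) := by
    intro m ρ; simp only [Contains2134]; push Not
    exact ⟨fun h i j k l a b c d => h i j k l a b c d, fun h i j k l a b c d => h i j k l a b c d⟩
  simp only [e]
  simp only [Q, Fin.forall_fin_succ, pre_zero, pre_succ, sA_lt, Fin.succ_lt_succ_iff, lt_sA, sA_lt']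
  simp only [lt_irrefl, Fin.succ_pos, Fin.not_lt_zero, false_imp_iff, true_imp_iff, true_and, implies_true]
  rw [and_comm]

lemma both_pre : AvoidsBoth (pre v π) ↔ AvoidsBoth π ∧ A π v := by
  rw [AvoidsBoth, c1243_pre, c2134_pre, AvoidsBoth, A]; tauto

lemma startSmall_pre : StartSmall (pre v π) ↔ (v : ℕ) ≠ n := by
  simp [StartSmall, pre_zero]

lemma inv1 (ha : A π v) (h : ¬ D (pre v π) (n-1)) (hn : 1 ≤ n) {g : ℕ} (hg : A (pre v π) g)
    (hgn : g ≤ n-1) : ∃ u, g ≤ u ∧ u ≤ n-1 ∧ A (pre v π) u ∧ I (pre v π) u := by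
  have hv := v.2
  rcases lt_or_ge (v : ℕ) g with h1 | h1
  · rw [A_pre_hi v π g h1] at hg
    refine (h ?_).elim
    rw [D_pre_hi v π _ (by omega)]
    exact D_up π (by omega) hg
  · rw [A_pre_lo v π g h1] at hg
    refine ⟨v, h1, ?_, ?_, ?_⟩
    · by_contra hc
      apply h
      rw [D_pre_lo v π _ (by omega)]
      exact ⟨D_top π (by omega), by omega⟩
    · rw [A_pre_lo v π _ le_rfl]; exact ⟨ha, hg.2⟩
    · rw [I_pre_lo v π _ le_rfl]; exact ⟨hg.2, rfl⟩

lemma inv2 (h : ¬ D (pre v π) (n-1)) (hn : 1 ≤ n) {u w : ℕ} (hu : I (pre v π) u)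
    (huw : u < w) (hw : w ≤ n - 1) : ¬ A (pre v π) w := by
  intro ha
  rcases lt_or_ge (v : ℕ) w with h1 | h1
  · rw [A_pre_hi v π w h1] at ha
    refine (h ?_).elim
    rw [D_pre_hi v π _ (by omega)]
    exact D_up π (by omega) ha
  · rw [I_pre_lo v π u (by omega)] at hu
    omega
end
open Classical Finset in
noncomputable def tt {n : ℕ} (π : Perm (Fin n)) : ℕ := ((range (n+1)).filter (fun g => D π g)).card
open Classical Finset in
noncomputable def ll {n : ℕ} (π : Perm (Fin n)) : ℕ :=
  ((range (n+1)).filter (fun g => A π g ∧ ¬ D π g)).card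

def ab : ℕ → (ℕ → ℕ) × (ℕ → ℕ)
  | 0 => (fun _ => 1, fun _ => 0)
  | m+1 => (fun t => (ab m).1 (t+1) + ∑ i ∈ Finset.Ico 2 (t+1), (ab m).1 i + (t-1) * (ab m).2 2,
      fun t => (ab m).2 (t+1) + (ab m).2 2 + (ab m).1 t + if t = 2 then (ab m).2 2 else 0)

def cc : ℕ → ℕ → ℕ
  | 0 => fun _ => 1
  | m+1 => fun t => cc m (t+1) + ∑ i ∈ Finset.Ico 2 (t+1), cc m i

noncomputable def ww (m : ℕ) {n : ℕ} (π : Perm (Fin n)) : ℕ :=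
  (ab m).1 (tt π) + ll π * (ab m).2 (tt π)

lemma exq {k : ℕ} (π : Perm (Fin (k+1))) : ∃ q, q ≤ k ∧ ∀ g, D π g ↔ q ≤ g := by
  classical
  have h : ∃ q, D π q := ⟨k, D_top π le_rfl⟩
  exact ⟨Nat.find h, Nat.find_min' h (D_top π le_rfl), fun g =>
    ⟨fun hg => Nat.find_min' h hg, fun hg => D_up π hg (Nat.find_spec h)⟩⟩

lemma tt_of_q {n q : ℕ} (π : Perm (Fin n)) (h : ∀ g, D π g ↔ q ≤ g) : tt π = n + 1 - q := by
  classical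
  have : (Finset.range (n+1)).filter (fun g => D π g) = Finset.Ico q (n+1) := by
    ext g; simp [h]; omega
  rw [tt, this, Nat.card_Ico]

open Classical in
lemma ll_of_q {n q : ℕ} (π : Perm (Fin n)) (h : ∀ g, D π g ↔ q ≤ g) (hq : q ≤ n + 1) :
    ll π = ((Finset.range q).filter (fun g => A π g)).card := by
  rw [ll]; congr 1
  ext g; simp [h]
  constructor
  · rintro ⟨h1, h2, h3⟩; exact ⟨h3, h2⟩
  · rintro ⟨h1, h2⟩; exact ⟨by omega, h2, h1⟩

section
variable {k q : ℕ} (π : Perm (Fin (k+1))) (hqk : q ≤ k) (hq : ∀ g, D π g ↔ q ≤ g) (v : Fin (k+1+1))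
include hqk hq

lemma Dq_top (hv : (v : ℕ) = k+1) : ∀ g, D (pre v π) g ↔ q ≤ g := by
  intro g
  rcases lt_or_ge (v : ℕ) g with h | h
  · rw [D_pre_hi v π g h, hq]; omega
  · rw [D_pre_lo v π g h, hq]; omega

lemma Dq_mid (hv : (v : ℕ) < k+1) (h2 : q ≤ v) : ∀ g, D (pre v π) g ↔ (v : ℕ) + 1 ≤ g := by
  intro g
  rcases lt_or_ge (v : ℕ) g with h | h
  · rw [D_pre_hi v π g h, hq]; omega
  · rw [D_pre_lo v π g h, hq]; omega

lemma Dq_low (h2 : (v : ℕ) < q) : ∀ g, D (pre v π) g ↔ q + 1 ≤ g := by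
  intro g
  rcases lt_or_ge (v : ℕ) g with h | h
  · rw [D_pre_hi v π g h, hq]; omega
  · rw [D_pre_lo v π g h, hq]; omega

lemma w_top (m : ℕ) (hv : (v : ℕ) = k+1) :
    ww m (pre v π) = (ab m).1 (tt π + 1) + ll π * (ab m).2 (tt π + 1) := by
  classical
  have hd := Dq_top π hqk hq v hv
  have e1 : tt (pre v π) = tt π + 1 := by
    rw [tt_of_q _ hd, tt_of_q _ hq]; omega
  have e2 : ll (pre v π) = ll π := by
    rw [ll_of_q _ hd (by omega), ll_of_q _ hq (by omega)]
    congr 1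
    apply Finset.filter_congr
    intro g hg
    rw [Finset.mem_range] at hg
    rw [A_pre_lo v π g (by omega)]
    exact and_iff_left (I_top π (by omega))
  rw [ww, e1, e2]

lemma w_sec (m : ℕ) (hv : (v : ℕ) = k) :
    ww m (pre v π) = (ab m).1 2 + (ll π + (tt π - 1)) * (ab m).2 2 := by
  classical
  have hd := Dq_mid π hqk hq v (by omega) (by omega)
  have e1 : tt (pre v π) = 2 := by
    rw [tt_of_q _ hd]; omega
  have e2 : ll (pre v π) = ll π + (tt π - 1) := by
    rw [ll_of_q _ hd (by omega), ll_of_q _ hq (by omega), tt_of_q _ hq]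
    have : (Finset.range ((v:ℕ)+1)).filter (fun g => A (pre v π) g)
        = (Finset.range q).filter (fun g => A π g) ∪ Finset.Ico q (k+1) := by
      ext g
      simp only [Finset.mem_filter, Finset.mem_range, Finset.mem_union, Finset.mem_Ico]
      constructor
      · rintro ⟨h1, h2⟩
        rw [A_pre_lo v π g (by omega)] at h2
        by_cases hgq : g < q
        · exact Or.inl ⟨hgq, h2.1⟩
        · right; omega
      · rintro (⟨h1, h2⟩ | ⟨h1, h2⟩)
        · refine ⟨by omega, ?_⟩
          rw [A_pre_lo v π g (by omega)]
          exact ⟨h2, I_top π (by omega)⟩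
        · refine ⟨by omega, ?_⟩
          rw [A_pre_lo v π g (by omega)]
          exact ⟨D_A π ((hq g).2 h1), I_top π (by omega)⟩
    rw [this, Finset.card_union_of_disjoint, Nat.card_Ico]
    · omega
    · rw [Finset.disjoint_left]
      intro g h1 h2
      simp only [Finset.mem_filter, Finset.mem_range, Finset.mem_Ico] at h1 h2
      omega
  rw [ww, e1, e2]

lemma w_mid (m : ℕ) (hv : (v : ℕ) < k) (h2 : q ≤ v) :
    ww m (pre v π) = (ab m).1 (k + 2 - v) := by
  classical
  have hd := Dq_mid π hqk hq v (by omega) (by omega)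
  have e1 : tt (pre v π) = k + 2 - v := by
    rw [tt_of_q _ hd]; omega
  have e2 : ll (pre v π) = 0 := by
    rw [ll_of_q _ hd (by omega), Finset.card_eq_zero, Finset.filter_eq_empty_iff]
    intro g hg ha
    rw [Finset.mem_range] at hg
    rw [A_pre_lo v π g (by omega)] at ha
    exact not_D_I π (by omega) ((hq v).2 h2) ha.2
  rw [ww, e1, e2]; simp

open Classical in
lemma w_low (m : ℕ) (h2 : (v : ℕ) < q) :
    ww m (pre v π) = (ab m).1 (tt π) + (if I π v then
      ((Finset.range ((v : ℕ)+1)).filter (fun g => A π g)).card else 0) * (ab m).2 (tt π) := by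
  have hd := Dq_low π hqk hq v (by omega)
  have e1 : tt (pre v π) = tt π := by
    rw [tt_of_q _ hd, tt_of_q _ hq]; omega
  have e2 : ll (pre v π) = (if I π v then
      ((Finset.range ((v : ℕ)+1)).filter (fun g => A π g)).card else 0) := by
    have e3 : ll (pre v π) = ((Finset.range ((v : ℕ)+1)).filter (fun g => A π g ∧ I π v)).card := by
      rw [ll_of_q _ hd (by omega)]
      congr 1
      ext g
      simp only [Finset.mem_filter, Finset.mem_range]
      rcases lt_or_ge (v : ℕ) g with h | h
      · rw [A_pre_hi v π g h, hq]; omega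
      · rw [A_pre_lo v π g h]
        constructor
        · rintro ⟨h3, h4⟩; exact ⟨by omega, h4⟩
        · rintro ⟨h3, h4⟩; exact ⟨by omega, h4⟩
    rw [e3]
    split_ifs with hI
    · simp [hI]
    · simp [hI]
  rw [ww, e1, e2]
end

def Inv {k : ℕ} (π : Perm (Fin (k+1))) : Prop :=
  (¬ D π (k-1) → ∀ g, A π g → g ≤ k-1 → ∃ u, g ≤ u ∧ u ≤ k-1 ∧ A π u ∧ I π u) ∧
  (¬ D π (k-1) → ∀ u w, I π u → u < w → w ≤ k-1 → ¬ A π w)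

open Classical in
lemma low_sum {k q : ℕ} (π : Perm (Fin (k+1))) (hqk : q ≤ k) (hq : ∀ g, D π g ↔ q ≤ g)
    (hinv : Inv π) :
    (∑ v ∈ Finset.range q, if A π v then (if I π v then
      ((Finset.range (v+1)).filter (fun g => A π g)).card else 0) else 0)
    = if tt π = 2 then ll π else 0 := by
  have ht := tt_of_q _ hq
  rcases hqk.lt_or_eq with h | h
  · rw [if_neg (by omega)]
    apply Finset.sum_eq_zero
    intro v hv
    rw [Finset.mem_range] at hv
    have : ¬ I π v := fun hI => not_D_I π (g := q) (by omega) ((hq q).2 le_rfl) (I_up π hv.le hI)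
    simp [this]
  · subst h
    rw [if_pos (by omega), ll_of_q _ hq (by omega)]
    rcases Finset.eq_empty_or_nonempty ((Finset.range q).filter (fun g => A π g)) with he | ⟨g, hg⟩
    · rw [he]
      rw [Finset.filter_eq_empty_iff] at he
      apply Finset.sum_eq_zero
      intro v hv
      simp [he hv]
    · rw [Finset.mem_filter, Finset.mem_range] at hg
      have hnD : ¬ D π (q-1) := by rw [hq]; omega
      obtain ⟨u, -, hu1, hu2, hu3⟩ := hinv.1 hnD g hg.2 (by omega)
      have hi2 := hinv.2 hnD
      rw [Finset.sum_eq_single u]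
      · rw [if_pos hu2, if_pos hu3]
        congr 1
        ext g
        simp only [Finset.mem_filter, Finset.mem_range]
        constructor
        · rintro ⟨h3, h4⟩; exact ⟨by omega, h4⟩
        · rintro ⟨h3, h4⟩
          refine ⟨?_, h4⟩
          by_contra hc
          exact hi2 u g hu3 (by omega) (by omega) h4
      · intro v hv hne
        rw [Finset.mem_range] at hv
        split_ifs with h1 h2
        · rcases lt_or_gt_of_ne hne with h5 | h5
          · exact (hi2 v u h2 h5 (by omega) hu2).elim
          · exact (hi2 u v hu3 h5 (by omega) h1).elim
        · rfl
        · rfl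
      · intro hc; rw [Finset.mem_range] at hc; omega

open Classical in
lemma step {k : ℕ} (π : Perm (Fin (k+1))) (hinv : Inv π) (m : ℕ) :
    (∑ v : Fin (k+1+1), if A π v then ww m (pre v π) else 0) = ww (m+1) π := by
  obtain ⟨q, hqk, hq⟩ := exq π
  have ht := tt_of_q _ hq
  let F : ℕ → ℕ := fun v => if v = k+1 then (ab m).1 (tt π + 1) + ll π * (ab m).2 (tt π + 1)
    else if v = k then (ab m).1 2 + (ll π + (tt π - 1)) * (ab m).2 2
    else if q ≤ v then (ab m).1 (k+2-v)
    else if A π v then (ab m).1 (tt π) + (if I π v then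
      ((Finset.range (v+1)).filter (fun g => A π g)).card else 0) * (ab m).2 (tt π) else 0
  have hF : ∀ v : Fin (k+1+1), (if A π v then ww m (pre v π) else 0) = F v := by
    intro v
    have hv := v.2
    have hA : q ≤ v → A π v := fun h => D_A π ((hq v).2 h)
    simp only [F]
    split_ifs with h1 h2 h3 h4 h5 h6 h7 <;> try omega
    all_goals first
      | exact w_top π hqk hq v m (by assumption)
      | exact w_sec π hqk hq v m (by assumption)
      | exact w_mid π hqk hq v m (by omega) (by assumption)
      | (rw [w_low π hqk hq v m (by omega)]; simp_all)
      | exact absurd (hA (by omega)) (by assumption)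
      | rfl
  rw [Finset.sum_congr rfl (fun v _ => hF v), Fin.sum_univ_eq_sum_range F (k+1+1),
    Finset.sum_range_succ, Finset.sum_range_succ]
  have h1 : F (k+1) = (ab m).1 (tt π + 1) + ll π * (ab m).2 (tt π + 1) := by simp [F]
  have h2 : F k = (ab m).1 2 + (ll π + (tt π - 1)) * (ab m).2 2 := by simp [F]
  have h3 : ∑ v ∈ Finset.range k, F v = ∑ v ∈ Finset.range q, F v + ∑ v ∈ Finset.Ico q k, F v := by
    rw [Finset.range_eq_Ico, Finset.range_eq_Ico, Finset.sum_Ico_consecutive _ (by omega) hqk]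
  have h4 : ∑ v ∈ Finset.Ico q k, F v = ∑ i ∈ Finset.Ico 3 (tt π + 1), (ab m).1 i := by
    have := Finset.sum_Ico_reflect (ab m).1 q (m := k) (n := k+2) (by omega)
    rw [show k + 2 + 1 - k = 3 by omega, show k + 2 + 1 - q = tt π + 1 by omega] at this
    rw [← this]
    apply Finset.sum_congr rfl
    intro v hv
    rw [Finset.mem_Ico] at hv
    simp only [F]
    rw [if_neg (by omega), if_neg (by omega), if_pos hv.1]
  have h5 : ∑ v ∈ Finset.range q, F v = ll π * (ab m).1 (tt π)
      + (if tt π = 2 then ll π else 0) * (ab m).2 (tt π) := by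
    rw [← low_sum π hqk hq hinv, ll_of_q π hq (by omega), Finset.card_filter, Finset.sum_mul,
      Finset.sum_mul, ← Finset.sum_add_distrib]
    apply Finset.sum_congr rfl
    intro v hv
    rw [Finset.mem_range] at hv
    simp only [F]
    rw [if_neg (by omega), if_neg (by omega), if_neg (by omega)]
    by_cases hA : A π v <;> simp [hA]
  have h6 : ∑ i ∈ Finset.Ico 2 (tt π + 1), (ab m).1 i
      = (ab m).1 2 + ∑ i ∈ Finset.Ico 3 (tt π + 1), (ab m).1 i := by
    rw [Finset.sum_eq_sum_Ico_succ_bot (by omega)]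
  rw [h1, h2, h3, h4, h5, ww, ab]
  simp only
  rw [h6]
  by_cases h7 : tt π = 2
  · simp only [h7, if_true]; ring
  · simp only [h7, if_false]; ring

open Classical in
lemma stepc {k : ℕ} (π : Perm (Fin (k+1))) (m : ℕ) :
    (∑ v : Fin (k+1+1), if D π v then cc m (tt (pre v π)) else 0) = cc (m+1) (tt π) := by
  obtain ⟨q, hqk, hq⟩ := exq π
  have ht := tt_of_q _ hq
  let F : ℕ → ℕ := fun v => if v = k+1 then cc m (tt π + 1) 
    else if q ≤ v then cc m (k+2-v) else 0
  have hF : ∀ v : Fin (k+1+1), (if D π v then cc m (tt (pre v π)) else 0) = F v := by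
    intro v
    have hv := v.2
    rw [hq]
    simp only [F]
    split_ifs with h1 h2 h3 h4 h5 h6 h7 <;> try omega
    · rw [tt_of_q _ (Dq_top π hqk hq v h2)]; congr 1; omega
    · rw [tt_of_q _ (Dq_mid π hqk hq v (by omega) h1)]; congr 1; omega
  rw [Finset.sum_congr rfl (fun v _ => hF v), Fin.sum_univ_eq_sum_range F (k+1+1),
    Finset.sum_range_succ]
  have h1 : F (k+1) = cc m (tt π + 1) := by simp [F]
  have h3 : ∑ v ∈ Finset.range (k+1), F v
      = ∑ v ∈ Finset.range q, F v + ∑ v ∈ Finset.Ico q (k+1), F v := by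
    rw [Finset.range_eq_Ico, Finset.range_eq_Ico, Finset.sum_Ico_consecutive _ (by omega) (by omega)]
  have h4 : ∑ v ∈ Finset.Ico q (k+1), F v = ∑ i ∈ Finset.Ico 2 (tt π + 1), cc m i := by
    have := Finset.sum_Ico_reflect (cc m) q (m := k+1) (n := k+2) (by omega)
    rw [show k + 2 + 1 - (k+1) = 2 by omega, show k + 2 + 1 - q = tt π + 1 by omega] at this
    rw [← this]
    apply Finset.sum_congr rfl
    intro v hv
    rw [Finset.mem_Ico] at hv
    simp only [F]
    rw [if_neg (by omega), if_pos hv.1]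
  have h5 : ∑ v ∈ Finset.range q, F v = 0 := by
    apply Finset.sum_eq_zero
    intro v hv
    rw [Finset.mem_range] at hv
    simp only [F]
    rw [if_neg (by omega), if_neg (by omega)]
  rw [h1, h3, h4, h5, cc]
  simp only
  omega

lemma inv_of_avoids {k : ℕ} (π : Perm (Fin (k+1))) (h : AvoidsBoth π) : Inv π := by
  obtain ⟨⟨v, ρ⟩, rfl⟩ := (preEquiv k).surjective π
  rw [preEquiv_apply] at *
  simp only at *
  rw [both_pre] at h
  rcases Nat.eq_zero_or_pos k with rfl | hk
  · constructor
    · intro hD; exact (hD (D_top _ (by omega))).elim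
    · intro hD; exact (hD (D_top _ (by omega))).elim
  · exact ⟨fun hD g hg hgn => inv1 v ρ h.2 hD hk hg hgn, fun hD u w hu huw hw => inv2 v ρ hD hk hu huw hw⟩

open Classical in
lemma fstep (k m : ℕ) :
    (∑ π : Perm (Fin (k+1+1)), if AvoidsBoth π then ww m π else 0)
    = ∑ π : Perm (Fin (k+1)), if AvoidsBoth π then ww (m+1) π else 0 := by
  rw [← (preEquiv (k+1)).sum_comp, Fintype.sum_prod_type_right]
  apply Finset.sum_congr rfl
  intro π _
  simp only [preEquiv_apply, both_pre]
  by_cases h : AvoidsBoth π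
  · simp only [h, true_and, if_true]
    exact step π (inv_of_avoids π h) m
  · simp [h]

open Classical in
lemma cstep (k m : ℕ) :
    (∑ π : Perm (Fin (k+1+1)), if ¬ Contains123 π then cc m (tt π) else 0)
    = ∑ π : Perm (Fin (k+1)), if ¬ Contains123 π then cc (m+1) (tt π) else 0 := by
  rw [← (preEquiv (k+1)).sum_comp, Fintype.sum_prod_type_right]
  apply Finset.sum_congr rfl
  intro π _
  simp only [preEquiv_apply, av123_pre]
  by_cases h : ¬ Contains123 π
  · simp only [h, not_false_eq_true, true_and, if_true]
    exact stepc π m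
  · simp [h]

lemma tt_one (π : Perm (Fin 1)) : tt π = 2 :=
  tt_of_q (q := 0) π (fun g => ⟨fun _ => Nat.zero_le _, fun _ => D_top π (by omega)⟩)

lemma ll_one (π : Perm (Fin 1)) : ll π = 0 := by
  classical
  rw [ll_of_q (q := 0) π (fun g => ⟨fun _ => Nat.zero_le _, fun _ => D_top π (by omega)⟩) (by omega)]
  simp

noncomputable def ff (n : ℕ) : ℕ := Nat.card {π : Perm (Fin n) // AvoidsBoth π}
noncomputable def uu (n : ℕ) : ℕ := Nat.card {π : Perm (Fin n) // ¬ Contains123 π}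

open Classical in
lemma ff_eq (k : ℕ) : ff (k+1) = (ab k).1 2 := by
  have h : ∀ k m, (∑ π : Perm (Fin (k+1)), if AvoidsBoth π then ww m π else 0) = (ab (m+k)).1 2 := by
    intro k
    induction k with
    | zero =>
      intro m
      have : ∀ π : Perm (Fin 1), AvoidsBoth π := fun π => by
        constructor <;> rintro ⟨i, j, _, _, h, _⟩ <;> omega
      simp [this, ww, tt_one, ll_one]
    | succ k ih => intro m; rw [fstep, ih, show m + 1 + k = m + (k+1) by omega]
  have h0 := h k 0
  rw [zero_add] at h0
  rw [← h0, ff, Nat.card_eq_fintype_card, Fintype.card_subtype, Finset.card_filter]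
  simp [ww, ab]

open Classical in
lemma uu_eq (k : ℕ) : uu (k+1) = cc k 2 := by
  have h : ∀ k m, (∑ π : Perm (Fin (k+1)), if ¬ Contains123 π then cc m (tt π) else 0) = cc (m+k) 2 := by
    intro k
    induction k with
    | zero =>
      intro m
      have : ∀ π : Perm (Fin 1), ¬ Contains123 π := fun π => by
        rintro ⟨i, j, _, h, _⟩; omega
      simp [this, tt_one]
    | succ k ih => intro m; rw [cstep, ih]; congr 1; omega
  have h0 := h k 0
  rw [zero_add] at h0
  rw [← h0, uu, Nat.card_eq_fintype_card, Fintype.card_subtype, Finset.card_filter]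
  simp [cc]

open Classical in
lemma ss_gen (p : ∀ n, Perm (Fin n) → Prop) (n : ℕ)
    (hp : ∀ π : Perm (Fin n), p (n+1) (pre (Fin.last n) π) ↔ p n π) :
    Nat.card {π : Perm (Fin (n+1)) // StartSmall π ∧ p (n+1) π} + Nat.card {π : Perm (Fin n) // p n π}
      = Nat.card {π : Perm (Fin (n+1)) // p (n+1) π} := by
  simp only [Nat.card_eq_fintype_card, Fintype.card_subtype, Finset.card_filter]
  rw [← (preEquiv n).sum_comp, ← (preEquiv n).sum_comp, Fintype.sum_prod_type_right,
    Fintype.sum_prod_type_right, ← Finset.sum_add_distrib]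
  apply Finset.sum_congr rfl
  intro π _
  simp only [preEquiv_apply, startSmall_pre]
  rw [Fin.sum_univ_castSucc, Fin.sum_univ_castSucc]
  simp only [hp]
  congr 1
  have : ∀ x : Fin n, (x : ℕ) ≠ n := fun x => by omega
  simp only [this, ne_eq, not_false_eq_true, true_and, Fin.val_castSucc,
    Fin.val_last, not_true_eq_false, false_and, if_false, add_zero]
  exact Finset.sum_congr rfl (fun i _ => by congr)

lemma ss_both (n : ℕ) : Nat.card {π : Perm (Fin (n+1)) // StartSmall π ∧ AvoidsBoth π} + ff n = ff (n+1) := by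
  refine ss_gen (fun _ π => AvoidsBoth π) n (fun π => ?_)
  rw [both_pre]
  exact and_iff_left (D_A π (D_top π (by simp)))

lemma ss_123 (n : ℕ) : s (n+1) + uu n = uu (n+1) := by
  refine ss_gen (fun _ π => ¬ Contains123 π) n (fun π => ?_)
  rw [av123_pre]
  exact and_iff_left (D_top π (by simp))
open PowerSeries

noncomputable def LL (k N : ℕ) : Finset (List ℕ) :=
  ((Finset.univ : Finset (Composition N)).filter (fun c => c.length = k)).image (fun c => c.blocks)

lemma mem_LL (k N : ℕ) (l : List ℕ) :
    l ∈ LL k N ↔ l.length = k ∧ (∀ x ∈ l, 0 < x) ∧ l.sum = N := by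
  simp only [LL, Finset.mem_image, Finset.mem_filter, Finset.mem_univ, true_and]
  constructor
  · rintro ⟨c, h1, rfl⟩
    exact ⟨h1, fun x hx => c.blocks_pos hx, c.blocks_sum⟩
  · rintro ⟨h1, h2, h3⟩
    exact ⟨⟨l, fun hx => h2 _ hx, h3⟩, h1, rfl⟩

lemma sum_LL (k N : ℕ) (f : List ℕ → ℤ) :
    (∑ c : Composition N, if c.length = k then f c.blocks else 0) = ∑ l ∈ LL k N, f l := by
  rw [LL, Finset.sum_image, Finset.sum_filter]
  intro c _ d _ h
  exact Composition.ext h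

lemma coeff_pow_LL (f : ℕ → ℤ) (S : ℤ⟦X⟧) (h0 : coeff 0 S = 0)
    (hS : ∀ m, 0 < m → coeff m S = f m) (k : ℕ) :
    ∀ N, coeff N (S^k) = ∑ l ∈ LL k N, (l.map f).prod := by
  induction k with
  | zero =>
    intro N
    rw [pow_zero, coeff_one]
    split_ifs with h
    · subst h
      have : LL 0 0 = {[]} := by
        ext l; simp only [mem_LL, Finset.mem_singleton, List.length_eq_zero_iff]
        constructor
        · exact fun h => h.1
        · rintro rfl; simp
      simp [this]
    · have : LL 0 N = ∅ := by
        ext l; simp only [mem_LL, List.length_eq_zero_iff, Finset.notMem_empty, iff_false]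
        rintro ⟨rfl, -, h2⟩
        exact h (by simpa using h2.symm)
      simp [this]
  | succ k ih =>
    intro N
    rw [pow_succ', coeff_mul]
    have e : ∑ p ∈ Finset.HasAntidiagonal.antidiagonal N, coeff p.1 S * coeff p.2 (S^k)
        = ∑ p ∈ (Finset.HasAntidiagonal.antidiagonal N).filter (fun p => 0 < p.1),
            ∑ l ∈ LL k p.2, f p.1 * (l.map f).prod := by
      rw [Finset.sum_filter]
      apply Finset.sum_congr rfl
      intro p _
      split_ifs with h
      · rw [hS _ h, ih, Finset.mul_sum]
      · have : p.1 = 0 := by omega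
        rw [this, h0, zero_mul]
    rw [e, Finset.sum_sigma']
    refine Finset.sum_bij (fun x _ => x.1.1 :: x.2) ?_ ?_ ?_ ?_
    · rintro ⟨⟨i, j⟩, l⟩ h
      simp only [Finset.mem_sigma, Finset.mem_filter, Finset.HasAntidiagonal.mem_antidiagonal, mem_LL] at h ⊢
      obtain ⟨⟨h1, h2⟩, h3, h4, h5⟩ := h
      refine ⟨by simp [h3], ?_, by simp [h5, h1]⟩
      intro x hx
      rcases List.mem_cons.1 hx with rfl | hx
      · exact h2
      · exact h4 x hx
    · rintro ⟨⟨i, j⟩, l⟩ h ⟨⟨i', j'⟩, l'⟩ h' he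
      simp only [Finset.mem_sigma, Finset.mem_filter, Finset.HasAntidiagonal.mem_antidiagonal, mem_LL] at h h'
      simp only [List.cons.injEq] at he
      obtain ⟨rfl, rfl⟩ := he
      have : j = j' := by omega
      subst this
      rfl
    · intro l hl
      rw [mem_LL] at hl
      obtain ⟨h1, h2, h3⟩ := hl
      cases l with
      | nil => simp at h1
      | cons i l =>
        simp only [List.length_cons, Nat.add_right_cancel_iff, List.sum_cons] at h1 h3
        refine ⟨⟨(i, l.sum), l⟩, ?_, rfl⟩
        simp only [Finset.mem_sigma, Finset.mem_filter, Finset.HasAntidiagonal.mem_antidiagonal, mem_LL]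
        exact ⟨⟨h3, h2 i (by simp)⟩, h1, fun x hx => h2 x (by simp [hx]), trivial⟩
    · intro x _
      simp

noncomputable def CS : ℤ⟦X⟧ := PowerSeries.map (Nat.castRingHom ℤ) catalanSeries

lemma CS_eq : CS = 1 + X * CS^2 := by
  have := congrArg (PowerSeries.map (Nat.castRingHom ℤ)) catalanSeries_sq_mul_X_add_one
  simp only [map_add, map_mul, map_pow, map_one, PowerSeries.map_X] at this
  rw [CS]
  linear_combination -this

lemma CS_const : constantCoeff CS = 1 := by
  have := congrArg constantCoeff CS_eq
  simpa using this

lemma CS_pow (t : ℕ) : CS^(t+1) = CS^t + X * CS^(t+2) := by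
  have := CS_eq
  linear_combination CS^t * this

lemma CS_sum (t : ℕ) : CS^(t+1) = 1 + X * (CS^(t+2) + ∑ i ∈ Finset.Ico 2 (t+2), CS^i) := by
  induction t with
  | zero => simpa using CS_eq
  | succ t ih =>
    rw [Finset.sum_Ico_succ_top (by omega)]
    have := CS_pow (t+1)
    linear_combination ih + this

lemma coeff_CS (m : ℕ) : ∀ t, coeff m (CS^(t+1)) = (cc m (t+1) : ℤ) := by
  induction m with
  | zero => intro t; simp [cc, CS_const]
  | succ m ih =>
    intro t
    rw [CS_sum, map_add, coeff_succ_X_mul, map_add, map_sum, ih (t+1), cc]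
    have : ∑ x ∈ Finset.Ico 2 (t+2), coeff m (CS^x) = ∑ x ∈ Finset.Ico 2 (t+2), (cc m x : ℤ) := by
      apply Finset.sum_congr rfl
      intro x hx
      rw [Finset.mem_Ico] at hx
      obtain ⟨y, rfl⟩ : ∃ y, x = y + 1 := ⟨x-1, by omega⟩
      exact ih y
    rw [this]
    simp [coeff_one]

noncomputable def TS : ℤ⟦X⟧ := CS^2 - CS

lemma TS_const : constantCoeff TS = 0 := by simp [TS, CS_const]

lemma exKB : ∃ K B : ℤ⟦X⟧, K * (1 - TS) = 1 ∧ (1 - X) * B = K * TS := by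
  have h1 : IsUnit (1 - TS) := by
    rw [PowerSeries.isUnit_iff_constantCoeff]; simp [TS_const]
  have h2 : IsUnit (1 - X : ℤ⟦X⟧) := by
    rw [PowerSeries.isUnit_iff_constantCoeff]; simp
  obtain ⟨K, hK⟩ := h1.exists_left_inv
  obtain ⟨L, hL⟩ := h2.exists_right_inv
  exact ⟨K, L * (K * TS), hK, by rw [← mul_assoc, hL, one_mul]⟩

section
variable (K B : ℤ⟦X⟧) (hK : K * (1 - TS) = 1) (hB : (1 - X) * B = K * TS)
include hK hB

lemma al_sum (t : ℕ) : K * CS^(t+1) - B = 1 + X * ((K * CS^(t+2) - B)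
    + ∑ i ∈ Finset.Ico 2 (t+2), (K * CS^i - B) + (t : ℤ⟦X⟧) * B) := by
  induction t with
  | zero =>
    have := CS_eq
    simp
    linear_combination K * this - hB + hK
  | succ t ih =>
    rw [Finset.sum_Ico_succ_top (by omega)]
    have := CS_pow (t+1)
    push_cast
    linear_combination ih + K * this

lemma be_two : B = X * (K * X * CS^4 + B + (K * CS^2 - B) + B) := by
  have := CS_eq
  have e : TS = X * (X * CS^4 + CS^2) := by
    rw [TS]
    linear_combination (CS + X * CS^2) * this
  linear_combination hB + K * e

lemma coeff_ab (m : ℕ) : (∀ t, coeff m (K * CS^(t+1) - B) = ((ab m).1 (t+1) : ℤ)) ∧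
    (∀ t, coeff m (K * X * CS^(t+4)) = ((ab m).2 (t+3) : ℤ)) ∧ coeff m B = ((ab m).2 2 : ℤ) := by
  have hT0 := TS_const
  have hK0 : constantCoeff K = 1 := by
    have := congrArg constantCoeff hK
    simpa [hT0] using this
  have hB0 : constantCoeff B = 0 := by
    have := congrArg constantCoeff hB
    simpa [hT0] using this
  induction m with
  | zero => simp [ab, CS_const, hK0, hB0]
  | succ m ih =>
    obtain ⟨i1, i2, i3⟩ := ih
    refine ⟨fun t => ?_, fun t => ?_, ?_⟩
    · rw [al_sum K B hK hB, map_add, coeff_succ_X_mul, map_add, map_add, map_sum, i1 (t+1), ab]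
      have : ∑ x ∈ Finset.Ico 2 (t+2), coeff m (K * CS^x - B)
          = ∑ x ∈ Finset.Ico 2 (t+2), ((ab m).1 x : ℤ) := by
        apply Finset.sum_congr rfl
        intro x hx
        rw [Finset.mem_Ico] at hx
        obtain ⟨y, rfl⟩ : ∃ y, x = y + 1 := ⟨x-1, by omega⟩
        exact i1 y
      have e2 : coeff m ((t : ℤ⟦X⟧) * B) = (t : ℤ) * (ab m).2 2 := by
        rw [← nsmul_eq_mul, map_nsmul, i3, nsmul_eq_mul]
      rw [this, e2]
      simp [coeff_one]
    · have e : K * X * CS^(t+4) = X * (K * X * CS^(t+1+4) + B + (K * CS^(t+2+1) - B)) := by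
        have := CS_pow (t+3)
        linear_combination K * X * this
      rw [e, coeff_succ_X_mul, map_add, map_add, i2 (t+1), i3, i1 (t+2), ab]
      simp
    · have e := congrArg (coeff (m+1)) (be_two K B hK hB)
      have j2 : coeff m (K * X * CS^4) = ((ab m).2 3 : ℤ) := i2 0
      have j1 : coeff m (K * CS^2 - B) = ((ab m).1 2 : ℤ) := i1 1
      rw [coeff_succ_X_mul, map_add, map_add, map_add, j2, i3, j1] at e
      rw [e, ab]
      simp

lemma coeff_main (j : ℕ) :
    (Nat.card {π : Perm (Fin (j+2)) // StartSmall π ∧ AvoidsBoth π} : ℤ) = coeff (j+1) (K * TS) := by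
  have h1 := ss_both (j+1)
  rw [ff_eq, ff_eq] at h1
  have h2 : (Nat.card {π : Perm (Fin (j+2)) // StartSmall π ∧ AvoidsBoth π} : ℤ)
      + (ab j).1 2 = (ab (j+1)).1 2 := by exact_mod_cast h1
  have e : K * TS = (K * CS^(1+1) - B) - X * (K * CS^(1+1) - B) - 1 := by
    have h := CS_eq
    have hT : TS = CS^2 - CS := rfl
    linear_combination (-1) * hK + hB - K * h + K * hT
  rw [e, map_sub, map_sub, coeff_succ_X_mul, (coeff_ab K B hK hB _).1, (coeff_ab K B hK hB _).1,
    coeff_one]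
  simp
  linarith
end

lemma s_one : s 1 = 0 := by
  have h := ss_123 0
  have h1 : uu 1 = 1 := by rw [uu_eq]; rfl
  have h0 : 0 < uu 0 := by
    rw [uu, Nat.card_pos_iff]
    refine ⟨⟨⟨1, ?_⟩⟩, inferInstance⟩
    rintro ⟨i, _⟩
    exact i.elim0
  rw [zero_add] at h
  omega

lemma coeff_TS (j : ℕ) : coeff j TS = (s (j+1) : ℤ) := by
  cases j with
  | zero => rw [s_one]; simpa using TS_const
  | succ j =>
    have h1 := ss_123 (j+1)
    rw [uu_eq, uu_eq] at h1
    have h2 : (s (j+1+1) : ℤ) + cc j 2 = cc (j+1) 2 := by exact_mod_cast h1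
    have e : TS = CS^(1+1) - X * CS^(1+1) - 1 := by
      have h := CS_eq
      have hT : TS = CS^2 - CS := rfl
      linear_combination hT + (-1) * h
    rw [e, map_sub, map_sub, coeff_succ_X_mul, coeff_CS, coeff_CS, coeff_one]
    simp
    linarith

lemma geo (K : ℤ⟦X⟧) (hK : K * (1 - TS) = 1) (N : ℕ) :
    K * TS = ∑ k ∈ Finset.Icc 1 N, TS^k + TS^N * (K * TS) := by
  induction N with
  | zero => simp
  | succ N ih =>
    rw [Finset.sum_Icc_succ_top (by omega)]
    linear_combination ih + TS^(N+1) * hK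

lemma coeff_geo (K : ℤ⟦X⟧) (hK : K * (1 - TS) = 1) (N : ℕ) :
    coeff N (K * TS) = ∑ k ∈ Finset.Icc 1 N, coeff N (TS^k) := by
  have h := congrArg (coeff N) (geo K hK N)
  rw [map_add, map_sum] at h
  have hX : (X : ℤ⟦X⟧) ∣ TS := PowerSeries.X_dvd_iff.2 TS_const
  have : (X : ℤ⟦X⟧)^(N+1) ∣ TS^N * (K * TS) := by
    have h2 := pow_dvd_pow_of_dvd hX (N+1)
    refine h2.trans ⟨K, by ring⟩
  rw [PowerSeries.X_pow_dvd_iff] at this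
  rw [this N (by omega), add_zero] at h
  exact h

end CAux

theorem stmt6 (n : ℕ) (hn : 2 ≤ n) :
    Nat.card {π : Equiv.Perm (Fin n) // StartSmall π ∧ AvoidsBoth π}
      = ∑ k ∈ Finset.Icc 1 (n - 1),
          ∑ c : Composition (n - 1 + k), if c.length = k then (c.blocks.map s).prod else 0 := by
  obtain ⟨j, rfl⟩ : ∃ j, n = j + 2 := ⟨n - 2, by omega⟩
  obtain ⟨K, B, hK, hB⟩ := CAux.exKB
  have h1 := CAux.coeff_main K B hK hB j
  rw [CAux.coeff_geo K hK] at h1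
  rw [← Nat.cast_inj (R := ℤ), h1, show j + 2 - 1 = j + 1 by omega]
  push_cast
  apply Finset.sum_congr rfl
  intro k _
  have h2 := CAux.coeff_pow_LL (fun m => (s m : ℤ)) (PowerSeries.X * CAux.TS) (by simp)
    (by
      intro m hm
      obtain ⟨i, rfl⟩ : ∃ i, m = i + 1 := ⟨m - 1, by omega⟩
      rw [PowerSeries.coeff_succ_X_mul, CAux.coeff_TS]) k (j + 1 + k)
  rw [mul_pow, PowerSeries.coeff_X_pow_mul, ← CAux.sum_LL] at h2
  rw [h2]
  apply Finset.sum_congr rfl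
  intro c _
  split_ifs
  · rw [List.map_map]; rfl
  · rfl
end

section
/- For every n ≥ 0, the number of start-small 123-avoiding permutations of [n+2] equals Σ_{a+b+c=n} C_a·C_b·C_c, the sum over all ordered triples (a,b,c) of nonnegative integers with a+b+c = n of products of Catalan numbers (i.e., the coefficient of x^n in C(x)³ where C(x) is the Catalan generating function). -/
/-- Prepend the entry `p` to `σ`. -/
def insP {n : ℕ} (x : Fin (n + 1) × Equiv.Perm (Fin n)) : Equiv.Perm (Fin (n + 1)) :=
  ((finSuccEquiv' 0).trans (Equiv.optionCongr x.2)).trans (finSuccEquiv' x.1).symm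

theorem insP_zero {n : ℕ} (x : Fin (n + 1) × Equiv.Perm (Fin n)) : insP x 0 = x.1 := by
  simp [insP]

theorem insP_succ {n : ℕ} (x : Fin (n + 1) × Equiv.Perm (Fin n)) (i : Fin n) :
    insP x i.succ = x.1.succAbove (x.2 i) := by
  have : finSuccEquiv' (0 : Fin (n + 1)) i.succ = some i := by
    rw [← Fin.succAbove_zero_apply]; exact finSuccEquiv'_succAbove 0 i
  simp [insP, this]

theorem insP_bij (n : ℕ) : Function.Bijective (@insP n) := by
  rw [Fintype.bijective_iff_injective_and_card]
  constructor
  · rintro ⟨p, σ⟩ ⟨q, τ⟩ h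
    have h0 := congrArg (fun f => f 0) h
    simp only [insP_zero] at h0
    subst h0
    congr 1
    ext i
    have h1 := congrArg (fun f => f i.succ) h
    simp only [insP_succ] at h1
    rw [Fin.succAbove_right_injective h1]
  · simp [Fintype.card_perm, Nat.factorial_succ]

/-- 123-avoiding, and every bottom of a 12 is below `m`. -/
def Bm (m : ℕ) {n : ℕ} (π : Equiv.Perm (Fin n)) : Prop :=
  ¬ Contains123 π ∧ ∀ i j, i < j → π i < π j → (π i : ℕ) < m

theorem exists_perm_gt {n : ℕ} (p : Fin (n + 1)) (σ : Equiv.Perm (Fin n)) (h : (p : ℕ) < n) :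
    ∃ j, p < p.succAbove (σ j) := by
  refine ⟨σ.symm ⟨p, h⟩, ?_⟩
  rw [Equiv.apply_symm_apply, Fin.lt_succAbove_iff_le_castSucc]
  simp [Fin.le_def]

theorem sA_val {n : ℕ} (p : Fin (n + 1)) (i : Fin n) :
    (p.succAbove i : ℕ) = if (i : ℕ) < p then (i : ℕ) else i + 1 := by
  unfold Fin.succAbove
  simp only [Fin.lt_def, Fin.val_castSucc]
  split_ifs <;> simp

theorem Bm_insP (m : ℕ) {n : ℕ} (p : Fin (n + 1)) (σ : Equiv.Perm (Fin n)) :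
    Bm m (insP (p, σ)) ↔ Bm (min p m) σ ∧ ((p : ℕ) < m ∨ (p : ℕ) = n) := by
  constructor
  · rintro ⟨h1, h2⟩
    have hlt : ∀ i j, i < j → σ i < σ j → (σ i : ℕ) < p := by
      intro i j hij hs
      by_contra hc
      apply h1
      refine ⟨0, i.succ, j.succ, Fin.succ_pos _, Fin.succ_lt_succ_iff.2 hij, ?_, ?_⟩
      · rw [insP_zero, insP_succ, Fin.lt_def, sA_val]; simp only [hc, if_false]; omega
      · rw [insP_succ, insP_succ]; exact Fin.succAbove_lt_succAbove_iff.2 hs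
    refine ⟨⟨?_, ?_⟩, ?_⟩
    · rintro ⟨i, j, k, a, b, c, d⟩
      apply h1
      refine ⟨i.succ, j.succ, k.succ, Fin.succ_lt_succ_iff.2 a, Fin.succ_lt_succ_iff.2 b, ?_, ?_⟩
      · rw [insP_succ, insP_succ]; exact Fin.succAbove_lt_succAbove_iff.2 c
      · rw [insP_succ, insP_succ]; exact Fin.succAbove_lt_succAbove_iff.2 d
    · intro i j hij hs
      have a := hlt i j hij hs
      have b := h2 i.succ j.succ (Fin.succ_lt_succ_iff.2 hij)
        (by rw [insP_succ, insP_succ]; exact Fin.succAbove_lt_succAbove_iff.2 hs)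
      rw [insP_succ, sA_val] at b
      simp only [a, if_true] at b
      exact lt_min a b
    · by_contra hc
      push Not at hc
      obtain ⟨j, hj⟩ := exists_perm_gt p σ (by omega)
      have := h2 0 j.succ (Fin.succ_pos _) (by rw [insP_zero, insP_succ]; exact hj)
      rw [insP_zero] at this
      simp only at this
      omega
  · rintro ⟨⟨h1, h2⟩, h3⟩
    constructor
    · rintro ⟨i, j, k, a, b, c, d⟩
      obtain ⟨j, rfl⟩ := Fin.exists_succ_eq.2 (Fin.ne_zero_of_lt a)
      obtain ⟨k, rfl⟩ := Fin.exists_succ_eq.2 (Fin.ne_zero_of_lt b)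
      rw [Fin.succ_lt_succ_iff] at b
      rw [insP_succ, insP_succ, Fin.succAbove_lt_succAbove_iff] at d
      induction i using Fin.cases with
      | zero =>
        have e := h2 j k b d
        rw [insP_zero, insP_succ, Fin.lt_def, sA_val] at c
        have e' := lt_of_lt_of_le e (min_le_left _ _)
        simp only [e', if_true] at c
        omega
      | succ i =>
        rw [Fin.succ_lt_succ_iff] at a
        rw [insP_succ, insP_succ, Fin.succAbove_lt_succAbove_iff] at c
        exact h1 ⟨i, j, k, a, b, c, d⟩
    · intro i j a c
      obtain ⟨j, rfl⟩ := Fin.exists_succ_eq.2 (Fin.ne_zero_of_lt a)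
      induction i using Fin.cases with
      | zero =>
        rw [insP_zero]
        rw [insP_zero, insP_succ, Fin.lt_def] at c
        have := (p.succAbove (σ j)).isLt
        simp only at c ⊢
        omega
      | succ i =>
        rw [Fin.succ_lt_succ_iff] at a
        rw [insP_succ, insP_succ, Fin.succAbove_lt_succAbove_iff] at c
        have e := h2 i j a c
        rw [insP_succ, sA_val]
        have e' := lt_of_lt_of_le e (min_le_left _ _)
        simp only [e', if_true]
        exact lt_of_lt_of_le e (min_le_right _ _)

open Classical in
/-- Counts. -/
noncomputable def cA (n m : ℕ) : ℕ :=
  (Finset.univ.filter (fun π : Equiv.Perm (Fin n) => Bm m π)).card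

open Classical in
theorem card_via {n : ℕ} (P : Equiv.Perm (Fin (n + 1)) → Prop) (Q : ℕ → Prop) (f : ℕ → ℕ)
    (h : ∀ (p : Fin (n + 1)) (σ : Equiv.Perm (Fin n)), P (insP (p, σ)) ↔ Bm (f p) σ ∧ Q p) :
    (Finset.univ.filter P).card
      = ∑ p ∈ Finset.range (n + 1), if Q p then cA n (f p) else 0 := by
  rw [Finset.card_filter, ← (insP_bij n).sum_comp (fun π => if P π then 1 else 0),
    Fintype.sum_prod_type, Finset.sum_range]
  refine Finset.sum_congr rfl fun p _ => ?_
  simp only [h]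
  by_cases hq : Q p
  · simp [hq, cA]
  · simp [hq]

theorem cA_succ (n m : ℕ) (hm : m ≤ n) :
    cA (n + 1) m = ∑ p ∈ Finset.range (m + 1), cA n p := by
  classical
  have := card_via (n := n) (fun π => Bm m π) (fun p => p < m ∨ p = n) (fun p => min p m)
    (fun p σ => Bm_insP m p σ)
  have e0 : cA (n + 1) m = (Finset.univ.filter
    (fun π : Equiv.Perm (Fin (n + 1)) => Bm m π)).card := by
    unfold cA; congr
  have hs0 : (∑ p ∈ Finset.range (n + 1), if p < m ∨ p = n then cA n (min p m) else 0)
      = ∑ p ∈ (Finset.range (n + 1)).filter (fun p => p < m ∨ p = n), cA n (min p m) := by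
    rw [Finset.sum_filter]
  have this2 : cA (n + 1) m
      = ∑ p ∈ Finset.range (n + 1), if p < m ∨ p = n then cA n (min p m) else 0 := by
    rw [e0]; convert this
  rw [this2, hs0]
  rw [Finset.sum_range_succ _ m]
  have hs : (Finset.range (n + 1)).filter (fun p => p < m ∨ p = n)
      = insert n (Finset.range m) := by
    ext p; simp; omega
  rw [hs, Finset.sum_insert (by simp; omega), add_comm]
  rw [min_eq_right hm]
  congr 1
  refine Finset.sum_congr rfl fun p hp => ?_
  rw [min_eq_left (Finset.mem_range.1 hp).le]

theorem cA_top (n : ℕ) : cA (n + 1) (n + 1) = ∑ p ∈ Finset.range (n + 1), cA n p := by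
  classical
  have := card_via (n := n) (fun π => Bm (n + 1) π) (fun p => p < n + 1 ∨ p = n)
    (fun p => min p (n + 1)) (fun p σ => Bm_insP (n + 1) p σ)
  unfold cA at this ⊢
  rw [this]
  refine Finset.sum_congr rfl fun p hp => ?_
  have hp := Finset.mem_range.1 hp
  rw [if_pos (Or.inl hp), min_eq_left hp.le]

/-- Ballot numbers. -/
def bal (n : ℕ) : ℕ → ℤ
  | 0 => 1
  | m + 1 => (Nat.choose (n + m + 1) (m + 1) : ℤ) - Nat.choose (n + m + 1) m

theorem bal_rec (n m : ℕ) : bal (n + 1) (m + 1) = bal (n + 1) m + bal n (m + 1) := by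
  cases m with
  | zero => simp [bal]; ring
  | succ m =>
    simp only [bal]
    have h1 : n + 1 + (m + 1) + 1 = (n + m + 2) + 1 := by ring
    have h2 : n + 1 + m + 1 = n + m + 2 := by ring
    have h3 : n + (m + 1) + 1 = n + m + 2 := by ring
    rw [h1, h2, h3, Nat.choose_succ_succ (n + m + 2) (m + 1), Nat.choose_succ_succ (n + m + 2) m]
    simp only [Nat.succ_eq_add_one]
    push_cast; ring

theorem bal_diag (n : ℕ) : bal n (n + 1) = 0 := by
  simp only [bal]
  rw [sub_eq_zero]
  norm_cast
  apply Nat.choose_symm_of_eq_add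
  ring

theorem sum_bal (n m : ℕ) : ∑ p ∈ Finset.range (m + 1), bal n p = bal (n + 1) m := by
  induction m with
  | zero => simp [bal]
  | succ m ih => rw [Finset.sum_range_succ, ih, bal_rec]

theorem cA_bal (n : ℕ) : ∀ m ≤ n, (cA n m : ℤ) = bal n m := by
  induction n with
  | zero =>
    intro m hm
    obtain rfl : m = 0 := by omega
    have : ∀ π : Equiv.Perm (Fin 0), Bm 0 π :=
      fun π => ⟨fun ⟨i, _⟩ => i.elim0, fun i => i.elim0⟩
    simp [cA, bal, this]
  | succ n ih =>
    have key : ∀ m ≤ n, ((∑ p ∈ Finset.range (m + 1), cA n p : ℕ) : ℤ) = bal (n + 1) m := by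
      intro m hm
      rw [← sum_bal]
      push_cast
      refine Finset.sum_congr rfl fun p hp => ih p ?_
      have := Finset.mem_range.1 hp
      omega
    intro m hm
    rcases Nat.lt_or_ge n m with h | h
    · obtain rfl : m = n + 1 := by omega
      rw [cA_top, key n le_rfl, bal_rec, bal_diag, add_zero]
    · rw [cA_succ n m h, key m h]

theorem bal_cat (n : ℕ) : bal n n = catalan n := by
  cases n with
  | zero => simp [bal]
  | succ n =>
    have h := succ_mul_catalan_eq_centralBinom (n + 1)
    have h2 := Nat.choose_succ_right_eq (2 * (n + 1)) n
    rw [Nat.centralBinom_eq_two_mul_choose] at h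
    simp only [bal]
    have e : n + 1 + n + 1 = 2 * (n + 1) := by ring
    rw [e]
    have e2 : 2 * (n + 1) - n = n + 2 := by omega
    rw [e2] at h2
    zify at h h2
    have : ((n : ℤ) + 2) ≠ 0 := by positivity
    apply mul_left_cancel₀ this
    linear_combination -h + h2

theorem cA_cat (n : ℕ) : cA n n = catalan n := by
  have := cA_bal n n le_rfl
  rw [bal_cat] at this
  exact_mod_cast this

theorem cat_sum (n : ℕ) :
    (∑ x ∈ Finset.Nat.antidiagonalTuple 3 n, catalan (x 0) * catalan (x 1) * catalan (x 2))
      + catalan (n + 1) = catalan (n + 2) := by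
  have h : ∑ x ∈ Finset.Nat.antidiagonalTuple 3 n, catalan (x 0) * catalan (x 1) * catalan (x 2)
      = ∑ y ∈ Finset.HasAntidiagonal.antidiagonal n, catalan y.1 * catalan (y.2 + 1) := by
    simp only [catalan_succ', Finset.mul_sum]
    rw [Finset.sum_sigma']
    refine Finset.sum_bij' (fun x _ => ⟨(x 0, x 1 + x 2), (x 1, x 2)⟩)
      (fun y _ => ![y.1.1, y.2.1, y.2.2]) ?_ ?_ ?_ ?_ ?_
    · intro x hx
      rw [Finset.Nat.mem_antidiagonalTuple, Fin.sum_univ_three] at hx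
      simp; omega
    · rintro ⟨⟨a, b⟩, c, d⟩ hy
      simp at hy
      rw [Finset.Nat.mem_antidiagonalTuple, Fin.sum_univ_three]
      simp; omega
    · intro x _
      ext i; fin_cases i <;> rfl
    · rintro ⟨⟨a, b⟩, c, d⟩ hy
      simp at hy
      obtain ⟨_, rfl⟩ := hy
      rfl
    · intro x _
      simp [mul_assoc]
  rw [h, catalan_succ' (n + 1), Finset.Nat.antidiagonal_succ']
  simp [add_comm]

theorem stmt7 (n : ℕ) :
    Nat.card {π : Equiv.Perm (Fin (n + 2)) // StartSmall π ∧ ¬ Contains123 π}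
      = ∑ x ∈ Finset.Nat.antidiagonalTuple 3 n, catalan (x 0) * catalan (x 1) * catalan (x 2) := by
  classical
  have h1 := cat_sum n
  rw [← cA_cat (n + 1), ← cA_cat (n + 2), cA_top (n + 1), Finset.sum_range_succ _ (n + 1)] at h1
  have h2 := card_via (n := n + 1) (fun π => StartSmall π ∧ ¬ Contains123 π)
    (fun p => p ≠ n + 1) (fun p => p) (by
      intro p σ
      have e := Bm_insP (n + 2) p σ
      have hp : (p : ℕ) < n + 2 := p.isLt
      rw [min_eq_left hp.le] at e
      have e2 : Bm (n + 2) (insP (p, σ)) ↔ ¬ Contains123 (insP (p, σ)) :=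
        ⟨fun h => h.1, fun h => ⟨h, fun i _ _ _ => (insP (p, σ) i).isLt⟩⟩
      have e3 : StartSmall (insP (p, σ)) ↔ (p : ℕ) ≠ n + 1 := by
        have : insP (p, σ) ⟨0, by omega⟩ = p := insP_zero (p, σ)
        unfold StartSmall
        constructor
        · intro h
          have h' := h (by omega)
          rw [this] at h'
          omega
        · intro h _
          rw [this]
          omega
      rw [e2] at e
      rw [e3, e]
      simp only [hp, true_or, and_true]
      exact and_comm)
  rw [Nat.card_eq_fintype_card, Fintype.card_subtype]
  have h4 : (Finset.univ.filter (fun π : Equiv.Perm (Fin (n + 2)) =>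
      StartSmall π ∧ ¬ Contains123 π)).card
      = ∑ p ∈ Finset.range (n + 1 + 1), if p ≠ n + 1 then cA (n + 1) p else 0 := by
    convert h2
  rw [h4, Finset.sum_range_succ]
  have h3 : ∑ p ∈ Finset.range (n + 1), (if p ≠ n + 1 then cA (n + 1) p else 0)
      = ∑ p ∈ Finset.range (n + 1), cA (n + 1) p := by
    refine Finset.sum_congr rfl fun p hp => if_pos ?_
    have := Finset.mem_range.1 hp
    omega
  rw [h3]
  simp only [ne_eq, not_true_eq_false, if_false]
  omega
end

section
/- Let v_n denote the number of start-small permutations of [n] avoiding both 1243 and 2134 (with v_0 = 1, v_1 = 0), let G = Σ_{n≥0} v_n X^n, and let C = Σ_{n≥0} C_n X^n be the Catalan generating function, all as formal power series over ℤ. Then (1 − X·C³)·(G − 1 + X) = X; equivalently, G = 1 + X/(1 − X·C³) − X. -/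
/-- `v n` is the number of start-small permutations of `[n]` avoiding both 1243 and 2134. -/
noncomputable def v (n : ℕ) : ℕ := Nat.card {π : Equiv.Perm (Fin n) // StartSmall π ∧ AvoidsBoth π}

namespace GT

def Act (t : ℕ) {n : ℕ} (σ : Equiv.Perm (Fin n)) : Prop :=
  (∀ a b c : Fin n, a < b → b < c → t ≤ (σ a : ℕ) → (σ a : ℕ) < σ c → (σ c : ℕ) < σ b → False) ∧
  (∀ a b c : Fin n, a < b → b < c → (σ a : ℕ) < t → t ≤ (σ b : ℕ) → (σ b : ℕ) < σ c → False)

def Dc (t : ℕ) {n : ℕ} (σ : Equiv.Perm (Fin n)) : Prop :=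
  ∀ a b : Fin n, a < b → t ≤ (σ a : ℕ) → (σ a : ℕ) < σ b → False

def Ic (t : ℕ) {n : ℕ} (σ : Equiv.Perm (Fin n)) : Prop :=
  ∀ a b : Fin n, a < b → t ≤ (σ b : ℕ) → (σ b : ℕ) < σ a → False

theorem Dc.act {t n : ℕ} {σ : Equiv.Perm (Fin n)} (h : Dc t σ) : Act t σ := by
  refine ⟨fun a b c hab hbc h1 h2 h3 => h a b hab h1 (by omega), fun a b c hab hbc h1 h2 h3 => ?_⟩
  exact h b c hbc h2 h3

def insFun {n : ℕ} (t : Fin (n+1)) (σ : Equiv.Perm (Fin n)) : Fin (n+1) → Fin (n+1) :=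
  Fin.cons t (fun i => t.succAbove (σ i))

theorem insFun_inj {n : ℕ} (t : Fin (n+1)) (σ : Equiv.Perm (Fin n)) :
    Function.Injective (insFun t σ) := by
  rw [insFun, Fin.cons_injective_iff]
  refine ⟨?_, fun a b h => ?_⟩
  · rintro ⟨i, hi⟩
    exact Fin.succAbove_ne _ _ hi
  · exact σ.injective (Fin.succAbove_right_injective h)

noncomputable def ins {n : ℕ} (t : Fin (n+1)) (σ : Equiv.Perm (Fin n)) : Equiv.Perm (Fin (n+1)) :=
  Equiv.ofBijective (insFun t σ) (Finite.injective_iff_bijective.1 (insFun_inj t σ))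

@[simp] theorem ins_zero {n : ℕ} (t : Fin (n+1)) (σ : Equiv.Perm (Fin n)) : ins t σ 0 = t := rfl

theorem ins_succ' {n : ℕ} (t : Fin (n+1)) (σ : Equiv.Perm (Fin n)) (i : Fin n) :
    ins t σ i.succ = t.succAbove (σ i) := rfl

theorem ins_succ {n : ℕ} (t : Fin (n+1)) (σ : Equiv.Perm (Fin n)) (i : Fin n) :
    (ins t σ i.succ : ℕ) = if (σ i : ℕ) < t then (σ i : ℕ) else σ i + 1 := by
  rw [ins_succ', Fin.succAbove]
  simp only [Fin.lt_def, Fin.val_castSucc]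
  split_ifs <;> simp

theorem ins_bij (n : ℕ) : Function.Bijective
    (fun p : Equiv.Perm (Fin n) × Fin (n+1) => ins p.2 p.1) := by
  rw [Fintype.bijective_iff_injective_and_card]
  constructor
  · rintro ⟨σ, t⟩ ⟨σ', t'⟩ h
    simp only at h
    have h0 : t = t' := by simpa using congrArg (fun e : Equiv.Perm (Fin (n+1)) => e 0) h
    subst h0
    congr 1
    ext i
    have := congrArg (fun e : Equiv.Perm (Fin (n+1)) => e i.succ) h
    simp only [ins_succ'] at this
    rw [Fin.succAbove_right_injective this]
  · simp [Fintype.card_perm, Nat.factorial_succ, mul_comm]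

noncomputable def insE (n : ℕ) : Equiv.Perm (Fin n) × Fin (n+1) ≃ Equiv.Perm (Fin (n+1)) :=
  Equiv.ofBijective _ (ins_bij n)

theorem avoids_ins {n : ℕ} (t : Fin (n+1)) (σ : Equiv.Perm (Fin n)) :
    AvoidsBoth (ins t σ) ↔ AvoidsBoth σ ∧ Act t σ := by
  simp only [AvoidsBoth, Contains1243, Contains2134, Act, not_exists]
  simp only [Fin.forall_fin_succ (n := n), Fin.lt_def, Fin.val_succ, Fin.val_zero, ins_zero, ins_succ]
  constructor
  · rintro ⟨h1, h2⟩
    refine ⟨⟨fun i j k l => ?_, fun i j k l => ?_⟩, fun a b c => ?_, fun a b c => ?_⟩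
    · have := (h1.2 i).2 j |>.2 k |>.2 l
      grind
    · have := (h2.2 i).2 j |>.2 k |>.2 l
      grind
    · have := h1.1.2 a |>.2 b |>.2 c
      grind
    · have := h2.1.2 a |>.2 b |>.2 c
      grind
  · rintro ⟨⟨h1, h2⟩, h3, h4⟩
    refine ⟨⟨⟨by simp, fun a => ⟨by simp, fun b => ⟨by simp, fun c => ?_⟩⟩⟩, fun i => ⟨by simp, fun j => ⟨by simp, fun k => ⟨by simp, fun l => ?_⟩⟩⟩⟩, 
      ⟨⟨by simp, fun a => ⟨by simp, fun b => ⟨by simp, fun c => ?_⟩⟩⟩, fun i => ⟨by simp, fun j => ⟨by simp, fun k => ⟨by simp, fun l => ?_⟩⟩⟩⟩⟩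
    · have := h3 a b c
      grind
    · have := h1 i j k l
      grind
    · have := h4 a b c
      grind
    · have := h2 i j k l
      grind

theorem act_le {n : ℕ} (t : Fin (n+1)) (σ : Equiv.Perm (Fin n)) (s : ℕ) (hs : s ≤ t) :
    Act s (ins t σ) ↔ Act s σ ∧ Ic t σ := by
  simp only [Act, Ic]
  simp only [Fin.forall_fin_succ (n := n), Fin.lt_def, Fin.val_succ, Fin.val_zero, ins_zero, ins_succ]
  constructor
  · rintro ⟨h1, h2⟩
    refine ⟨⟨fun a b c => ?_, fun a b c => ?_⟩, fun a b => ?_⟩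
    · have := h1.2 a |>.2 b |>.2 c
      grind
    · have := h2.2 a |>.2 b |>.2 c
      grind
    · have := h1.1.2 a |>.2 b
      grind
  · rintro ⟨⟨h1, h2⟩, h3⟩
    refine ⟨⟨⟨by simp, fun a => ⟨by simp, fun b => ?_⟩⟩, fun i => ⟨by simp, fun j => ⟨by simp, fun k => ?_⟩⟩⟩, 
      ⟨⟨by simp, fun a => ⟨by simp, fun b => ?_⟩⟩, fun i => ⟨by simp, fun j => ⟨by simp, fun k => ?_⟩⟩⟩⟩
    · have := h3 a b
      grind
    · have := h1 i j k
      grind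
    · grind
    · have := h2 i j k
      grind

theorem act_gt {n : ℕ} (t : Fin (n+1)) (σ : Equiv.Perm (Fin n)) (s : ℕ) (hs : (t:ℕ) < s + 1) :
    Act (s+1) (ins t σ) ↔ Dc s σ := by
  constructor
  · rintro ⟨h1, h2⟩ a b hab ha hb
    have := h2 0 a.succ b.succ (by simp) (by simpa using hab)
    simp only [ins_zero, ins_succ] at this
    grind
  · intro h
    simp only [Act]
    simp only [Fin.forall_fin_succ (n := n), Fin.lt_def, Fin.val_succ, Fin.val_zero, ins_zero, ins_succ]
    simp only [Dc, Fin.lt_def] at h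
    refine ⟨⟨⟨by simp, fun a => ⟨by simp, fun b => ?_⟩⟩, fun i => ⟨by simp, fun j => ⟨by simp, fun k => ?_⟩⟩⟩, 
      ⟨⟨by simp, fun a => ⟨by simp, fun b => ?_⟩⟩, fun i => ⟨by simp, fun j => ⟨by simp, fun k => ?_⟩⟩⟩⟩
    · grind
    · have := h i j
      grind
    · have := h a b
      grind
    · have := h j k
      grind

theorem dc_gt {n : ℕ} (t : Fin (n+1)) (σ : Equiv.Perm (Fin n)) (s : ℕ) (hs : (t:ℕ) < s + 1) :
    Dc (s+1) (ins t σ) ↔ Dc s σ := by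
  simp only [Dc]
  simp only [Fin.forall_fin_succ (n := n), Fin.lt_def, Fin.val_succ, Fin.val_zero, ins_zero, ins_succ]
  constructor
  · rintro h a b
    have := h.2 a |>.2 b
    grind
  · intro h
    refine ⟨⟨by simp, fun a => ?_⟩, fun i => ⟨by simp, fun j => ?_⟩⟩
    · grind
    · have := h i j
      grind

theorem dc_le {n : ℕ} (t : Fin (n+1)) (σ : Equiv.Perm (Fin n)) (s : ℕ) (hs : s ≤ t) 
    (ht : (t:ℕ) < n) : ¬ Dc s (ins t σ) := by
  intro h
  have := h 0 (σ.symm ⟨t, ht⟩).succ (by simp)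
  simp only [ins_zero, ins_succ] at this
  grind

theorem dc_last {n : ℕ} (t : Fin (n+1)) (σ : Equiv.Perm (Fin n)) (s : ℕ) (hs : s ≤ t) 
    (ht : (t:ℕ) = n) : Dc s (ins t σ) ↔ Dc s σ := by
  simp only [Dc]
  simp only [Fin.forall_fin_succ (n := n), Fin.lt_def, Fin.val_succ, Fin.val_zero, ins_zero, ins_succ]
  constructor
  · rintro h a b
    have := h.2 a |>.2 b
    grind
  · intro h
    refine ⟨⟨by simp, fun a => ?_⟩, fun i => ⟨by simp, fun j => ?_⟩⟩
    · grind
    · have := h i j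
      grind

theorem ic_gt {n : ℕ} (t : Fin (n+1)) (σ : Equiv.Perm (Fin n)) (s : ℕ) (hs : (t:ℕ) < s + 1) :
    Ic (s+1) (ins t σ) ↔ Ic s σ := by
  simp only [Ic]
  simp only [Fin.forall_fin_succ (n := n), Fin.lt_def, Fin.val_succ, Fin.val_zero, ins_zero, ins_succ]
  constructor
  · rintro h a b
    have := h.2 a |>.2 b
    grind
  · intro h
    refine ⟨⟨by simp, fun a => ?_⟩, fun i => ⟨by simp, fun j => ?_⟩⟩
    · grind
    · have := h i j
      grind

theorem ic_lt {n : ℕ} (t : Fin (n+1)) (σ : Equiv.Perm (Fin n)) (s : ℕ) (hs : s < t) :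
    ¬ Ic s (ins t σ) := by
  intro h
  have := h 0 (σ.symm ⟨s, by omega⟩).succ (by simp)
  simp only [ins_zero, ins_succ] at this
  grind

theorem ic_eq {n : ℕ} (t : Fin (n+1)) (σ : Equiv.Perm (Fin n)) :
    Ic t (ins t σ) ↔ Ic t σ := by
  simp only [Ic]
  simp only [Fin.forall_fin_succ (n := n), Fin.lt_def, Fin.val_succ, Fin.val_zero, ins_zero, ins_succ]
  constructor
  · rintro h a b
    have := h.2 a |>.2 b
    grind
  · intro h
    refine ⟨⟨by simp, fun a => ?_⟩, fun i => ⟨by simp, fun j => ?_⟩⟩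
    · grind
    · have := h i j
      grind

structure St {n : ℕ} (σ : Equiv.Perm (Fin n)) (j K m : ℕ) : Prop where
  hn : n = m + K + 1
  dc : ∀ t, t ≤ n → (Dc t σ ↔ m ≤ t)
  cj : ∀ [DecidablePred fun t => Act t σ], ((Finset.range m).filter (fun t => Act t σ)).card = j
  ic : Ic (m + K) σ
  icn : Ic n σ
  ics : 1 ≤ K → ∀ t, t < m + K → ¬ Ic t σ
  ic0 : K = 0 → 1 ≤ j → ∃ t0, t0 < m ∧ Act t0 σ ∧ Ic t0 σ ∧
    ∀ t, t < m → Act t σ → t ≠ t0 → t < t0 ∧ ¬ Ic t σ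

theorem ic_top {n : ℕ} (σ : Equiv.Perm (Fin n)) : Ic n σ := by
  intro a b _ h
  omega

open Classical in
theorem St.top {n : ℕ} {σ : Equiv.Perm (Fin n)} {j K m : ℕ} (h : St σ j K m) (t : Fin (n+1))
    (ht : (t:ℕ) = n) : St (ins t σ) j (K+1) m := by
  have hn := h.hn
  refine ⟨by omega, ?_, ?_, ?_, ic_top _, ?_, by omega⟩
  · intro s hs
    rcases Nat.lt_or_ge n s with h1 | h1
    · obtain ⟨s, rfl⟩ : ∃ s', s = s' + 1 := ⟨s - 1, by omega⟩
      rw [dc_gt _ _ _ (by omega), h.dc _ (by omega)]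
      omega
    · rw [dc_last _ _ _ (by omega) ht, h.dc _ h1]
  · intro _
    rw [← h.cj]
    congr 1
    apply Finset.filter_congr
    intro s hs
    rw [Finset.mem_range] at hs
    rw [act_le _ _ _ (by omega), ht]
    simp [h.icn]
  · have : m + (K+1) = (t:ℕ) := by omega
    rw [this, ic_eq, ht]
    exact h.icn
  · intro _ s hs
    exact ic_lt _ _ _ (by omega)

open Classical in
theorem St.snd {n : ℕ} {σ : Equiv.Perm (Fin n)} {j K m : ℕ} (h : St σ j K m) (t : Fin (n+1))
    (ht : (t:ℕ) = m + K) : St (ins t σ) (j+K+1) 0 n := by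
  have hn := h.hn
  have hact : ∀ s, s < n → (Act s (ins t σ) ↔ Act s σ) := by
    intro s hs
    rw [act_le _ _ _ (by omega), ht]
    simp [h.ic]
  refine ⟨by omega, ?_, ?_, ?_, ic_top _, by omega, ?_⟩
  · intro s hs
    rcases Nat.lt_or_ge (m+K) s with h1 | h1
    · obtain ⟨s, rfl⟩ : ∃ s', s = s' + 1 := ⟨s - 1, by omega⟩
      rw [dc_gt _ _ _ (by omega), h.dc _ (by omega)]
      omega
    · have := dc_le t σ s (by omega) (by omega)
      simp only [this, false_iff]
      omega
  · intro _
    have : (Finset.range n).filter (fun s => Act s (ins t σ)) =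
        (Finset.range m).filter (fun s => Act s σ) ∪ Finset.Ico m n := by
      ext s
      simp only [Finset.mem_filter, Finset.mem_range, Finset.mem_union, Finset.mem_Ico]
      constructor
      · rintro ⟨h1, h2⟩
        rw [hact s h1] at h2
        by_cases h3 : s < m
        · exact Or.inl ⟨h3, h2⟩
        · right; omega
      · rintro (⟨h1, h2⟩ | ⟨h1, h2⟩)
        · exact ⟨by omega, (hact s (by omega)).2 h2⟩
        · exact ⟨h2, (hact s h2).2 ((h.dc s (by omega)).2 h1).act⟩
    rw [this, Finset.card_union_of_disjoint, h.cj, Nat.card_Ico]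
    · omega
    · rw [Finset.disjoint_left]
      intro s hs
      simp only [Finset.mem_filter, Finset.mem_range] at hs
      simp only [Finset.mem_Ico]
      omega
  · have : n + 0 = (m + K) + 1 := by omega
    rw [this, ic_gt _ _ _ (by omega)]
    exact h.ic
  · intro _ _
    refine ⟨t, by omega, ?_, ?_, ?_⟩
    · rw [hact _ (by omega)]
      exact ((h.dc _ (by omega)).2 (by omega)).act
    · rw [ic_eq, ht]
      exact h.ic
    · intro s hs _ hst
      exact ⟨by omega, ic_lt _ _ _ (by omega)⟩

open Classical in
theorem St.mid {n : ℕ} {σ : Equiv.Perm (Fin n)} {j K m : ℕ} (h : St σ j K m) (t : Fin (n+1))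
    (ht : m ≤ t) (ht2 : (t:ℕ) < m + K) : St (ins t σ) 0 (m + K - t) (t+1) := by
  have hn := h.hn
  have hic : ∀ s, s < m + K → ¬ Ic s σ := h.ics (by omega)
  refine ⟨by omega, ?_, ?_, ?_, ic_top _, ?_, by omega⟩
  · intro s hs
    rcases Nat.lt_or_ge t s with h1 | h1
    · obtain ⟨s, rfl⟩ : ∃ s', s = s' + 1 := ⟨s - 1, by omega⟩
      rw [dc_gt _ _ _ (by omega), h.dc _ (by omega)]
      omega
    · have := dc_le t σ s (by omega) (by omega)
      simp only [this, false_iff]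
      omega
  · intro _
    rw [Finset.card_eq_zero, Finset.filter_eq_empty_iff]
    intro s hs
    rw [Finset.mem_range] at hs
    rw [act_le _ _ _ (by omega)]
    have := hic t ht2
    tauto
  · have : (t : ℕ) + 1 + (m + K - t) = (m + K) + 1 := by omega
    rw [this, ic_gt _ _ _ (by omega)]
    exact h.ic
  · intro _ s hs
    rcases Nat.lt_trichotomy s t with h1 | h1 | h1
    · exact ic_lt _ _ _ h1
    · rw [h1, ic_eq]
      exact hic _ ht2
    · obtain ⟨s, rfl⟩ : ∃ s', s = s' + 1 := ⟨s - 1, by omega⟩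
      rw [ic_gt _ _ _ (by omega)]
      exact hic _ (by omega)

open Classical in
theorem St.lowN {n : ℕ} {σ : Equiv.Perm (Fin n)} {j K m : ℕ} (h : St σ j K m) (t : Fin (n+1))
    (ht : (t:ℕ) < m) (hi : ¬ Ic t σ) : St (ins t σ) 0 K (m+1) := by
  have hn := h.hn
  refine ⟨by omega, ?_, ?_, ?_, ic_top _, ?_, by omega⟩
  · intro s hs
    rcases Nat.lt_or_ge t s with h1 | h1
    · obtain ⟨s, rfl⟩ : ∃ s', s = s' + 1 := ⟨s - 1, by omega⟩
      rw [dc_gt _ _ _ (by omega), h.dc _ (by omega)]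
      omega
    · have := dc_le t σ s (by omega) (by omega)
      simp only [this, false_iff]
      omega
  · intro _
    rw [Finset.card_eq_zero, Finset.filter_eq_empty_iff]
    intro s hs
    rw [Finset.mem_range] at hs
    rcases Nat.lt_or_ge t s with h1 | h1
    · obtain ⟨s, rfl⟩ : ∃ s', s = s' + 1 := ⟨s - 1, by omega⟩
      rw [act_gt _ _ _ (by omega), h.dc _ (by omega)]
      omega
    · rw [act_le _ _ _ (by omega)]
      tauto
  · have : m + 1 + K = (m + K) + 1 := by omega
    rw [this, ic_gt _ _ _ (by omega)]
    exact h.ic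
  · intro hK s hs
    rcases Nat.lt_trichotomy s t with h1 | h1 | h1
    · exact ic_lt _ _ _ h1
    · rw [h1, ic_eq]
      exact hi
    · obtain ⟨s, rfl⟩ : ∃ s', s = s' + 1 := ⟨s - 1, by omega⟩
      rw [ic_gt _ _ _ (by omega)]
      exact h.ics hK _ (by omega)

open Classical in
theorem St.lowI {n : ℕ} {σ : Equiv.Perm (Fin n)} {j m : ℕ} (h : St σ j 0 m) (t : Fin (n+1))
    (ht : (t:ℕ) < m) (ha : Act t σ) (hi : Ic t σ)
    (hall : ∀ s, s < m → Act s σ → s ≠ t → s < t ∧ ¬ Ic s σ) : St (ins t σ) j 0 (m+1) := by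
  have hn := h.hn
  have hact : ∀ s, s < m + 1 → (Act s (ins t σ) ↔ s ≤ t ∧ Act s σ) := by
    intro s hs
    rcases Nat.lt_or_ge t s with h1 | h1
    · obtain ⟨s, rfl⟩ : ∃ s', s = s' + 1 := ⟨s - 1, by omega⟩
      rw [act_gt _ _ _ (by omega), h.dc _ (by omega)]
      omega
    · rw [act_le _ _ _ (by omega)]
      tauto
  refine ⟨by omega, ?_, ?_, ?_, ic_top _, by omega, ?_⟩
  · intro s hs
    rcases Nat.lt_or_ge t s with h1 | h1
    · obtain ⟨s, rfl⟩ : ∃ s', s = s' + 1 := ⟨s - 1, by omega⟩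
      rw [dc_gt _ _ _ (by omega), h.dc _ (by omega)]
      omega
    · have := dc_le t σ s (by omega) (by omega)
      simp only [this, false_iff]
      omega
  · intro _
    rw [← h.cj]
    congr 1
    ext s
    simp only [Finset.mem_filter, Finset.mem_range]
    constructor
    · rintro ⟨h1, h2⟩
      rw [hact s h1] at h2
      exact ⟨by omega, h2.2⟩
    · rintro ⟨h1, h2⟩
      refine ⟨by omega, (hact s (by omega)).2 ⟨?_, h2⟩⟩
      by_contra h3
      have := (hall s h1 h2 (by omega)).1
      omega
  · rw [ic_gt _ _ _ (by omega)]
    exact h.ic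
  · intro _ _
    refine ⟨t, by omega, (hact _ (by omega)).2 ⟨le_rfl, ha⟩, (ic_eq _ _).2 hi, ?_⟩
    intro s hs h2 h3
    have := ((hact s hs).1 h2).1
    exact ⟨by omega, ic_lt _ _ _ (by omega)⟩

theorem St.root (σ : Equiv.Perm (Fin 1)) : St σ 0 0 0 := by
  refine ⟨rfl, ?_, ?_, ?_, ic_top _, by omega, by omega⟩
  · intro t _
    simp only [zero_le, iff_true]
    intro a b hab
    omega
  · intro _
    simp
  · intro a b hab
    omega

section
open Classical

noncomputable def cnt : ℕ → {n : ℕ} → Equiv.Perm (Fin n) → ℤ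
  | 0, _, _ => 1
  | d+1, n, σ => ∑ t : Fin (n+1), if Act t σ then cnt d (ins t σ) else 0

noncomputable def f (n : ℕ) : ℤ := ∑ σ : Equiv.Perm (Fin n), if AvoidsBoth σ then 1 else 0

theorem sum_ins {n : ℕ} (g : Equiv.Perm (Fin (n+1)) → ℤ) :
    ∑ τ, g τ = ∑ σ : Equiv.Perm (Fin n), ∑ t : Fin (n+1), g (ins t σ) := by
  rw [← Fintype.sum_prod_type' (f := fun σ t => g (ins t σ))]
  exact ((insE n).sum_comp g).symm

theorem sum_cnt (d : ℕ) : ∀ n : ℕ,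
    (∑ σ : Equiv.Perm (Fin n), if AvoidsBoth σ then cnt d σ else 0) = f (n + d) := by
  induction d with
  | zero => intro n; rfl
  | succ d ih =>
    intro n
    rw [show n + (d+1) = n + 1 + d by omega, ← ih (n+1), sum_ins]
    apply Finset.sum_congr rfl
    intro σ _
    simp only [avoids_ins, cnt]
    by_cases h : AvoidsBoth σ <;> simp [h]

theorem act_top {n : ℕ} (σ : Equiv.Perm (Fin n)) : Act n σ := by
  refine ⟨fun a b c _ _ h => ?_, fun a b c _ _ _ h => ?_⟩ <;> omega

theorem f_one (d : ℕ) (σ : Equiv.Perm (Fin 1)) : f (d+1) = cnt d σ := by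
  rw [add_comm, ← sum_cnt, Fintype.sum_eq_single σ]
  · rw [if_pos]
    constructor <;> rintro ⟨i, j, k, l, h, _⟩ <;> omega
  · intro τ h
    exact absurd (Subsingleton.elim _ _) h

theorem v_succ (n : ℕ) : (v (n+1) : ℤ) = f (n+1) - f n := by
  have h1 : (v (n+1) : ℤ) = ∑ τ : Equiv.Perm (Fin (n+1)), if StartSmall τ ∧ AvoidsBoth τ then 1 else 0 := by
    rw [v, Nat.card_eq_fintype_card, Fintype.card_subtype]
    simp
  rw [h1, f, f, sum_ins, sum_ins, ← Finset.sum_sub_distrib]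
  apply Finset.sum_congr rfl
  intro σ _
  rw [Fin.sum_univ_castSucc, Fin.sum_univ_castSucc]
  have hs : ∀ t : Fin (n+1), StartSmall (ins t σ) ↔ (t:ℕ) ≠ n := by
    intro t
    constructor
    · intro h
      have := h (Nat.succ_pos n)
      intro h2
      apply this
      change ((ins t σ 0 : Fin (n+1)) : ℕ) + 1 = n + 1
      rw [ins_zero, h2]
    · intro h _ h2
      change ((ins t σ 0 : Fin (n+1)) : ℕ) + 1 = n + 1 at h2
      rw [ins_zero] at h2
      omega
  simp only [hs, avoids_ins]
  have hne : ∀ i : Fin n, (i : ℕ) ≠ n := fun i => by omega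
  simp [act_top, hne]

end
section
open PowerSeries

noncomputable def F (C w g : ℤ⟦X⟧) (j K : ℕ) : ℤ⟦X⟧ :=
  if K = 0 then g * w + (j : ℤ⟦X⟧) * (g * (w - 1))
  else w * C ^ (K+2) - g * (w - 1) + (j : ℤ⟦X⟧) * (X * w * C ^ (K+3))

theorem F_zero (C w g : ℤ⟦X⟧) (j : ℕ) : F C w g j 0 = g * w + (j : ℤ⟦X⟧) * (g * (w - 1)) := by simp [F]
theorem F_succ (C w g : ℤ⟦X⟧) (j K : ℕ) : F C w g j (K+1) =
    w * C ^ (K+3) - g * (w - 1) + (j : ℤ⟦X⟧) * (X * w * C ^ (K+4)) := by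
  simp [F]

theorem F_sum (C w g : ℤ⟦X⟧) (hC : C = 1 + X * C ^ 2) (K : ℕ) :
    X * ∑ i ∈ Finset.range K, F C w g 0 (i+1) =
      w * (C ^ (K+1) - C) - (K : ℤ⟦X⟧) * (X * (g * (w-1))) := by
  induction K with
  | zero => simp
  | succ K ih =>
    rw [Finset.sum_range_succ, mul_add, ih, F_succ]
    push_cast
    linear_combination (-w * C ^ (K+1)) * hC

theorem F_eq (C w g : ℤ⟦X⟧) (hC : C = 1 + X * C ^ 2) (hw : (1 - X * C ^ 3) * w = 1)
    (hg : (1 - X) * g = 1) (j K : ℕ) :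
    F C w g j K = 1 + X * (F C w g j (K+1) + F C w g (j+K+1) 0
      + ∑ i ∈ Finset.range K, F C w g 0 (i+1)
      + if K = 0 then F C w g j 0 + ((j : ℤ⟦X⟧) - 1) * F C w g 0 0 else (j : ℤ⟦X⟧) * F C w g 0 K) := by
  have hx : (1 - X) * (1 - X * C ^ 3) * (g * w) = (1 : ℤ⟦X⟧) := by
    linear_combination hw * ((1 - X) * g) + hg
  cases K with
  | zero =>
    have h1 : g * w = 1 + X * (w * C ^ 3 + g * w) := by
      linear_combination w * hg + hw
    have h2 : g * (w - 1) = X * (X * w * C ^ 4 + 2 * (g * (w - 1)) + g * w) := by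
      generalize (X : ℤ⟦X⟧) = x at *
      grind
    simp only [F_zero, F_succ, if_true, Finset.range_zero, Finset.sum_empty]
    push_cast
    linear_combination h1 + (j : ℤ⟦X⟧) * h2
  | succ K =>
    have h1 : 1 + X * g * w - w * C + g * w - g = 0 := by
      generalize (X : ℤ⟦X⟧) = x at *
      grind
    have hs := F_sum C w g hC (K+1)
    rw [if_neg (by omega), mul_add, mul_add, hs]
    simp only [F_zero, F_succ]
    push_cast
    linear_combination (w * C ^ (K+2) + (j : ℤ⟦X⟧) * (X * w * C ^ (K+3))) * hC - h1

open Classical in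
theorem cnt_eq (C w g : ℤ⟦X⟧) (hC : C = 1 + X * C ^ 2) (hw : (1 - X * C ^ 3) * w = 1)
    (hg : (1 - X) * g = 1) (d : ℕ) : ∀ (n : ℕ) (σ : Equiv.Perm (Fin n)) (j K m : ℕ),
    St σ j K m → cnt d σ = coeff d (F C w g j K) := by
  induction d with
  | zero =>
    intro n σ j K m _
    rw [F_eq C w g hC hw hg]
    simp [cnt]
  | succ d ih =>
    intro n σ j K m h
    have hn := h.hn
    subst hn
    rw [F_eq C w g hC hw hg, map_add, coeff_succ_X_mul, coeff_one, if_neg (by omega), zero_add, cnt]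
    -- the low part
    have key : ∀ c : ℕ → ℤ,
        (∀ t : Fin (m+K+1+1), Act t σ → cnt d (ins t σ) = c t) →
        ∑ t : Fin (m+K+1+1), (if Act t σ then cnt d (ins t σ) else 0)
        = (∑ t ∈ Finset.range m, if Act t σ then c t else 0) +
          (∑ i ∈ Finset.range K, c (m+i)) + c (m+K) + c (m+K+1) := by
      intro c hc
      have : ∀ t : Fin (m+K+1+1), (if Act t σ then cnt d (ins t σ) else 0) =
          (fun s : ℕ => if Act s σ then c s else 0) t := by
        intro t
        by_cases ha : Act t σ
        · simp [ha, hc t ha]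
        · simp [ha]
      rw [Finset.sum_congr rfl (fun t _ => this t), Fin.sum_univ_eq_sum_range
        (fun s : ℕ => if Act s σ then c s else 0), Finset.sum_range_succ, Finset.sum_range_succ,
        Finset.sum_range_add]
      have ha : ∀ s, m ≤ s → s ≤ m + K + 1 → Act s σ := fun s h1 h2 => ((h.dc s h2).2 h1).act
      rw [if_pos (ha _ (by omega) (by omega)), if_pos (ha _ (by omega) (by omega))]
      congr 3
      apply Finset.sum_congr rfl
      intro i hi
      rw [Finset.mem_range] at hi
      rw [if_pos (ha _ (by omega) (by omega))]
    have hsum : ∑ i ∈ Finset.range K, coeff d (F C w g 0 (m + K - (m+i)))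
        = coeff d (∑ i ∈ Finset.range K, F C w g 0 (i+1)) := by
      rw [map_sum, ← Finset.sum_range_reflect]
      apply Finset.sum_congr rfl
      intro i hi
      rw [Finset.mem_range] at hi
      congr 2
      omega
    by_cases hK : K = 0
    · subst hK
      rw [if_pos rfl]
      rw [key (fun t => if t < m then
          (if Ic t σ then coeff d (F C w g j 0) else coeff d (F C w g 0 0)) else
          if t = m then coeff d (F C w g (j+0+1) 0) else coeff d (F C w g j (0+1)))]
      · have hlow : (∑ t ∈ Finset.range m, if Act t σ then (if t < m then
          (if Ic t σ then coeff d (F C w g j 0) else coeff d (F C w g 0 0)) else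
          if t = m then coeff d (F C w g (j+0+1) 0) else coeff d (F C w g j (0+1))) else 0)
            = coeff d (F C w g j 0) + (j - 1) * coeff d (F C w g 0 0) := by
          have hcj := h.cj
          rw [← Finset.sum_filter]
          rcases Nat.eq_zero_or_pos j with hj | hj
          · rw [hj, Finset.card_eq_zero] at hcj
            rw [hcj, hj]
            simp
          · obtain ⟨t0, h1, h2, h3, h4⟩ := h.ic0 rfl hj
            have hmem : t0 ∈ (Finset.range m).filter (fun t => Act t σ) := by simp [h1, h2]
            rw [← Finset.add_sum_erase _ _ hmem, if_pos h1, if_pos h3]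
            congr 1
            rw [Finset.sum_congr rfl (g := fun _ => coeff d (F C w g 0 0)), Finset.sum_const,
              Finset.card_erase_of_mem hmem, hcj]
            · simp [Nat.cast_sub hj]
            · intro s hs
              simp only [Finset.mem_erase, Finset.mem_filter, Finset.mem_range] at hs
              rw [if_pos hs.2.1, if_neg (h4 s hs.2.1 hs.2.2 hs.1).2]
        rw [hlow]
        have e1 : ((j : ℤ⟦X⟧) - 1) * F C w g 0 0 = PowerSeries.C ((j:ℤ) - 1) * F C w g 0 0 := by
          simp
        rw [e1]
        simp only [map_add, PowerSeries.coeff_C_mul]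
        simp
        ring
      · intro t ha
        by_cases h1 : (t:ℕ) < m
        · rw [if_pos h1]
          by_cases h2 : Ic t σ
          · rw [if_pos h2]
            apply ih _ _ _ _ (m+1)
            apply h.lowI t h1 ha h2
            have hj : 1 ≤ j := by
              rw [← h.cj]
              exact Finset.card_pos.2 ⟨t, by simp [h1, ha]⟩
            obtain ⟨t0, k1, k2, k3, k4⟩ := h.ic0 rfl hj
            have : (t:ℕ) = t0 := by
              by_contra hne
              exact (k4 t h1 ha hne).2 h2
            rw [this]
            exact k4
          · rw [if_neg h2]
            exact ih _ _ _ _ _ (h.lowN t h1 h2)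
        · rw [if_neg h1]
          by_cases h2 : (t:ℕ) = m
          · rw [if_pos h2]
            exact ih _ _ _ _ _ (h.snd t h2)
          · rw [if_neg h2]
            exact ih _ _ _ _ _ (h.top t (by omega))
    · rw [if_neg hK]
      rw [key (fun t => if t < m then coeff d (F C w g 0 K) else
          if t < m + K then coeff d (F C w g 0 (m + K - t)) else
          if t = m + K then coeff d (F C w g (j+K+1) 0) else coeff d (F C w g j (K+1)))]
      · have hlow : (∑ t ∈ Finset.range m, if Act t σ then (if t < m then coeff d (F C w g 0 K) else
          if t < m + K then coeff d (F C w g 0 (m + K - t)) else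
          if t = m + K then coeff d (F C w g (j+K+1) 0) else coeff d (F C w g j (K+1))) else 0)
            = j * coeff d (F C w g 0 K) := by
          rw [← Finset.sum_filter, Finset.sum_congr rfl (g := fun _ => coeff d (F C w g 0 K)),
            Finset.sum_const, h.cj]
          · simp
          · intro s hs
            simp only [Finset.mem_filter, Finset.mem_range] at hs
            rw [if_pos hs.1]
        have hmid : (∑ i ∈ Finset.range K, if m + i < m then coeff d (F C w g 0 K) else
          if m + i < m + K then coeff d (F C w g 0 (m + K - (m + i))) else
          if m + i = m + K then coeff d (F C w g (j+K+1) 0) else coeff d (F C w g j (K+1)))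
            = coeff d (∑ i ∈ Finset.range K, F C w g 0 (i+1)) := by
          rw [← hsum]
          apply Finset.sum_congr rfl
          intro i hi
          rw [Finset.mem_range] at hi
          rw [if_neg (by omega), if_pos (by omega)]
        rw [hlow, hmid]
        have e1 : (j : ℤ⟦X⟧) * F C w g 0 K = PowerSeries.C (j:ℤ) * F C w g 0 K := by
          simp
        rw [e1]
        rw [if_neg (by omega), if_neg (by omega), if_pos rfl, if_neg (by omega), if_neg (by omega),
          if_neg (by omega)]
        simp only [map_add, PowerSeries.coeff_C_mul]
        ring
      · intro t ha
        by_cases h1 : (t:ℕ) < m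
        · rw [if_pos h1]
          exact ih _ _ _ _ _ (h.lowN t h1 (h.ics (by omega) _ (by omega)))
        · rw [if_neg h1]
          by_cases h2 : (t:ℕ) < m + K
          · rw [if_pos h2]
            exact ih _ _ _ _ _ (h.mid t (by omega) h2)
          · rw [if_neg h2]
            by_cases h3 : (t:ℕ) = m + K
            · rw [if_pos h3]
              exact ih _ _ _ _ _ (h.snd t h3)
            · rw [if_neg h3]
              exact ih _ _ _ _ _ (h.top t (by omega))

theorem exists_inv (a : ℤ⟦X⟧) (h : constantCoeff a = 1) : ∃ b, a * b = 1 := by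
  have : IsUnit a := by
    rw [PowerSeries.isUnit_iff_constantCoeff, h]
    exact isUnit_one
  exact this.exists_right_inv

theorem f_zero : f 0 = 1 := by
  have : ∀ σ : Equiv.Perm (Fin 0), AvoidsBoth σ := by
    intro σ
    constructor <;> rintro ⟨i, _⟩ <;> exact i.elim0
  simp [f, this]

theorem v_zero : v 0 = 1 := by
  have : ∀ σ : Equiv.Perm (Fin 0), StartSmall σ ∧ AvoidsBoth σ := by
    intro σ
    refine ⟨fun h => by omega, ?_⟩
    constructor <;> rintro ⟨i, _⟩ <;> exact i.elim0
  simp [v, this]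

end

end GT

open PowerSeries in
theorem stmt12 :
    let G : ℤ⟦X⟧ := PowerSeries.mk fun n => (v n : ℤ)
    let C : ℤ⟦X⟧ := PowerSeries.mk fun n => (catalan n : ℤ)
    (1 - X * C ^ 3) * (G - 1 + X) = X := by
  intro G C
  have hC : C = 1 + X * C ^ 2 := by
    have h := congrArg (PowerSeries.map (Nat.castRingHom ℤ)) catalanSeries_sq_mul_X_add_one
    have h2 : PowerSeries.map (Nat.castRingHom ℤ) catalanSeries = C := by
      ext n
      simp [C]
    simp only [map_add, map_mul, map_pow, map_one, PowerSeries.map_X, h2] at h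
    rw [mul_comm, add_comm] at h
    exact h.symm
  obtain ⟨w, hw⟩ := GT.exists_inv (1 - X * C ^ 3) (by simp)
  obtain ⟨g, hg⟩ := GT.exists_inv (1 - X) (by simp)
  have hf : ∀ d, GT.f (d+1) = coeff d (g * w) := by
    intro d
    rw [GT.f_one d (Equiv.refl _), GT.cnt_eq C w g hC hw hg d _ _ _ _ _ (GT.St.root _), GT.F_zero]
    simp
  have hG : G = (1 - X) * (1 + X * (g * w)) := by
    have hff : ∀ n, GT.f n = coeff n (1 + X * (g * w)) := by
      intro n
      cases n with
      | zero => simp [GT.f_zero]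
      | succ n => rw [hf, map_add, coeff_succ_X_mul, coeff_one]; simp
    rw [sub_mul, one_mul]
    ext n
    cases n with
    | zero => simp [G, GT.v_zero]
    | succ n => rw [map_sub, coeff_succ_X_mul, ← hff, ← hff, ← GT.v_succ]; simp [G]
  rw [hG]
  linear_combination X * hw * (1 - X) * g + X * hg
end
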